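/- Let p,q > 1 satisfy 1/p + 1/q < 2/d if d ≥ 2. Suppose f: Ω → ℝ is continuous and h: Ω → [0,∞) satisfies |f(ω')| ≤ h(ω') for all ω' ∈ Ω. Assume ω ∈ Ω* ∩ Ω_{p,q} is such that sup_{n≥1} n^{-d} Σ_{x∈Λ_n} [h(τ_x(ω))]^α π_ω(x) < ∞ for some α > 1. Then f ∈ L¹(Q_ω) and (1/n) Σ_{k=0}^{n−1} f(τ_{X_k}(ω)) converges to E_{Q_ω}(f) in L¹(P_ω^0) as n → ∞. -/

import Mathlib

open MeasureTheory Filter Topology Matrix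
open scoped ENNReal NNReal

noncomputable section

namespace DetCond

/-- Vertices of `ℤ^d`. -/
abbrev Vert (d : ℕ) := Fin d → ℤ

/-- Index of the (unordered) nearest-neighbour edge `(x, x + e i)` of `ℤ^d`;
the set of these indices is in natural bijection with `E(ℤ^d)` modulo orientation. -/
abbrev EdgeIx (d : ℕ) := Vert d × Fin d

/-- The space `Ω = (0,∞)^{E(ℤ^d)}` of (symmetric) conductance configurations, with
its product topology and product σ-algebra. -/
abbrev EnvSp (d : ℕ) := {ω : EdgeIx d → ℝ // ∀ e, 0 < ω e}

/-- The `i`-th coordinate unit vector of `ℤ^d`. -/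
def unitv (d : ℕ) (i : Fin d) : Vert d := fun j => if j = i then 1 else 0

/-- The translation `τ_x` acting on environments: `c_{τ_x ω}(y,z) = c_ω(y+x,z+x)`. -/
def shift (d : ℕ) (x : Vert d) (ω : EnvSp d) : EnvSp d :=
  ⟨fun e => ω.1 (e.1 + x, e.2), fun e => ω.2 (e.1 + x, e.2)⟩

/-- The conductance `c_ω(x,y)`; it vanishes when `x,y` are not nearest neighbours
and is symmetric in `x,y` by construction. -/
def cnd (d : ℕ) (ω : EnvSp d) (x y : Vert d) : ℝ :=
  ∑ i, ((if y = x + unitv d i then ω.1 (x, i) else 0) +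
        (if x = y + unitv d i then ω.1 (y, i) else 0))

/-- `π_ω(x) = Σ_{z : (x,z) ∈ E(ℤ^d)} c_ω(x,z)`. -/
def piOf (d : ℕ) (ω : EnvSp d) (x : Vert d) : ℝ :=
  ∑ i, (ω.1 (x, i) + ω.1 (x - unitv d i, i))

/-- The box `Λ_r = [-r,r]^d ∩ ℤ^d`. -/
def box (d : ℕ) (r : ℝ) : Finset (Vert d) :=
  Fintype.piFinset fun _ : Fin d => Finset.Icc ⌈-r⌉ ⌊r⌋

/-- The nearest neighbours of `x` in `ℤ^d`. -/
def nbrs (d : ℕ) (x : Vert d) : Finset (Vert d) :=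
  (Finset.univ.image fun i => x + unitv d i) ∪ (Finset.univ.image fun i => x - unitv d i)

/-- The set `E(Λ)` of edges incident with at least one vertex of `Λ`
(one index per unordered edge). -/
def edgesIn (d : ℕ) (Λ : Finset (Vert d)) : Finset (EdgeIx d) :=
  Λ.biUnion fun x =>
    (Finset.univ.image fun i => (x, i)) ∪ (Finset.univ.image fun i => (x - unitv d i, i))

/-- Bounded functions on `Ω`. -/
def IsBdd (d : ℕ) (f : EnvSp d → ℝ) : Prop := ∃ M, ∀ ω, |f ω| ≤ M

/-- Local functions: `f` depends only on the coordinates in some finite set `B` of edges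
and, viewed as a function of those coordinates, has compact support in `(0,∞)^B`. -/
def IsLocalFn (d : ℕ) (f : EnvSp d → ℝ) : Prop :=
  ∃ B : Finset (EdgeIx d),
    (∀ ω₁ ω₂ : EnvSp d, (∀ e ∈ B, ω₁.1 e = ω₂.1 e) → f ω₁ = f ω₂) ∧
    ∃ a b : ℝ, 0 < a ∧ ∀ ω : EnvSp d, (∃ e ∈ B, ω.1 e < a ∨ b < ω.1 e) → f ω = 0

/-- `ℓ_ω(f) = L`, i.e. the block averages of the translates of `f` converge to `L`. -/
def avgTo (d : ℕ) (ω : EnvSp d) (f : EnvSp d → ℝ) (L : ℝ) : Prop :=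
  Tendsto (fun n : ℕ => (∑ x ∈ box d (n : ℝ), f (shift d x ω)) / ((box d (n : ℝ)).card : ℝ))
    atTop (𝓝 L)

/-- `ω` is averaging: `ℓ_ω(f)` exists for every continuous local `f`. -/
def Averaging (d : ℕ) (ω : EnvSp d) : Prop :=
  ∀ f : EnvSp d → ℝ, Continuous f → IsLocalFn d f → ∃ L, avgTo d ω f L

/-- `ω` is tempered, i.e. `ω ∈ Ω'`. -/
def Tempered (d : ℕ) (ω : EnvSp d) : Prop :=
  Tendsto (fun ε : ℝ =>
      limsup (fun n : ℕ =>
        (∑ e ∈ edgesIn d (box d (n : ℝ)),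
            (if ε ≤ ω.1 e ∧ ω.1 e ≤ ε⁻¹ then (0:ℝ) else 1)) / (n : ℝ) ^ d) atTop)
    (𝓝[>] 0) (𝓝 0)

/-- `P` is the measure `ℙ_ω` associated with an averaging tempered `ω`:
the unique probability measure whose expectation of every bounded continuous function
is the corresponding block-average limit `ℓ_ω(f)`. -/
def IsEnvLaw (d : ℕ) (ω : EnvSp d) (P : Measure (EnvSp d)) : Prop :=
  IsProbabilityMeasure P ∧
    ∀ f : EnvSp d → ℝ, Continuous f → IsBdd d f → avgTo d ω f (∫ ω', f ω' ∂P)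

/-- Ergodicity of a measure on `Ω` with respect to the translations of `ℤ^d`. -/
def ErgodicEnv (d : ℕ) (P : Measure (EnvSp d)) : Prop :=
  ∀ A : Set (EnvSp d), MeasurableSet A → (∀ x : Vert d, shift d x ⁻¹' A = A) →
    P A = 0 ∨ P A = 1

/-- `ω ∈ Ω⋆`: tempered, averaging, and the associated measure `ℙ_ω` is ergodic. -/
def InOmegaStar (d : ℕ) (ω : EnvSp d) : Prop :=
  Tempered d ω ∧ Averaging d ω ∧
    ∀ P : Measure (EnvSp d), IsEnvLaw d ω P → ErgodicEnv d P

/-- `ω ∈ Ω_{p,q}`. -/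
def InOmegaPQ (d : ℕ) (p q : ℝ) (ω : EnvSp d) : Prop :=
  (∃ C : ℝ, ∀ n : ℕ, 1 ≤ n →
      (∑ e ∈ edgesIn d (box d (n : ℝ)), ω.1 e ^ p) / (n : ℝ) ^ d ≤ C) ∧
  (∃ C : ℝ, ∀ n : ℕ, 1 ≤ n →
      (∑ e ∈ edgesIn d (box d (n : ℝ)), ω.1 e ^ (-q)) / (n : ℝ) ^ d ≤ C)

/-- The path space of the discrete-time walk. -/
abbrev Path (d : ℕ) := ℕ → Vert d

/-- One-step transition probabilities `𝖯_ω(x,y) = c_ω(x,y)/π_ω(x)`. -/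
def transP (d : ℕ) (ω : EnvSp d) (x y : Vert d) : ℝ := cnd d ω x y / piOf d ω x

/-- `μ` is the law `P_ω^{x₀}` of the random walk among the conductances `ω`
started at `x₀`: a probability measure on the path space with the prescribed
finite-dimensional (cylinder) probabilities. -/
def IsWalkLaw (d : ℕ) (ω : EnvSp d) (x₀ : Vert d) (μ : Measure (Path d)) : Prop :=
  IsProbabilityMeasure μ ∧
    ∀ (n : ℕ) (γ : ℕ → Vert d),
      μ {w | ∀ k ≤ n, w k = γ k} =
        (if γ 0 = x₀ then 1 else 0) *
          ∏ k ∈ Finset.range n, ENNReal.ofReal (transP d ω (γ k) (γ (k+1)))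

/-- `n`-step transition probabilities of the discrete-time walk. -/
def stepP (d : ℕ) (ω : EnvSp d) : ℕ → Vert d → Vert d → ℝ
  | 0, x, y => if x = y then 1 else 0
  | n+1, x, y => ∑ z ∈ nbrs d x, transP d ω x z * stepP d ω n z y

/-- `P_ω^x(Y_t = y)` for the constant-speed continuous-time walk `Y_t = X_{N(t)}`,
where `N` is an independent rate-1 Poisson process. -/
def ctP (d : ℕ) (ω : EnvSp d) (t : ℝ) (x y : Vert d) : ℝ :=
  ∑' k : ℕ, Real.exp (-t) * t ^ k / (Nat.factorial k : ℝ) * stepP d ω k x y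

/-- The `ℓ¹`-norm of a vertex of `ℤ^d`. -/
def l1 (d : ℕ) (x : Vert d) : ℝ := ∑ i, |(x i : ℝ)|

/-- A vertex of `ℤ^d` regarded as a point of `ℝ^d`. -/
def ivert (d : ℕ) (x : Vert d) : Fin d → ℝ := fun i => (x i : ℝ)

/-- The linearly interpolated diffusively rescaled walk `B^{(n)}`. -/
def BnProc (d : ℕ) (n : ℕ) (w : Path d) (t : ℝ) : Fin d → ℝ :=
  (Real.sqrt n)⁻¹ •
    (ivert d (w ⌊t * n⌋₊) +
      (t * n - (⌊t * n⌋₊ : ℝ)) • (ivert d (w (⌊t * n⌋₊ + 1)) - ivert d (w ⌊t * n⌋₊)))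


/-- The measure `ℚ_ω` obtained from `ℙ_ω` by tilting with `π(0)`. -/
def Qmeas (d : ℕ) (P : Measure (EnvSp d)) : Measure (EnvSp d) :=
  P.withDensity fun ω' => ENNReal.ofReal (piOf d ω' 0 / ∫ ω'', piOf d ω'' 0 ∂P)

/-- The inner product `⟨f,g⟩_{L²(πμ)}`. -/
def innerP (d : ℕ) (P : Measure (EnvSp d)) (f g : EnvSp d → ℝ) : ℝ :=
  ∫ ω', f ω' * g ω' * piOf d ω' 0 ∂P

/-- The Dirichlet pairing `⟨h, (−L)h⟩_{L²(πμ)}`. -/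
def quadL (d : ℕ) (P : Measure (EnvSp d)) (h : EnvSp d → ℝ) : ℝ :=
  ∫ ω', (∑ z ∈ nbrs d 0, cnd d ω' 0 z * (h ω' - h (shift d z ω'))) * h ω' ∂P

/-- The inner product of `L²(ν)`. -/
def innerQ (d : ℕ) (ν : Measure (EnvSp d)) (f g : EnvSp d → ℝ) : ℝ :=
  ∫ ω', f ω' * g ω' ∂ν

/-- The Dirichlet pairing `⟨h, (−L)h⟩_{L²(ν)}`. -/
def quadQ (d : ℕ) (ν : Measure (EnvSp d)) (h : EnvSp d → ℝ) : ℝ :=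
  ∫ ω', ((piOf d ω' 0)⁻¹ *
      ∑ z ∈ nbrs d 0, cnd d ω' 0 z * (h ω' - h (shift d z ω'))) * h ω' ∂ν

/-- The set whose supremum is the variational characterization
`⟨f,(−L)⁻¹f⟩_{L²(ν)} = sup_h [2⟨h,f⟩ − ⟨h,(−L)h⟩]` (over bounded continuous `h`);
`⟨f,(−L)⁻¹f⟩_{L²(ν)} < ∞` means this set is bounded above. -/
def invPairSet (d : ℕ) (ν : Measure (EnvSp d)) (f : EnvSp d → ℝ) : Set ℝ :=
  {r | ∃ h : EnvSp d → ℝ, Continuous h ∧ IsBdd d h ∧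
        r = 2 * innerQ d ν h f - quadQ d ν h}

/-- The function `f(ω) = π_ω(0)⁻¹ ∇⋆(c v)(ω)` built from a vector field `v`. -/
def fDiv (d : ℕ) (v : EnvSp d → Fin d → ℝ) (ω : EnvSp d) : ℝ :=
  (piOf d ω 0)⁻¹ *
    ∑ i, (cnd d ω 0 (unitv d i) * v ω i -
          cnd d ω (-(unitv d i)) 0 * v (shift d (-(unitv d i)) ω) i)

/-- The inner product of `ℓ²(Λ,π_ω)`. -/
def innerF (d : ℕ) (ω : EnvSp d) (Λ : Finset (Vert d)) (f g : Vert d → ℝ) : ℝ :=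
  ∑ x ∈ Λ, f x * g x * piOf d ω x

/-- The pairing `⟨h, (−𝖫_ω)h⟩_{ℓ²(Λ,π_ω)}` for `h` vanishing outside `Λ`. -/
def quadF (d : ℕ) (ω : EnvSp d) (Λ : Finset (Vert d)) (h : Vert d → ℝ) : ℝ :=
  ∑ x ∈ Λ, (∑ z ∈ nbrs d x, cnd d ω x z * (h x - h z)) * h x

/-- `⟨f, (−𝖫_ω)⁻¹_Λ f⟩_{ℓ²(Λ,π_ω)}` via its variational characterization
`sup_h [2⟨h,f⟩ − ⟨h,(−𝖫_ω)h⟩]` over `h ∈ ℓ²(Λ,π_ω)`. -/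
def invPairF (d : ℕ) (ω : EnvSp d) (Λ : Finset (Vert d)) (f : Vert d → ℝ) : ℝ :=
  sSup {r | ∃ h : Vert d → ℝ, (∀ x ∉ Λ, h x = 0) ∧
      r = 2 * innerF d ω Λ h f - quadF d ω Λ h}

/-- The antisymmetric edge function `v∘τ(ω)`: the value assigned to the
edge `(x, x+e_i)` is `v_i(τ_x(ω))`. -/
def efield (d : ℕ) (v : EnvSp d → Fin d → ℝ) (ω : EnvSp d) : Vert d → Fin d → ℝ :=
  fun x i => v (shift d x ω) i

/-- The discrete gradient `∇h` of `h : ℤ^d → ℝ` as an edge function. -/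
def dgradE (d : ℕ) (h : Vert d → ℝ) : Vert d → Fin d → ℝ :=
  fun x i => h (x + unitv d i) - h x

/-- The inner product `⟨u,w⟩_{ℓ²(E(Λ), c_ω)}` of (antisymmetric) edge functions;
each unordered edge is counted once, which agrees with the paper's sum over
ordered edges carrying the factor ½. -/
def einner (d : ℕ) (ω : EnvSp d) (Λ : Finset (Vert d)) (u w : Vert d → Fin d → ℝ) : ℝ :=
  ∑ e ∈ edgesIn d Λ, u e.1 e.2 * w e.1 e.2 * ω.1 e

/-- The Dirichlet energy `𝓔_Λ^ω(v)`. -/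
def direnergy (d : ℕ) (ω : EnvSp d) (Λ : Finset (Vert d)) (v : EnvSp d → Fin d → ℝ) : ℝ :=
  sInf {r | ∃ h : Vert d → ℝ, (∀ x ∉ Λ, h x = 0) ∧
      r = einner d ω Λ (fun x i => efield d v ω x i - dgradE d h x i)
            (fun x i => efield d v ω x i - dgradE d h x i)}

/-- The gradient `∇h` of a function on `Ω`. -/
def gradOmega (d : ℕ) (h : EnvSp d → ℝ) : EnvSp d → Fin d → ℝ :=
  fun ω i => h (shift d (unitv d i) ω) - h ω

/-- The inner product `⟨u, c w⟩_{L²(P,ℝ^d)}`. -/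
def cinnerP (d : ℕ) (P : Measure (EnvSp d)) (u w : EnvSp d → Fin d → ℝ) : ℝ :=
  ∑ i, ∫ ω', cnd d ω' 0 (unitv d i) * u ω' i * w ω' i ∂P

/-- Bounded vector fields on `Ω`. -/
def IsBddV (d : ℕ) (v : EnvSp d → Fin d → ℝ) : Prop := ∃ M, ∀ ω i, |v ω i| ≤ M

/-- The space `𝒱 = (ℝ^d)^{ℤ^d}` of vector fields on `ℤ^d`. -/
abbrev VS (d : ℕ) := Vert d → Fin d → ℝ

/-- The empirical measures `μ_r^{ω,v}` built from the minimizers `h_r` of the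
finite-volume Dirichlet energies. -/
def muR (d : ℕ) (ω : EnvSp d) (hr : ℕ → Vert d → ℝ) (r : ℕ) :
    Measure (EnvSp d × VS d) :=
  (((box d ((r : ℝ) + Real.sqrt r)).card : ℝ≥0∞) *
      ((box d (Real.sqrt r)).card : ℝ≥0∞))⁻¹ •
    ∑ z ∈ box d (Real.sqrt r), ∑ x ∈ box d ((r : ℝ) + Real.sqrt r),
      Measure.dirac (shift d (x + z) ω, fun y => dgradE d (hr r) (x + z + y))

/-- The localized conductances `c_ω^R`. -/
def cR (d : ℕ) (ω : EnvSp d) (R : ℝ) (e : EdgeIx d) : ℝ :=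
  if e ∈ edgesIn d (box d (2 * R)) then ω.1 e else 1

/-- The localized measure `π_ω^R`. -/
def piRloc (d : ℕ) (ω : EnvSp d) (R : ℝ) (x : Vert d) : ℝ :=
  if x ∈ box d (2 * R) then piOf d ω x
  else if x ∈ box d (4 * R) then 1 + piOf d ω x else 1

/-- The localized Dirichlet form `D_ω^R(f,f)` (each unordered edge counted once). -/
def DR (d : ℕ) (ω : EnvSp d) (R : ℝ) (f : Vert d → ℝ) : ℝ≥0∞ :=
  ∑' e : EdgeIx d, ENNReal.ofReal (cR d ω R e * (f (e.1 + unitv d e.2) - f e.1) ^ 2)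

/-- The norm `‖f‖_{ℓ^s(μ)}`. -/
def lpN (d : ℕ) (μw : Vert d → ℝ) (s : ℝ) (f : Vert d → ℝ) : ℝ≥0∞ :=
  (∑' x : Vert d, ENNReal.ofReal (|f x| ^ s * μw x)) ^ (1 / s)

/-- The exponent `ε = 2(2/d − 1/p − 1/q)((d−2)/d + 1/q)⁻¹`. -/
def epsPQ (d : ℕ) (p q : ℝ) : ℝ :=
  2 * (2 / (d : ℝ) - 1 / p - 1 / q) / (((d : ℝ) - 2) / (d : ℝ) + 1 / q)

/-- Jump rates of the localized constant-speed chain `Y^R`: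
rate `c_ω^R(x,y)/π_ω^R(x)` from `x` to `y`. -/
def rateR (d : ℕ) (ω : EnvSp d) (R : ℝ) (x y : Vert d) : ℝ :=
  (∑ i, ((if y = x + unitv d i then cR d ω R (x, i) else 0) +
         (if x = y + unitv d i then cR d ω R (y, i) else 0))) / piRloc d ω R x

/-- The generator matrix of `Y^R`. -/
def qmatR (d : ℕ) (ω : EnvSp d) (R : ℝ) (x y : Vert d) : ℝ :=
  if x = y then -(∑ z ∈ nbrs d x, rateR d ω R x z) else rateR d ω R x y

/-- Iterates of the generator matrix of `Y^R`. -/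
def qiter (d : ℕ) (ω : EnvSp d) (R : ℝ) : ℕ → Vert d → Vert d → ℝ
  | 0, x, y => if x = y then 1 else 0
  | n+1, x, y => ∑ z ∈ insert x (nbrs d x), qmatR d ω R x z * qiter d ω R n z y

/-- The heat kernel `P_ω^x(Y_t^R = y) = (e^{tQ})(x,y)` of the localized chain `Y^R`. -/
def hkR (d : ℕ) (ω : EnvSp d) (R : ℝ) (t : ℝ) (x y : Vert d) : ℝ :=
  ∑' k : ℕ, t ^ k / (Nat.factorial k : ℝ) * qiter d ω R k x y

lemma piOf_pos {d : ℕ} (hd : 1 ≤ d) (ω : EnvSp d) (x : Vert d) : 0 < piOf d ω x := by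
  have : Nonempty (Fin d) := ⟨⟨0, hd⟩⟩
  exact Finset.sum_pos (fun i _ => add_pos (ω.2 _) (ω.2 _)) Finset.univ_nonempty

/-- The averaging operator of the random walk among the conductances `ω`. -/
def avgOp (d : ℕ) (ω : EnvSp d) (u : Vert d → ℝ) (x : Vert d) : ℝ :=
  (∑ i, (ω.1 (x, i) * u (x + unitv d i) + ω.1 (x - unitv d i, i) * u (x - unitv d i)))
    / piOf d ω x

lemma piOf_mul_avgOp {d : ℕ} (hd : 1 ≤ d) (ω : EnvSp d) (u : Vert d → ℝ) (x : Vert d) :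
    piOf d ω x * avgOp d ω u x =
      ∑ i, (ω.1 (x, i) * u (x + unitv d i) + ω.1 (x - unitv d i, i) * u (x - unitv d i)) := by
  rw [avgOp, mul_div_cancel₀ _ (piOf_pos hd ω x).ne']

lemma avgOp_nonneg {d : ℕ} (ω : EnvSp d) {u : Vert d → ℝ} (hu : ∀ x, 0 ≤ u x) (x : Vert d) :
    0 ≤ avgOp d ω u x := by
  refine div_nonneg (Finset.sum_nonneg fun i _ => ?_) (Finset.sum_nonneg fun i _ => ?_)
  · exact add_nonneg (mul_nonneg (ω.2 _).le (hu _)) (mul_nonneg (ω.2 _).le (hu _))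
  · exact add_nonneg (ω.2 _).le (ω.2 _).le

lemma avgOp_mono {d : ℕ} (ω : EnvSp d) {u v : Vert d → ℝ} (huv : ∀ x, u x ≤ v x) (x : Vert d) :
    avgOp d ω u x ≤ avgOp d ω v x := by
  refine div_le_div_of_nonneg_right (Finset.sum_le_sum fun i _ => ?_)
    (Finset.sum_nonneg fun i _ => add_nonneg (ω.2 _).le (ω.2 _).le)
  have h1 := mul_le_mul_of_nonneg_left (huv (x + unitv d i)) (ω.2 (x, i)).le
  have h2 := mul_le_mul_of_nonneg_left (huv (x - unitv d i)) (ω.2 (x - unitv d i, i)).le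
  linarith

/-- Finitely supported functions. -/
abbrev FS {X : Type*} (u : X → ℝ) : Prop := (Function.support u).Finite

lemma FS.of_imp {X : Type*} {u g : X → ℝ} (hu : FS u) (h : ∀ x, u x = 0 → g x = 0) : FS g :=
  hu.subset fun x hx hux => hx (h x hux)

lemma FS.summable {X : Type*} {u g : X → ℝ} (hu : FS u) (h : ∀ x, u x = 0 → g x = 0) :
    Summable g :=
  summable_of_hasFiniteSupport (hu.of_imp h)

lemma FS.add {X : Type*} {u v : X → ℝ} (hu : FS u) (hv : FS v) : FS fun x => u x + v x :=
  (hu.union hv).subset fun x hx => by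
    by_contra h
    simp only [Set.mem_union, Function.mem_support, not_or, not_not] at h
    exact hx (by simp [h.1, h.2])

lemma FS.shift {d : ℕ} {u : Vert d → ℝ} (hu : FS u) (y : Vert d) : FS fun x => u (x + y) :=
  (hu.preimage (add_left_injective y).injOn : _)

lemma FS.shift_sub {d : ℕ} {u : Vert d → ℝ} (hu : FS u) (y : Vert d) : FS fun x => u (x - y) := by
  simpa only [sub_eq_add_neg] using hu.shift (-y)

lemma FS.sum {X ι : Type*} (s : Finset ι) {u : ι → X → ℝ} (hu : ∀ i ∈ s, FS (u i)) :
    FS fun x => ∑ i ∈ s, u i x := by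
  classical
  induction s using Finset.induction_on with
  | empty => simp [FS, Function.support]
  | insert a s ha ih =>
    simp only [Finset.sum_insert ha]
    exact FS.add (hu a (Finset.mem_insert_self a s))
      (ih fun i hi => hu i (Finset.mem_insert_of_mem hi))

lemma FS.avgOp {d : ℕ} (ω : EnvSp d) {u : Vert d → ℝ} (hu : FS u) : FS (avgOp d ω u) := by
  have : FS fun x => ∑ i, (ω.1 (x, i) * u (x + unitv d i)
      + ω.1 (x - unitv d i, i) * u (x - unitv d i)) := by
    refine FS.sum _ fun i _ => FS.add ?_ ?_
    · exact (hu.shift (unitv d i)).of_imp fun x hx => by simp [hx]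
    · exact (hu.shift_sub (unitv d i)).of_imp fun x hx => by simp [hx]
  exact this.of_imp fun x hx => by simp only [DetCond.avgOp, hx, zero_div]

lemma tsum_shift {d : ℕ} (g : Vert d → ℝ) (y : Vert d) : ∑' x, g (x + y) = ∑' x, g x :=
  (Equiv.addRight y).tsum_eq g

lemma tsum_mul_piOf {d : ℕ} (ω : EnvSp d) {g : Vert d → ℝ} (hg : FS g) :
    ∑' x, g x * piOf d ω x =
      ∑ i, ∑' x, ω.1 (x, i) * (g x + g (x + unitv d i)) := by
  have h1 : ∀ i, Summable fun x => ω.1 (x, i) * g x :=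
    fun i => hg.summable fun x hx => by simp [hx]
  have h2 : ∀ i, Summable fun x => ω.1 (x - unitv d i, i) * g x :=
    fun i => hg.summable fun x hx => by simp [hx]
  have h3 : ∀ i, Summable fun x => ω.1 (x, i) * g (x + unitv d i) :=
    fun i => (hg.shift (unitv d i)).summable fun x hx => by simp [hx]
  calc ∑' x, g x * piOf d ω x
      = ∑' x, ∑ i, (ω.1 (x, i) * g x + ω.1 (x - unitv d i, i) * g x) := by
        refine tsum_congr fun x => ?_
        rw [piOf, Finset.mul_sum]
        exact Finset.sum_congr rfl fun i _ => by ring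
    _ = ∑ i, ∑' x, (ω.1 (x, i) * g x + ω.1 (x - unitv d i, i) * g x) :=
        Summable.tsum_finsetSum fun i _ => (h1 i).add (h2 i)
    _ = _ := by
        refine Finset.sum_congr rfl fun i _ => ?_
        rw [(h1 i).tsum_add (h2 i), ← tsum_shift (fun x => ω.1 (x - unitv d i, i) * g x) (unitv d i)]
        simp only [add_sub_cancel_right]
        rw [← (h1 i).tsum_add (h3 i)]
        exact tsum_congr fun x => by ring

lemma tsum_parts {d : ℕ} (hd : 1 ≤ d) (ω : EnvSp d) (u : Vert d → ℝ) {w : Vert d → ℝ}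
    (hw : FS w) :
    ∑' x, (u x - avgOp d ω u x) * w x * piOf d ω x =
      ∑ i, ∑' x, ω.1 (x, i) *
        ((u (x + unitv d i) - u x) * (w (x + unitv d i) - w x)) := by
  have h1 : ∀ i, Summable fun x => ω.1 (x, i) * (u x - u (x + unitv d i)) * w x :=
    fun i => hw.summable fun x hx => by simp [hx]
  have h2 : ∀ i, Summable fun x =>
      ω.1 (x - unitv d i, i) * (u x - u (x - unitv d i)) * w x :=
    fun i => hw.summable fun x hx => by simp [hx]
  have h3 : ∀ i, Summable fun x =>
      ω.1 (x, i) * (u (x + unitv d i) - u x) * w (x + unitv d i) :=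
    fun i => (hw.shift (unitv d i)).summable fun x hx => by simp [hx]
  calc ∑' x, (u x - avgOp d ω u x) * w x * piOf d ω x
      = ∑' x, ∑ i, (ω.1 (x, i) * (u x - u (x + unitv d i)) * w x
          + ω.1 (x - unitv d i, i) * (u x - u (x - unitv d i)) * w x) := by
        refine tsum_congr fun x => ?_
        have : (u x - avgOp d ω u x) * w x * piOf d ω x =
          (u x * piOf d ω x - piOf d ω x * avgOp d ω u x) * w x := by ring
        rw [this, piOf_mul_avgOp hd, piOf, Finset.mul_sum, ← Finset.sum_sub_distrib,
          Finset.sum_mul]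
        exact Finset.sum_congr rfl fun i _ => by ring
    _ = ∑ i, ∑' x, (ω.1 (x, i) * (u x - u (x + unitv d i)) * w x
          + ω.1 (x - unitv d i, i) * (u x - u (x - unitv d i)) * w x) :=
        Summable.tsum_finsetSum fun i _ => (h1 i).add (h2 i)
    _ = _ := by
        refine Finset.sum_congr rfl fun i _ => ?_
        rw [(h1 i).tsum_add (h2 i), ← tsum_shift (fun x =>
          ω.1 (x - unitv d i, i) * (u x - u (x - unitv d i)) * w x) (unitv d i)]
        simp only [add_sub_cancel_right]
        rw [← (h1 i).tsum_add (h3 i)]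
        exact tsum_congr fun x => by ring

lemma tsum_avgOp {d : ℕ} (hd : 1 ≤ d) (ω : EnvSp d) {u : Vert d → ℝ} (hu : FS u)
    {w : Vert d → ℝ} (hw : FS w) :
    ∑' x, avgOp d ω u x * w x * piOf d ω x = ∑' x, u x * avgOp d ω w x * piOf d ω x := by
  have key : ∀ u w : Vert d → ℝ, FS u → FS w → ∑' x, avgOp d ω u x * w x * piOf d ω x =
      ∑' x, u x * w x * piOf d ω x - ∑ i, ∑' x, ω.1 (x, i) *
        ((u (x + unitv d i) - u x) * (w (x + unitv d i) - w x)) := by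
    intro u w hu hw
    rw [← tsum_parts hd ω u hw, ← Summable.tsum_sub]
    · exact tsum_congr fun x => by ring
    · exact hw.summable fun x hx => by simp [hx]
    · exact hw.summable fun x hx => by simp [hx]
  rw [key u w hu hw]
  have : ∑' x, u x * avgOp d ω w x * piOf d ω x = ∑' x, avgOp d ω w x * u x * piOf d ω x :=
    tsum_congr fun x => by ring
  rw [this, key w u hw hu]
  congr 1
  · exact tsum_congr fun x => by ring
  · exact Finset.sum_congr rfl fun i _ => tsum_congr fun x => by ring

/-! ### The energy inequality -/

lemma young_pow (n : ℕ) {a b : ℝ} (ha : 0 ≤ a) (hb : 0 ≤ b) :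
    ((n : ℝ) + 1) * (a * b ^ n) ≤ a ^ (n + 1) + n * b ^ (n + 1) := by
  induction n with
  | zero => simp
  | succ n ih =>
    have h1 := mul_le_mul_of_nonneg_right ih hb
    have h2 : 0 ≤ (a - b) * (a ^ (n + 1) - b ^ (n + 1)) := by
      rcases le_total a b with h | h
      · exact mul_nonneg_of_nonpos_of_nonpos (sub_nonpos.2 h)
          (sub_nonpos.2 (pow_le_pow_left₀ ha h _))
      · exact mul_nonneg (sub_nonneg.2 h) (sub_nonneg.2 (pow_le_pow_left₀ hb h _))
    push_cast
    ring_nf at h1 h2 ⊢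
    linarith

set_option maxHeartbeats 1000000 in
lemma edge_ineq_aux (k : ℕ) {a b α β : ℝ} (hb : 0 ≤ b) (hab : b ≤ a) (hα : 0 ≤ α)
    (hβ : 0 ≤ β) :
    (1 / (4 * ((k : ℝ) + 1) ^ 2)) * (a ^ (k + 1) * α - b ^ (k + 1) * β) ^ 2
        - 4 * a ^ (2 * k + 2) * (α - β) ^ 2
      ≤ (a - b) * (a ^ (2 * k + 1) * α ^ 2 - b ^ (2 * k + 1) * β ^ 2) := by
  have ha : 0 ≤ a := hb.trans hab
  set t := a ^ k with ht
  have ht0 : 0 ≤ t := pow_nonneg ha k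
  -- bounds for differences of powers
  have h1 : a ^ (k + 1) - b ^ (k + 1) ≤ (k + 1) * (t * (a - b)) := by
    have := young_pow k hb ha
    rw [ht]
    have e : a ^ (k + 1) = a * a ^ k := pow_succ' a k
    have e' : (k : ℝ) * a ^ (k + 1) = k * (a * a ^ k) := by rw [e]
    nlinarith [this]
  have h1' : 0 ≤ a ^ (k + 1) - b ^ (k + 1) := sub_nonneg.2 (pow_le_pow_left₀ hb hab _)
  have h2 : t ^ 2 * (a - b) ≤ a ^ (2 * k + 1) - b ^ (2 * k + 1) := by
    have e1 : a ^ (2 * k + 1) = t ^ 2 * a := by rw [ht]; ring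
    have e2 : b ^ (2 * k + 1) = (b ^ k) ^ 2 * b := by ring
    have : (b ^ k) ^ 2 ≤ t ^ 2 := pow_le_pow_left₀ (pow_nonneg hb k) (pow_le_pow_left₀ hb hab k) 2
    rw [e1, e2]
    nlinarith
  set A := a ^ (k + 1) with hA
  set B := b ^ (k + 1) with hB
  have hB0 : 0 ≤ B := pow_nonneg hb _
  have hBA : B ≤ A := sub_nonneg.1 h1'
  have hAt : A = t * a := by rw [hA, ht]; ring
  have hA2 : a ^ (2 * k + 2) = A ^ 2 := by rw [hA]; ring
  set k1 : ℝ := (k : ℝ) + 1 with hk1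
  have hk : 1 ≤ k1 := by rw [hk1]; linarith [(Nat.cast_nonneg k : (0 : ℝ) ≤ k)]
  have hX : (A - B) ^ 2 ≤ k1 ^ 2 * (t * (a - b)) ^ 2 := by
    rw [← mul_pow]; exact pow_le_pow_left₀ h1' h1 2
  have hXY : (A * α - B * β) ^ 2 ≤ 2 * (k1 ^ 2 * (t * (a - b)) ^ 2) * α ^ 2
      + 2 * A ^ 2 * (α - β) ^ 2 := by
    have e : A * α - B * β = (A - B) * α + B * (α - β) := by ring
    have h3 : B ^ 2 ≤ A ^ 2 := pow_le_pow_left₀ hB0 hBA 2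
    have h4 : ((A - B) * α + B * (α - β)) ^ 2 ≤ 2 * ((A - B) * α) ^ 2 + 2 * (B * (α - β)) ^ 2 := by
      nlinarith [sq_nonneg ((A - B) * α - B * (α - β))]
    rw [e]
    refine h4.trans (add_le_add ?_ ?_)
    · rw [mul_pow, mul_assoc]
      exact mul_le_mul_of_nonneg_left (mul_le_mul_of_nonneg_right hX (sq_nonneg _)) two_pos.le
    · rw [mul_pow, mul_assoc]
      exact mul_le_mul_of_nonneg_left (mul_le_mul_of_nonneg_right h3 (sq_nonneg _)) two_pos.le
  have hL : (1 / (4 * k1 ^ 2)) * (A * α - B * β) ^ 2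
      ≤ (1 / 2) * (t * (a - b)) ^ 2 * α ^ 2 + (1 / 2) * A ^ 2 * (α - β) ^ 2 := by
    rw [one_div, inv_mul_le_iff₀ (by positivity)]
    refine hXY.trans ?_
    have : A ^ 2 * (α - β) ^ 2 ≤ k1 ^ 2 * (A ^ 2 * (α - β) ^ 2) :=
      le_mul_of_one_le_left (by positivity) (one_le_pow₀ hk)
    nlinarith
  rw [hA2]
  -- lower bound for the right-hand side
  set b' := b ^ (2 * k + 1) with hb'
  have hb'0 : 0 ≤ b' := pow_nonneg hb _
  have hb'1 : b' ≤ t * A := by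
    have : b' ≤ a ^ (2 * k + 1) := pow_le_pow_left₀ hb hab _
    refine this.trans (le_of_eq ?_)
    rw [ht, hA]; ring
  have hR1 : (t * (a - b)) ^ 2 * α ^ 2 ≤ (a - b) * (a ^ (2 * k + 1) - b') * α ^ 2 := by
    have := mul_le_mul_of_nonneg_left h2 (sub_nonneg.2 hab)
    refine mul_le_mul_of_nonneg_right (le_trans (le_of_eq ?_) this) (sq_nonneg _)
    ring
  -- |(a-b) b' (α²-β²)| ≤ (a-b) t A |α-β| (2α + |α-β|)
  have hcross : -((a - b) * (t * A) * (|α - β| * (2 * α + |α - β|)))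
      ≤ (a - b) * b' * (α ^ 2 - β ^ 2) := by
    have e : α ^ 2 - β ^ 2 = (α - β) * (α + β) := by ring
    have h5 : |α ^ 2 - β ^ 2| ≤ |α - β| * (2 * α + |α - β|) := by
      rw [e, abs_mul, abs_of_nonneg (add_nonneg hα hβ)]
      refine mul_le_mul_of_nonneg_left ?_ (abs_nonneg _)
      have := neg_abs_le (α - β)
      linarith
    have h6 : (a - b) * b' * |α ^ 2 - β ^ 2|
        ≤ (a - b) * (t * A) * (|α - β| * (2 * α + |α - β|)) :=
      mul_le_mul (mul_le_mul_of_nonneg_left hb'1 (sub_nonneg.2 hab)) h5 (abs_nonneg _)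
        (by have := sub_nonneg.2 hab; positivity)
    have h7 := neg_abs_le ((a - b) * b' * (α ^ 2 - β ^ 2))
    rw [abs_mul, abs_of_nonneg (mul_nonneg (sub_nonneg.2 hab) hb'0)] at h7
    exact (neg_le_neg h6).trans h7
  have hδ : |α - β| ^ 2 = (α - β) ^ 2 := sq_abs _
  set δ := |α - β| with hδdef
  have hδ0 : 0 ≤ δ := abs_nonneg _
  set D := t * (a - b) with hD
  have hD0 : 0 ≤ D := mul_nonneg ht0 (sub_nonneg.2 hab)
  have hDA : D ≤ A := by rw [hD, hAt]; exact mul_le_mul_of_nonneg_left (by linarith) ht0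
  have e3 : (a - b) * (t * A) * (δ * (2 * α + δ)) = 2 * (D * α) * (A * δ) + D * A * δ ^ 2 := by
    rw [hD]; ring
  have h8 : 2 * (D * α) * (A * δ) ≤ (1 / 2) * (D * α) ^ 2 + 2 * (A * δ) ^ 2 := by
    nlinarith [sq_nonneg (D * α - 2 * (A * δ))]
  have h9 : D * A * δ ^ 2 ≤ A ^ 2 * δ ^ 2 := by
    refine mul_le_mul_of_nonneg_right ?_ (sq_nonneg _)
    rw [sq]; exact mul_le_mul_of_nonneg_right hDA (hB0.trans hBA)
  have e4 : (a - b) * (a ^ (2 * k + 1) * α ^ 2 - b' * β ^ 2)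
      = (a - b) * (a ^ (2 * k + 1) - b') * α ^ 2 + (a - b) * b' * (α ^ 2 - β ^ 2) := by ring
  rw [e4, ← hδ]
  rw [← hδ] at hL
  clear_value D δ A B b' k1 t
  have h10 : 0 ≤ A ^ 2 * δ ^ 2 := by positivity
  rw [e3] at hcross
  have e5 : (D * α) ^ 2 = D ^ 2 * α ^ 2 := by ring
  have e6 : (A * δ) ^ 2 = A ^ 2 * δ ^ 2 := by ring
  linarith

lemma edge_ineq (k : ℕ) {a b α β : ℝ} (ha : 0 ≤ a) (hb : 0 ≤ b) (hα : 0 ≤ α)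
    (hβ : 0 ≤ β) :
    (1 / (4 * ((k : ℝ) + 1) ^ 2)) * (a ^ (k + 1) * α - b ^ (k + 1) * β) ^ 2
        - 4 * (a ^ (2 * k + 2) + b ^ (2 * k + 2)) * (α - β) ^ 2
      ≤ (a - b) * (a ^ (2 * k + 1) * α ^ 2 - b ^ (2 * k + 1) * β ^ 2) := by
  have h0 : 0 ≤ a ^ (2 * k + 2) * (α - β) ^ 2 := mul_nonneg (pow_nonneg ha _) (sq_nonneg _)
  have h0' : 0 ≤ b ^ (2 * k + 2) * (α - β) ^ 2 := mul_nonneg (pow_nonneg hb _) (sq_nonneg _)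
  rcases le_total b a with h | h
  · have := edge_ineq_aux k hb h hα hβ
    linarith
  · have := edge_ineq_aux k ha h hβ hα
    have e1 : (a ^ (k + 1) * α - b ^ (k + 1) * β) ^ 2 = (b ^ (k + 1) * β - a ^ (k + 1) * α) ^ 2 := by
      ring
    have e2 : (α - β) ^ 2 = (β - α) ^ 2 := by ring
    rw [e1]
    rw [e2] at h0 h0' ⊢
    linarith

/-- The Dirichlet energy of a function on `ℤ^d`. -/
def energy (d : ℕ) (ω : EnvSp d) (F : Vert d → ℝ) : ℝ :=
  ∑ i, ∑' x, ω.1 (x, i) * (F (x + unitv d i) - F x) ^ 2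

lemma energy_nonneg {d : ℕ} (ω : EnvSp d) (F : Vert d → ℝ) : 0 ≤ energy d ω F :=
  Finset.sum_nonneg fun _ _ => tsum_nonneg fun _ => mul_nonneg (ω.2 _).le (sq_nonneg _)

lemma energy_step {d : ℕ} (hd : 1 ≤ d) (ω : EnvSp d) (k : ℕ) {h : ℝ} (hh : 0 ≤ h)
    {u v ψ G : Vert d → ℝ} (hu : ∀ x, 0 ≤ u x) (hv : ∀ x, 0 ≤ v x) (hψ : ∀ x, 0 ≤ ψ x)
    (hus : FS u) (hvs : FS v) (hsub : ∀ x, u x + h * (u x - avgOp d ω u x) ≤ v x)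
    (hG : ∀ x i, (ψ (x + unitv d i) - ψ x) ^ 2 ≤ G x ∧
      (ψ (x + unitv d i) - ψ x) ^ 2 ≤ G (x + unitv d i)) :
    ∑' x, u x ^ (2 * k + 2) * ψ x ^ 2 * piOf d ω x
        + (h / (2 * ((k : ℝ) + 1))) * energy d ω (fun x => u x ^ (k + 1) * ψ x)
      ≤ ∑' x, v x ^ (2 * k + 2) * ψ x ^ 2 * piOf d ω x
        + 8 * (k + 1) * h * ∑' x, u x ^ (2 * k + 2) * G x * piOf d ω x := by
  have hpi : ∀ x, 0 < piOf d ω x := piOf_pos hd ω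
  set w : Vert d → ℝ := fun x => u x ^ (2 * k + 1) * ψ x ^ 2 with hw
  have hw0 : ∀ x, 0 ≤ w x := fun x => mul_nonneg (pow_nonneg (hu x) _) (sq_nonneg _)
  have hws : FS w := hus.of_imp fun x hx => by simp [hw, hx]
  set S := ∑' x, u x ^ (2 * k + 2) * ψ x ^ 2 * piOf d ω x with hS
  set V := ∑' x, v x ^ (2 * k + 2) * ψ x ^ 2 * piOf d ω x with hV
  have sS : Summable fun x => u x ^ (2 * k + 2) * ψ x ^ 2 * piOf d ω x :=
    hus.summable fun x hx => by simp [hx]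
  have sV : Summable fun x => v x ^ (2 * k + 2) * ψ x ^ 2 * piOf d ω x :=
    hvs.summable fun x hx => by simp [hx]
  -- test the inequality against `w`
  have h1 : (2 * (k : ℝ) + 2) * ∑' x, (u x + h * (u x - avgOp d ω u x)) * w x * piOf d ω x
      ≤ V + (2 * k + 1) * S := by
    rw [← tsum_mul_left, hV, hS, ← tsum_mul_left, ← sV.tsum_add (sS.mul_left _)]
    refine Summable.tsum_le_tsum (fun x => ?_) ?_ (sV.add (sS.mul_left _))
    · have hy := young_pow (2 * k + 1) (hv x) (hu x)
      have hle : (u x + h * (u x - avgOp d ω u x)) * w x ≤ v x * w x :=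
        mul_le_mul_of_nonneg_right (hsub x) (hw0 x)
      have h2 : (2 * (k : ℝ) + 2) * (v x * w x)
          ≤ (v x ^ (2 * k + 2) + (2 * k + 1) * u x ^ (2 * k + 2)) * ψ x ^ 2 := by
        have := mul_le_mul_of_nonneg_right hy (sq_nonneg (ψ x))
        push_cast at this
        simp only [hw]
        refine le_trans (le_of_eq ?_) (this.trans (le_of_eq ?_)) <;> ring
      calc (2 * (k : ℝ) + 2) * ((u x + h * (u x - avgOp d ω u x)) * w x * piOf d ω x)
          = ((2 * (k : ℝ) + 2) * ((u x + h * (u x - avgOp d ω u x)) * w x)) * piOf d ω x := by ring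
        _ ≤ ((2 * (k : ℝ) + 2) * (v x * w x)) * piOf d ω x := by
            have := (hpi x).le
            gcongr
        _ ≤ ((v x ^ (2 * k + 2) + (2 * k + 1) * u x ^ (2 * k + 2)) * ψ x ^ 2) * piOf d ω x :=
            mul_le_mul_of_nonneg_right h2 (hpi x).le
        _ = _ := by ring
    · exact (hws.summable fun x hx => by simp [hx])
  have h2 : ∑' x, (u x + h * (u x - avgOp d ω u x)) * w x * piOf d ω x
      = S + h * ∑ i, ∑' x, ω.1 (x, i) *
        ((u (x + unitv d i) - u x) * (w (x + unitv d i) - w x)) := by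
    rw [← tsum_parts hd ω u hws, ← tsum_mul_left, hS, ← Summable.tsum_add sS]
    · refine tsum_congr fun x => ?_
      simp only [hw]; ring
    · exact hws.summable fun x hx => by simp [hx]
  set E := energy d ω (fun x => u x ^ (k + 1) * ψ x) with hE
  set T := ∑' x, u x ^ (2 * k + 2) * G x * piOf d ω x with hT
  have h3 : (1 / (4 * ((k : ℝ) + 1) ^ 2)) * E - 4 * T ≤ ∑ i, ∑' x, ω.1 (x, i) *
        ((u (x + unitv d i) - u x) * (w (x + unitv d i) - w x)) := by
    have hg : FS fun x => u x ^ (2 * k + 2) * G x := hus.of_imp fun x hx => by simp [hx]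
    rw [hT, tsum_mul_piOf ω hg, hE, energy, Finset.mul_sum, Finset.mul_sum,
      ← Finset.sum_sub_distrib]
    refine Finset.sum_le_sum fun i _ => ?_
    have f1 : FS fun x => |u (x + unitv d i)| + |u x| :=
      ((hus.shift (unitv d i)).of_imp fun x hx => by simpa using hx).add
        (hus.of_imp fun x hx => by simpa using hx)
    have f2 : ∀ x, |u (x + unitv d i)| + |u x| = 0 → u (x + unitv d i) = 0 ∧ u x = 0 := by
      intro x hx
      have a1 := abs_nonneg (u (x + unitv d i))
      have a2 := abs_nonneg (u x)
      exact ⟨abs_eq_zero.1 (by linarith), abs_eq_zero.1 (by linarith)⟩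
    have s1 : Summable fun x => ω.1 (x, i) *
        (u (x + unitv d i) ^ (k + 1) * ψ (x + unitv d i) - u x ^ (k + 1) * ψ x) ^ 2 :=
      f1.summable fun x hx => by simp [(f2 x hx).1, (f2 x hx).2]
    have s2 : Summable fun x => ω.1 (x, i) *
        (u x ^ (2 * k + 2) * G x + u (x + unitv d i) ^ (2 * k + 2) * G (x + unitv d i)) :=
      f1.summable fun x hx => by simp [(f2 x hx).1, (f2 x hx).2]
    have s3 : Summable fun x => ω.1 (x, i) *
        ((u (x + unitv d i) - u x) * (w (x + unitv d i) - w x)) :=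
      f1.summable fun x hx => by simp [(f2 x hx).1, (f2 x hx).2]
    rw [← tsum_mul_left, ← tsum_mul_left, ← (s1.mul_left _).tsum_sub (s2.mul_left _)]
    refine Summable.tsum_le_tsum (fun x => ?_) ((s1.mul_left _).sub (s2.mul_left _)) s3
    have he := edge_ineq k (hu (x + unitv d i)) (hu x) (hψ (x + unitv d i)) (hψ x)
    have g1 := mul_le_mul_of_nonneg_left (hG x i).1 (pow_nonneg (hu x) (2 * k + 2))
    have g2 := mul_le_mul_of_nonneg_left (hG x i).2
      (pow_nonneg (hu (x + unitv d i)) (2 * k + 2))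
    have := mul_le_mul_of_nonneg_left (show
      (1 / (4 * ((k : ℝ) + 1) ^ 2)) * (u (x + unitv d i) ^ (k + 1) * ψ (x + unitv d i)
        - u x ^ (k + 1) * ψ x) ^ 2
        - 4 * (u x ^ (2 * k + 2) * G x + u (x + unitv d i) ^ (2 * k + 2) * G (x + unitv d i))
        ≤ (u (x + unitv d i) - u x) * (w (x + unitv d i) - w x) by
          simp only [hw]; linarith) (ω.2 (x, i)).le
    linarith
  have hk : (0 : ℝ) < (k : ℝ) + 1 := by positivity
  rw [h2] at h1
  have h4 := mul_le_mul_of_nonneg_left h3 hh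
  have h5 := mul_le_mul_of_nonneg_left h4 (show (0 : ℝ) ≤ 2 * ((k : ℝ) + 1) by positivity)
  have e1 : 2 * ((k : ℝ) + 1) * (h * (1 / (4 * ((k : ℝ) + 1) ^ 2) * E - 4 * T))
      = h / (2 * ((k : ℝ) + 1)) * E - 8 * (k + 1) * h * T := by
    field_simp
    ring
  rw [e1] at h5
  linarith

/-! ### Discrete Sobolev inequalities -/

lemma ofReal_abs_le_tsum_int {g : ℤ → ℝ} (hg : FS g) (t : ℤ) :
    ENNReal.ofReal |g t| ≤ ∑' s : ℤ, ENNReal.ofReal |g (s + 1) - g s| := by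
  obtain ⟨N, hN⟩ : ∃ N : ℕ, g (t + N) = 0 := by
    by_contra hcon
    push Not at hcon
    have : (Set.range fun n : ℕ => t + (n : ℤ)).Infinite :=
      Set.infinite_range_of_injective fun a b hab => by simpa using hab
    exact this (hg.subset (by rintro _ ⟨n, rfl⟩; exact hcon n))
  have h1 : ∀ n : ℕ, ENNReal.ofReal |g t| ≤
      ∑ j ∈ Finset.range n, ENNReal.ofReal |g (t + j + 1) - g (t + j)|
        + ENNReal.ofReal |g (t + n)| := by
    intro n
    induction n with
    | zero => simp
    | succ n ih =>
      rw [Finset.sum_range_succ, add_assoc]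
      refine ih.trans (add_le_add le_rfl ?_)
      rw [← ENNReal.ofReal_add (abs_nonneg _) (abs_nonneg _)]
      refine ENNReal.ofReal_le_ofReal ?_
      push_cast
      rw [← add_assoc]
      have := abs_sub_abs_le_abs_sub (g (t + n)) (g (t + n + 1))
      rw [abs_sub_comm] at this
      linarith
  have h2 := h1 N
  rw [hN] at h2
  simp only [abs_zero, ENNReal.ofReal_zero, add_zero] at h2
  refine h2.trans ((ENNReal.sum_le_tsum _).trans ?_)
  exact ENNReal.tsum_comp_le_tsum_of_injective (f := fun j : ℕ => t + (j : ℤ))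
    (fun a b hab => by simpa using hab) (fun s => ENNReal.ofReal |g (s + 1) - g s|)

lemma update_add_unitv {d : ℕ} (x : Vert d) (i : Fin d) (t : ℤ) :
    Function.update x i t + unitv d i = Function.update x i (t + 1) := by
  ext j
  by_cases h : j = i
  · subst h; simp [unitv]
  · simp [unitv, h]

lemma ofReal_abs_le_tsum_line {d : ℕ} {F : Vert d → ℝ} (hF : FS F) (x : Vert d) (i : Fin d) :
    ENNReal.ofReal |F x| ≤ ∑' t : ℤ, ENNReal.ofReal
      |F (Function.update x i t + unitv d i) - F (Function.update x i t)| := by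
  have h : FS fun t : ℤ => F (Function.update x i t) :=
    hF.preimage (Function.update_injective x i).injOn
  simpa only [update_add_unitv, Function.update_eq_self] using ofReal_abs_le_tsum_int h (x i)

lemma pi_count_eq (d : ℕ) :
    Measure.pi (fun _ : Fin d => (Measure.count : Measure ℤ)) = Measure.count :=
  Measure.ext_of_singleton fun a => by simp

lemma FS.grad {d : ℕ} {F : Vert d → ℝ} (hF : FS F) (i : Fin d) :
    FS fun x => |F (x + unitv d i) - F x| :=
  (((hF.shift (unitv d i)).of_imp (g := fun x => |F (x + unitv d i)|)
    fun x hx => by simpa using hx).add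
      (hF.of_imp (g := fun x => |F x|) fun x hx => by simpa using hx)).of_imp fun x hx => by
    have a1 := abs_nonneg (F (x + unitv d i))
    have a2 := abs_nonneg (F x)
    rw [abs_eq_zero.1 (by linarith : |F (x + unitv d i)| = 0),
      abs_eq_zero.1 (by linarith : |F x| = 0)]
    simp

lemma sobolev_l1 {d : ℕ} (hd : 2 ≤ d) {F : Vert d → ℝ} (hF0 : ∀ x, 0 ≤ F x) (hF : FS F) :
    ∑' x, F x ^ ((d : ℝ) / (d - 1)) ≤
      (∑ i, ∑' x, |F (x + unitv d i) - F x|) ^ ((d : ℝ) / (d - 1)) := by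
  have hd1 : (1 : ℝ) < d := by exact_mod_cast hd
  have hp : (0 : ℝ) < (d : ℝ) / (d - 1) := div_pos (by linarith) (by linarith)
  have hconj : Real.HolderConjugate (Fintype.card (Fin d) : ℝ) ((d : ℝ) / (d - 1)) := by
    rw [Fintype.card_fin, Real.holderConjugate_iff]
    refine ⟨hd1, ?_⟩
    have : (d : ℝ) - 1 ≠ 0 := by linarith
    field_simp
    ring
  set f : Vert d → ℝ≥0∞ := fun x => ∑ i, ENNReal.ofReal |F (x + unitv d i) - F x| with hf
  have key := lintegral_prod_lintegral_pow_le (fun _ : Fin d => (Measure.count : Measure ℤ))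
    hconj (f := f) (measurable_of_countable f)
  rw [pi_count_eq, lintegral_count, lintegral_count] at key
  simp only [lintegral_count, Fintype.card_fin] at key
  have h1 : ∀ x, ENNReal.ofReal (F x ^ ((d : ℝ) / (d - 1))) ≤
      ∏ i, (∑' t, f (Function.update x i t)) ^ ((1 : ℝ) / ((d : ℝ) - 1)) := by
    intro x
    have h2 : ∀ i, ENNReal.ofReal (F x) ≤ ∑' t, f (Function.update x i t) := by
      intro i
      have := ofReal_abs_le_tsum_line hF x i
      rw [abs_of_nonneg (hF0 x)] at this
      refine this.trans (ENNReal.tsum_le_tsum fun t => ?_)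
      exact Finset.single_le_sum (f := fun j => ENNReal.ofReal
        |F (Function.update x i t + unitv d j) - F (Function.update x i t)|)
        (fun _ _ => zero_le) (Finset.mem_univ i)
    calc ENNReal.ofReal (F x ^ ((d : ℝ) / (d - 1)))
        = ∏ _i : Fin d, (ENNReal.ofReal (F x)) ^ ((1 : ℝ) / ((d : ℝ) - 1)) := by
          rw [Finset.prod_const, Finset.card_univ, Fintype.card_fin, ← ENNReal.rpow_natCast,
            ← ENNReal.rpow_mul, ← ENNReal.ofReal_rpow_of_nonneg (hF0 x) hp.le]
          congr 1
          field_simp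
      _ ≤ _ := Finset.prod_le_prod' fun i _ =>
          ENNReal.rpow_le_rpow (h2 i) (by rw [one_div]; exact inv_nonneg.2 (by linarith))
  have h3 : ∑' x, f x = ENNReal.ofReal (∑ i, ∑' x, |F (x + unitv d i) - F x|) := by
    rw [ENNReal.ofReal_sum_of_nonneg fun i _ => tsum_nonneg fun x => abs_nonneg _, hf,
      Summable.tsum_finsetSum fun _ _ => ENNReal.summable]
    exact Finset.sum_congr rfl fun i _ => (ENNReal.ofReal_tsum_of_nonneg (fun x => abs_nonneg _)
      ((hF.grad i).summable fun x hx => hx)).symm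
  have hS0 : 0 ≤ ∑ i, ∑' x, |F (x + unitv d i) - F x| :=
    Finset.sum_nonneg fun i _ => tsum_nonneg fun x => abs_nonneg _
  have h4 : ENNReal.ofReal (∑' x, F x ^ ((d : ℝ) / (d - 1))) ≤
      ENNReal.ofReal ((∑ i, ∑' x, |F (x + unitv d i) - F x|) ^ ((d : ℝ) / (d - 1))) := by
    rw [ENNReal.ofReal_tsum_of_nonneg (fun x => Real.rpow_nonneg (hF0 x) _)
      (hF.summable fun x hx => by rw [hx, Real.zero_rpow hp.ne']),
      ← ENNReal.ofReal_rpow_of_nonneg hS0 hp.le, ← h3]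
    exact (ENNReal.tsum_le_tsum h1).trans key
  exact (ENNReal.ofReal_le_ofReal_iff (Real.rpow_nonneg hS0 _)).1 h4

lemma rpow_sub_rpow_le {γ a b : ℝ} (hγ : 1 ≤ γ) (hb : 0 ≤ b) (hab : b ≤ a) :
    a ^ γ - b ^ γ ≤ γ * a ^ (γ - 1) * (a - b) := by
  rcases hb.eq_or_lt with rfl | hb'
  · rcases hab.eq_or_lt with rfl | ha
    · simp
    · rw [Real.zero_rpow (by linarith), sub_zero, sub_zero, mul_assoc, Real.rpow_sub_one ha.ne',
        div_mul_cancel₀ _ ha.ne']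
      exact le_mul_of_one_le_left (Real.rpow_nonneg ha.le _) hγ
  · have ha : 0 < a := hb'.trans_le hab
    have h1 := one_add_mul_self_le_rpow_one_add (s := b / a - 1)
      (by linarith [div_nonneg hb ha.le]) hγ
    rw [add_sub_cancel, Real.div_rpow hb ha.le] at h1
    have h2 := mul_le_mul_of_nonneg_left h1 (Real.rpow_nonneg ha.le γ)
    have hane : a ^ γ ≠ 0 := (Real.rpow_pos_of_pos ha γ).ne'
    rw [mul_div_cancel₀ _ hane] at h2
    have e : γ * a ^ (γ - 1) * (a - b) = a ^ γ * (γ * (1 - b / a)) := by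
      rw [Real.rpow_sub_one ha.ne']
      field_simp
    rw [e]
    linarith

lemma abs_rpow_sub_rpow_le {γ a b : ℝ} (hγ : 1 ≤ γ) (ha : 0 ≤ a) (hb : 0 ≤ b) :
    |a ^ γ - b ^ γ| ≤ γ * (|a - b| * (a ^ (γ - 1) + b ^ (γ - 1))) := by
  have ha' := Real.rpow_nonneg ha (γ - 1)
  have hb' := Real.rpow_nonneg hb (γ - 1)
  rcases le_total b a with h | h
  · have h1 := rpow_sub_rpow_le hγ hb h
    rw [abs_of_nonneg (sub_nonneg.2 (Real.rpow_le_rpow hb h (by linarith))),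
      abs_of_nonneg (sub_nonneg.2 h)]
    have : 0 ≤ γ * ((a - b) * b ^ (γ - 1)) :=
      mul_nonneg (by linarith) (mul_nonneg (sub_nonneg.2 h) hb')
    linarith
  · have h1 := rpow_sub_rpow_le hγ ha h
    rw [abs_sub_comm, abs_sub_comm a b,
      abs_of_nonneg (sub_nonneg.2 (Real.rpow_le_rpow ha h (by linarith))),
      abs_of_nonneg (sub_nonneg.2 h)]
    have : 0 ≤ γ * ((b - a) * a ^ (γ - 1)) :=
      mul_nonneg (by linarith) (mul_nonneg (sub_nonneg.2 h) ha')
    linarith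

lemma add_rpow_le_two {t a b σ s : ℝ} (ht : 0 ≤ t) (ha : 0 ≤ a) (hb : 0 ≤ b) (hs : 0 ≤ s)
    (h : t * s = σ) :
    (a ^ t + b ^ t) ^ s ≤ 2 ^ s * (a ^ σ + b ^ σ) := by
  subst h
  have key : ∀ {a b : ℝ}, 0 ≤ b → b ≤ a →
      (a ^ t + b ^ t) ^ s ≤ 2 ^ s * (a ^ (t * s) + b ^ (t * s)) := by
    intro a b hb hab
    have ha : 0 ≤ a := hb.trans hab
    have h1 : a ^ t + b ^ t ≤ 2 * a ^ t := by
      have := Real.rpow_le_rpow hb hab ht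
      linarith
    calc (a ^ t + b ^ t) ^ s ≤ (2 * a ^ t) ^ s :=
          Real.rpow_le_rpow (add_nonneg (Real.rpow_nonneg ha t) (Real.rpow_nonneg hb t)) h1 hs
      _ = 2 ^ s * a ^ (t * s) := by
          rw [Real.mul_rpow two_pos.le (Real.rpow_nonneg ha t), ← Real.rpow_mul ha]
      _ ≤ _ := by
          refine mul_le_mul_of_nonneg_left ?_ (Real.rpow_nonneg two_pos.le _)
          linarith [Real.rpow_nonneg hb (t * s)]
  rcases le_total b a with h | h
  · exact key hb h
  · rw [add_comm, add_comm (a ^ (t * s))]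
    exact key ha h

/-- Three-factor Hölder inequality with weights. -/
lemma holder_weighted {ι : Type*} (D : Finset ι) {c X H : ι → ℝ} {q : ℝ} (hq : 1 < q)
    (hc : ∀ e ∈ D, 0 < c e) (hH : ∀ e ∈ D, 0 ≤ H e) :
    ∑ e ∈ D, X e * H e ≤ (∑ e ∈ D, c e * X e ^ 2) ^ (1 / 2 : ℝ) *
      ((∑ e ∈ D, c e ^ (-q)) ^ (1 / (2 * q)) *
        (∑ e ∈ D, H e ^ (2 * (q / (q - 1)))) ^ ((1 - 1 / q) / 2)) := by
  have hq0 : 0 < q := by linarith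
  have h1 : ∑ e ∈ D, X e * H e ≤
      √(∑ e ∈ D, c e * X e ^ 2) * √(∑ e ∈ D, (c e)⁻¹ * H e ^ 2) := by
    have := Real.sum_mul_le_sqrt_mul_sqrt D (fun e => √(c e) * X e) (fun e => (√(c e))⁻¹ * H e)
    have e1 : ∑ e ∈ D, X e * H e = ∑ e ∈ D, √(c e) * X e * ((√(c e))⁻¹ * H e) :=
      Finset.sum_congr rfl fun e he => by
        have := (Real.sqrt_pos.2 (hc e he)).ne'
        field_simp
    have e2 : ∑ e ∈ D, c e * X e ^ 2 = ∑ e ∈ D, (√(c e) * X e) ^ 2 :=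
      Finset.sum_congr rfl fun e he => by rw [mul_pow, Real.sq_sqrt (hc e he).le]
    have e3 : ∑ e ∈ D, (c e)⁻¹ * H e ^ 2 = ∑ e ∈ D, ((√(c e))⁻¹ * H e) ^ 2 :=
      Finset.sum_congr rfl fun e he => by rw [mul_pow, inv_pow, Real.sq_sqrt (hc e he).le]
    rw [e1, e2, e3]
    exact this
  have hconj : q.HolderConjugate (q / (q - 1)) := by
    rw [Real.holderConjugate_iff]
    refine ⟨hq, ?_⟩
    have : q - 1 ≠ 0 := by linarith
    field_simp
    ring
  have h2 := Real.inner_le_Lp_mul_Lq_of_nonneg D hconj (f := fun e => (c e)⁻¹)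
    (g := fun e => H e ^ 2) (fun e he => inv_nonneg.2 (hc e he).le) (fun e _ => sq_nonneg _)
  have e4 : ∑ e ∈ D, (c e)⁻¹ ^ q = ∑ e ∈ D, c e ^ (-q) :=
    Finset.sum_congr rfl fun e he => by
      rw [Real.inv_rpow (hc e he).le, Real.rpow_neg (hc e he).le]
  have e5 : ∑ e ∈ D, (H e ^ 2) ^ (q / (q - 1)) = ∑ e ∈ D, H e ^ (2 * (q / (q - 1))) :=
    Finset.sum_congr rfl fun e he => by
      rw [← Real.rpow_natCast, ← Real.rpow_mul (hH e he)]; norm_num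
  rw [e4, e5] at h2
  refine h1.trans ?_
  rw [← Real.sqrt_eq_rpow]
  refine mul_le_mul_of_nonneg_left ?_ (Real.sqrt_nonneg _)
  have n1 : 0 ≤ ∑ e ∈ D, c e ^ (-q) := Finset.sum_nonneg fun e he => Real.rpow_nonneg (hc e he).le _
  have n2 : 0 ≤ ∑ e ∈ D, H e ^ (2 * (q / (q - 1))) :=
    Finset.sum_nonneg fun e he => Real.rpow_nonneg (hH e he) _
  refine (Real.sqrt_le_sqrt h2).trans (le_of_eq ?_)
  rw [Real.sqrt_eq_rpow, Real.mul_rpow (Real.rpow_nonneg n1 _) (Real.rpow_nonneg n2 _),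
    ← Real.rpow_mul n1, ← Real.rpow_mul n2]
  have : q - 1 ≠ 0 := by linarith
  congr 2 <;> field_simp

/-! ### Boxes and moment bounds -/

lemma mem_box {d : ℕ} {n : ℕ} {x : Vert d} : x ∈ box d (n : ℝ) ↔ ‖x‖ ≤ n := by
  rw [pi_norm_le_iff_of_nonneg (Nat.cast_nonneg n), box, Fintype.mem_piFinset]
  refine forall_congr' fun i => ?_
  rw [Finset.mem_Icc, Int.norm_eq_abs, abs_le, Int.ceil_le, Int.le_floor]

lemma card_box (d n : ℕ) : (box d (n : ℝ)).card = (2 * n + 1) ^ d := by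
  have h1 : ⌈-(n : ℝ)⌉ = -(n : ℤ) := by
    rw [Int.ceil_neg, Int.floor_natCast]
  rw [box, Fintype.card_piFinset, Finset.prod_const, Finset.card_univ, Fintype.card_fin, h1,
    Int.floor_natCast, Int.card_Icc]
  congr 1
  omega

lemma pow_le_card_box (d n : ℕ) : (n : ℝ) ^ d ≤ (box d (n : ℝ)).card := by
  rw [card_box]
  push_cast
  exact pow_le_pow_left₀ (Nat.cast_nonneg n) (by linarith [(Nat.cast_nonneg n : (0 : ℝ) ≤ n)]) d

lemma card_box_le (d : ℕ) {n : ℕ} (hn : 1 ≤ n) :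
    ((box d (n : ℝ)).card : ℝ) ≤ 3 ^ d * (n : ℝ) ^ d := by
  rw [card_box, ← mul_pow]
  push_cast
  have : (1 : ℝ) ≤ n := by exact_mod_cast hn
  exact pow_le_pow_left₀ (by linarith) (by linarith) d

lemma norm_unitv_le {d : ℕ} (i : Fin d) : ‖unitv d i‖ ≤ 1 := by
  rw [pi_norm_le_iff_of_nonneg zero_le_one]
  intro j
  by_cases h : j = i <;> simp [unitv, h]

lemma sum_box_edge_le {d : ℕ} {φ : EdgeIx d → ℝ} (hφ : ∀ e, 0 ≤ φ e) (Λ : Finset (Vert d))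
    (i : Fin d) : ∑ x ∈ Λ, φ (x, i) ≤ ∑ e ∈ edgesIn d Λ, φ e := by
  classical
  rw [← Finset.sum_image (f := φ) (s := Λ) (g := fun x => (x, i))
    fun a _ b _ hab => (Prod.mk.inj hab).1]
  refine Finset.sum_le_sum_of_subset_of_nonneg (fun e he => ?_) fun e _ _ => hφ e
  obtain ⟨x, hx, rfl⟩ := Finset.mem_image.1 he
  exact Finset.mem_biUnion.2 ⟨x, hx, Finset.mem_union_left _ (Finset.mem_image.2 ⟨i, by simp, rfl⟩)⟩

lemma sum_box_edge_sub_le {d : ℕ} {φ : EdgeIx d → ℝ} (hφ : ∀ e, 0 ≤ φ e) (Λ : Finset (Vert d))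
    (i : Fin d) : ∑ x ∈ Λ, φ (x - unitv d i, i) ≤ ∑ e ∈ edgesIn d Λ, φ e := by
  classical
  rw [← Finset.sum_image (f := φ) (s := Λ) (g := fun x => (x - unitv d i, i))
    fun a _ b _ hab => by simpa using (Prod.mk.inj hab).1]
  refine Finset.sum_le_sum_of_subset_of_nonneg (fun e he => ?_) fun e _ _ => hφ e
  obtain ⟨x, hx, rfl⟩ := Finset.mem_image.1 he
  exact Finset.mem_biUnion.2
    ⟨x, hx, Finset.mem_union_right _ (Finset.mem_image.2 ⟨i, by simp, rfl⟩)⟩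

lemma exists_sum_piOf_rpow_le {d : ℕ} {p : ℝ} (hp : 1 ≤ p) {ω : EnvSp d}
    (h : ∃ C : ℝ, ∀ n : ℕ, 1 ≤ n →
      (∑ e ∈ edgesIn d (box d (n : ℝ)), ω.1 e ^ p) / (n : ℝ) ^ d ≤ C) :
    ∃ C : ℝ, 0 < C ∧ ∀ n : ℕ, 1 ≤ n →
      ∑ x ∈ box d (n : ℝ), piOf d ω x ^ p ≤ C * (n : ℝ) ^ d := by
  obtain ⟨C, hC⟩ := h
  have hnn : ∀ e, 0 ≤ ω.1 e ^ p := fun e => Real.rpow_nonneg (ω.2 e).le p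
  have key : ∀ x, piOf d ω x ^ p ≤ ((2 * d : ℝ) ^ (p - 1)) *
      ∑ i, (ω.1 (x, i) ^ p + ω.1 (x - unitv d i, i) ^ p) := by
    intro x
    have h1 := Real.rpow_sum_le_const_mul_sum_rpow_of_nonneg
      (s := (Finset.univ : Finset (Fin d ⊕ Fin d))) (p := p)
      (f := Sum.elim (fun i => ω.1 (x, i)) fun i => ω.1 (x - unitv d i, i)) hp
      (by rintro (i | i) _ <;> exact (ω.2 _).le)
    simp only [Fintype.sum_sum_type, Sum.elim_inl, Sum.elim_inr, Finset.card_univ,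
      Fintype.card_sum, Fintype.card_fin] at h1
    rw [piOf, Finset.sum_add_distrib, Finset.sum_add_distrib]
    convert h1 using 3
    push_cast; ring
  refine ⟨(2 * d : ℝ) ^ (p - 1) * (d * (2 * max C 0)) + 1, by positivity, fun n hn => ?_⟩
  have hn0 : (0 : ℝ) < (n : ℝ) ^ d := pow_pos (by exact_mod_cast hn) d
  have hS : ∑ e ∈ edgesIn d (box d (n : ℝ)), ω.1 e ^ p ≤ max C 0 * (n : ℝ) ^ d :=
    ((div_le_iff₀ hn0).1 (hC n hn)).trans
      (mul_le_mul_of_nonneg_right (le_max_left _ _) hn0.le)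
  calc ∑ x ∈ box d (n : ℝ), piOf d ω x ^ p
      ≤ ∑ x ∈ box d (n : ℝ), ((2 * d : ℝ) ^ (p - 1)) *
          ∑ i, (ω.1 (x, i) ^ p + ω.1 (x - unitv d i, i) ^ p) := Finset.sum_le_sum fun x _ => key x
    _ = (2 * d : ℝ) ^ (p - 1) * ∑ i : Fin d, (∑ x ∈ box d (n : ℝ), ω.1 (x, i) ^ p
          + ∑ x ∈ box d (n : ℝ), ω.1 (x - unitv d i, i) ^ p) := by
        rw [← Finset.mul_sum, Finset.sum_comm]
        simp only [Finset.sum_add_distrib]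
    _ ≤ (2 * d : ℝ) ^ (p - 1) * ∑ _i : Fin d, 2 * (max C 0 * (n : ℝ) ^ d) := by
        refine mul_le_mul_of_nonneg_left (Finset.sum_le_sum fun i _ => ?_) (by positivity)
        have a1 := (sum_box_edge_le hnn (box d (n : ℝ)) i).trans hS
        have a2 := (sum_box_edge_sub_le hnn (box d (n : ℝ)) i).trans hS
        linarith
    _ ≤ _ := by
        rw [Finset.sum_const, Finset.card_univ, Fintype.card_fin, nsmul_eq_mul]
        nlinarith

lemma exists_sum_inv_rpow_le {d : ℕ} {q : ℝ} {ω : EnvSp d}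
    (h : ∃ C : ℝ, ∀ n : ℕ, 1 ≤ n →
      (∑ e ∈ edgesIn d (box d (n : ℝ)), ω.1 e ^ (-q)) / (n : ℝ) ^ d ≤ C) :
    ∃ C : ℝ, 0 < C ∧ ∀ n : ℕ, 1 ≤ n →
      ∑ e ∈ (Finset.univ : Finset (Fin d)) ×ˢ box d (n : ℝ), ω.1 (e.2, e.1) ^ (-q)
        ≤ C * (n : ℝ) ^ d := by
  obtain ⟨C, hC⟩ := h
  refine ⟨d * max C 0 + 1, by positivity, fun n hn => ?_⟩
  have hn0 : (0 : ℝ) < (n : ℝ) ^ d := pow_pos (by exact_mod_cast hn) d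
  rw [Finset.sum_product]
  calc _ ≤ ∑ _i : Fin d, max C 0 * (n : ℝ) ^ d := Finset.sum_le_sum fun i _ =>
        (sum_box_edge_le (fun e => Real.rpow_nonneg (ω.2 e).le (-q)) (box d (n : ℝ)) i).trans
          (((div_le_iff₀ hn0).1 (hC n hn)).trans
            (mul_le_mul_of_nonneg_right (le_max_left _ _) hn0.le))
    _ ≤ _ := by
        rw [Finset.sum_const, Finset.card_univ, Fintype.card_fin, nsmul_eq_mul]
        nlinarith

/-! ### Weighted Sobolev inequalities -/

lemma energy_eq_sum {d : ℕ} (ω : EnvSp d) {F : Vert d → ℝ} {T : Finset (Vert d)}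
    (hT : ∀ x ∉ T, F x = 0 ∧ ∀ i, F (x + unitv d i) = 0) :
    energy d ω F = ∑ e ∈ (Finset.univ : Finset (Fin d)) ×ˢ T,
      ω.1 (e.2, e.1) * |F (e.2 + unitv d e.1) - F e.2| ^ 2 := by
  rw [Finset.sum_product, energy]
  refine Finset.sum_congr rfl fun i _ => ?_
  rw [tsum_eq_sum (s := T) fun x hx => by rw [(hT x hx).1, (hT x hx).2 i]; simp]
  exact Finset.sum_congr rfl fun x _ => by rw [sq_abs]

lemma sum_edge_add_le {d : ℕ} {G : Vert d → ℝ} (hG : ∀ x, 0 ≤ G x) (hGs : FS G)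
    (T : Finset (Vert d)) :
    ∑ e ∈ (Finset.univ : Finset (Fin d)) ×ˢ T, (G (e.2 + unitv d e.1) + G e.2)
      ≤ 2 * d * ∑' x, G x := by
  have hs : Summable G := hGs.summable fun x hx => hx
  rw [Finset.sum_product]
  calc _ ≤ ∑ _i : Fin d, (∑' x, G x + ∑' x, G x) := by
        refine Finset.sum_le_sum fun i _ => ?_
        rw [Finset.sum_add_distrib]
        refine add_le_add ?_ (hs.sum_le_tsum T fun x _ => hG x)
        rw [← tsum_shift G (unitv d i)]
        exact ((Equiv.addRight (unitv d i)).summable_iff.2 hs).sum_le_tsum T fun x _ => hG _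
    _ = _ := by
        rw [Finset.sum_const, Finset.card_univ, Fintype.card_fin, nsmul_eq_mul]; ring

lemma sobolev_two_le {d : ℕ} (hd : 2 ≤ d) {q : ℝ} (hq : 1 < q) (ω : EnvSp d) {ρ : ℝ}
    (hρ : ρ = (1 + 1 / q - 2 / d) / 2) {F : Vert d → ℝ} (hF0 : ∀ x, 0 ≤ F x)
    {T : Finset (Vert d)} (hT : ∀ x ∉ T, F x = 0 ∧ ∀ i, F (x + unitv d i) = 0) :
    (∑' x, F x ^ (1 / ρ)) ^ ρ ≤
      ((d - 1) / (ρ * d)) * (2 ^ (2 * (q / (q - 1))) * (2 * d)) ^ ((1 - 1 / q) / 2) *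
        energy d ω F ^ (1 / 2 : ℝ) *
        (∑ e ∈ (Finset.univ : Finset (Fin d)) ×ˢ T, ω.1 (e.2, e.1) ^ (-q)) ^ (1 / (2 * q)) := by
  have hFS : FS F := T.finite_toSet.subset fun x hx => by
    by_contra h
    exact hx (hT x h).1
  have hd2 : (2 : ℝ) ≤ d := by exact_mod_cast hd
  have hd0 : (0 : ℝ) < d := by linarith
  have h2d : (2 : ℝ) / d ≤ 1 := (div_le_one hd0).2 hd2
  have hq0 : 0 < q := by linarith
  have hqi : 0 < 1 / q := by positivity
  have hqi1 : 1 / q < 1 := (div_lt_one hq0).2 hq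
  have hρ0 : 0 < ρ := by rw [hρ]; linarith
  set γ := ((d : ℝ) - 1) / (ρ * d) with hγ
  have hγρ : γ * ρ = (d - 1) / d := by rw [hγ]; field_simp
  have hdd : ((d : ℝ) - 1) / d = 1 - (2 / d) / 2 := by field_simp
  have hγ1 : 1 ≤ γ := by
    rw [hγ, one_le_div (by positivity)]
    have : ρ ≤ (d - 1) / d := by rw [hdd, hρ]; linarith
    calc ρ * d ≤ (d - 1) / d * d := mul_le_mul_of_nonneg_right this hd0.le
      _ = d - 1 := by field_simp
  set Z := ∑' x, F x ^ (1 / ρ) with hZ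
  have hZ0 : 0 ≤ Z := tsum_nonneg fun x => Real.rpow_nonneg (hF0 x) _
  set A := ∑ e ∈ (Finset.univ : Finset (Fin d)) ×ˢ T, ω.1 (e.2, e.1) ^ (-q) with hA
  have hA0 : 0 ≤ A := Finset.sum_nonneg fun e _ => Real.rpow_nonneg (ω.2 _).le _
  have hE0 := energy_nonneg ω F
  have hrhs : 0 ≤ γ * (2 ^ (2 * (q / (q - 1))) * (2 * d)) ^ ((1 - 1 / q) / 2) *
      energy d ω F ^ (1 / 2 : ℝ) * A ^ (1 / (2 * q)) := by positivity
  rcases hZ0.eq_or_lt with h0 | hZpos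
  · rw [← h0, Real.zero_rpow hρ0.ne']; exact hrhs
  have hqq : 0 ≤ q / (q - 1) := div_nonneg hq0.le (by linarith)
  -- the one-step estimate
  have hsob := sobolev_l1 hd (F := fun x => F x ^ γ) (fun x => Real.rpow_nonneg (hF0 x) _)
    (hFS.of_imp fun x hx => by
      simp only [hx]; exact Real.zero_rpow (by linarith))
  have e1 : ∀ x, (F x ^ γ) ^ ((d : ℝ) / (d - 1)) = F x ^ (1 / ρ) := fun x => by
    rw [← Real.rpow_mul (hF0 x)]
    congr 1
    have : (d : ℝ) - 1 ≠ 0 := by linarith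
    rw [hγ]; field_simp
  simp only [e1] at hsob
  set W := ∑ i, ∑' x, |F (x + unitv d i) ^ γ - F x ^ γ| with hW
  have hW0 : 0 ≤ W := Finset.sum_nonneg fun i _ => tsum_nonneg fun x => abs_nonneg _
  have hsob' : Z ^ (((d : ℝ) - 1) / d) ≤ W := by
    have hdm : (0 : ℝ) < d - 1 := by linarith
    calc Z ^ (((d : ℝ) - 1) / d) ≤ (W ^ ((d : ℝ) / (d - 1))) ^ (((d : ℝ) - 1) / d) :=
          Real.rpow_le_rpow hZ0 hsob (by positivity)
      _ = W := by
          rw [← Real.rpow_mul hW0, div_mul_div_cancel₀ hdm.ne', div_self hd0.ne', Real.rpow_one]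
  have hγ0 : γ ≠ 0 := by linarith
  have hWle : W ≤ γ * ∑ e ∈ (Finset.univ : Finset (Fin d)) ×ˢ T,
      |F (e.2 + unitv d e.1) - F e.2| *
        (F (e.2 + unitv d e.1) ^ (γ - 1) + F e.2 ^ (γ - 1)) := by
    rw [Finset.mul_sum, Finset.sum_product, hW]
    refine Finset.sum_le_sum fun i _ => ?_
    rw [tsum_eq_sum (s := T) fun x hx => by rw [(hT x hx).1, (hT x hx).2 i]; simp]
    exact Finset.sum_le_sum fun x _ => abs_rpow_sub_rpow_le hγ1 (hF0 _) (hF0 _)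
  have hhol := holder_weighted ((Finset.univ : Finset (Fin d)) ×ˢ T)
    (c := fun e => ω.1 (e.2, e.1)) (X := fun e => |F (e.2 + unitv d e.1) - F e.2|)
    (H := fun e => F (e.2 + unitv d e.1) ^ (γ - 1) + F e.2 ^ (γ - 1)) hq
    (fun e _ => ω.2 _)
    (fun e _ => add_nonneg (Real.rpow_nonneg (hF0 _) _) (Real.rpow_nonneg (hF0 _) _))
  rw [← energy_eq_sum ω hT, ← hA] at hhol
  have hexp : (γ - 1) * (2 * (q / (q - 1))) = 1 / ρ := by
    have h1 : γ - 1 = ((1 - 1 / q) / 2) / ρ := by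
      rw [eq_div_iff hρ0.ne', sub_mul, hγρ, hdd, hρ]; ring
    have : q - 1 ≠ 0 := by linarith
    rw [h1]; field_simp
  have hHle : ∑ e ∈ (Finset.univ : Finset (Fin d)) ×ˢ T,
      (F (e.2 + unitv d e.1) ^ (γ - 1) + F e.2 ^ (γ - 1)) ^ (2 * (q / (q - 1)))
      ≤ 2 ^ (2 * (q / (q - 1))) * (2 * d) * Z := by
    have h1 := sum_edge_add_le (G := fun x => F x ^ (1 / ρ))
      (fun x => Real.rpow_nonneg (hF0 x) _)
      (hFS.of_imp fun x hx => by rw [hx]; exact Real.zero_rpow (by positivity)) T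
    have h2 : (0 : ℝ) ≤ 2 ^ (2 * (q / (q - 1))) := by positivity
    rw [mul_assoc]
    refine le_trans ?_ (mul_le_mul_of_nonneg_left h1 h2)
    rw [Finset.mul_sum]
    exact Finset.sum_le_sum fun e _ =>
      add_rpow_le_two (sub_nonneg.2 hγ1) (hF0 _) (hF0 _) (by linarith) hexp
  have hH0 : 0 ≤ ∑ e ∈ (Finset.univ : Finset (Fin d)) ×ˢ T,
      (F (e.2 + unitv d e.1) ^ (γ - 1) + F e.2 ^ (γ - 1)) ^ (2 * (q / (q - 1))) :=
    Finset.sum_nonneg fun e _ => Real.rpow_nonneg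
      (add_nonneg (Real.rpow_nonneg (hF0 _) _) (Real.rpow_nonneg (hF0 _) _)) _
  have hb : 0 ≤ (1 - 1 / q) / 2 := by linarith
  set β := (1 - 1 / q) / 2 with hβ
  have hfin : Z ^ (((d : ℝ) - 1) / d) ≤ γ * (energy d ω F ^ (1 / 2 : ℝ) * (A ^ (1 / (2 * q)) *
      ((2 ^ (2 * (q / (q - 1))) * (2 * d)) ^ β * Z ^ β))) := by
    refine hsob'.trans (hWle.trans (mul_le_mul_of_nonneg_left (hhol.trans ?_) (by linarith)))
    refine mul_le_mul_of_nonneg_left (mul_le_mul_of_nonneg_left ?_ (by positivity))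
      (by positivity)
    rw [← Real.mul_rpow (by positivity) hZ0]
    exact Real.rpow_le_rpow hH0 hHle hb
  have hsplit : Z ^ (((d : ℝ) - 1) / d) = Z ^ ρ * Z ^ β := by
    rw [← Real.rpow_add hZpos]; congr 1; rw [hdd, hρ, hβ]; ring
  rw [hsplit] at hfin
  have hZβ : 0 < Z ^ β := Real.rpow_pos_of_pos hZpos _
  refine le_of_mul_le_mul_right (hfin.trans (le_of_eq ?_)) hZβ
  ring

lemma eq_zero_off_box {d : ℕ} {F : Vert d → ℝ} {R : ℕ} (hF : ∀ x, F x ≠ 0 → ‖x‖ ≤ R) :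
    ∀ x ∉ box d ((R + 1 : ℕ) : ℝ), F x = 0 ∧ ∀ i, F (x + unitv d i) = 0 := by
  intro x hx
  rw [mem_box, not_le] at hx
  push_cast at hx
  refine ⟨by_contra fun h => ?_, fun i => by_contra fun h => ?_⟩
  · linarith [hF x h]
  · have h1 := hF _ h
    have h2 : ‖x‖ ≤ ‖x + unitv d i‖ + ‖unitv d i‖ := by
      simpa using norm_sub_le (x + unitv d i) (unitv d i)
    linarith [norm_unitv_le i]

lemma weighted_sobolev_two {d : ℕ} (hd : 2 ≤ d) {p q : ℝ} (hp : 1 < p) (hq : 1 < q)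
    (hpq : 1 / p + 1 / q < 2 / (d : ℝ)) {ω : EnvSp d} (hmom : InOmegaPQ d p q ω) :
    ∃ κ : ℝ, 1 < κ ∧ ∀ L : ℕ, ∃ C : ℝ, 0 < C ∧ ∀ r : ℕ, 1 ≤ r → ∀ F : Vert d → ℝ,
      (∀ x, 0 ≤ F x) → (∀ x, F x ≠ 0 → ‖x‖ ≤ (L * r : ℕ)) →
      ∑' x, F x ^ (2 * κ) * piOf d ω x ≤
        C * ((r : ℝ) ^ d) ^ (1 - κ) * ((r : ℝ) ^ 2 * energy d ω F) ^ κ := by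
  have hd2 : (2 : ℝ) ≤ d := by exact_mod_cast hd
  have hd0 : (0 : ℝ) < d := by linarith
  have h2d : (2 : ℝ) / d ≤ 1 := (div_le_one hd0).2 hd2
  have hq0 : 0 < q := by linarith
  have hp0 : 0 < p := by linarith
  have hqi : 0 < 1 / q := by positivity
  have hpi1 : 1 / p < 1 := (div_lt_one hp0).2 hp
  obtain ⟨ρ, hρ⟩ : ∃ ρ : ℝ, ρ = (1 + 1 / q - 2 / d) / 2 := ⟨_, rfl⟩
  have hρ0 : 0 < ρ := by rw [hρ]; linarith
  obtain ⟨κ, hκ⟩ : ∃ κ : ℝ, κ = (1 - 1 / p) / (2 * ρ) := ⟨_, rfl⟩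
  have hκρ : κ * (2 * ρ) = 1 - 1 / p := by rw [hκ, div_mul_cancel₀]; positivity
  have hκ1 : 1 < κ := by
    rw [hκ, one_lt_div (by positivity), hρ]; linarith
  obtain ⟨CP, hCP0, hCP⟩ := exists_sum_piOf_rpow_le hp.le hmom.1
  obtain ⟨CQ, hCQ0, hCQ⟩ := exists_sum_inv_rpow_le hmom.2
  obtain ⟨K, hK, hK0⟩ : ∃ K : ℝ, K = ((d - 1) / (ρ * d)) *
      (2 ^ (2 * (q / (q - 1))) * (2 * d)) ^ ((1 - 1 / q) / 2) ∧ 0 < K := by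
    refine ⟨_, rfl, ?_⟩
    have : (0 : ℝ) < d - 1 := by linarith
    positivity
  refine ⟨κ, hκ1, fun L => ?_⟩
  obtain ⟨a, ha⟩ : ∃ a : ℝ, a = ((L : ℝ) + 1) ^ d := ⟨_, rfl⟩
  have ha0 : 0 < a := by rw [ha]; positivity
  refine ⟨K ^ (2 * κ) * (CQ * a) ^ (κ / q) * (CP * a) ^ (1 / p), by positivity, ?_⟩
  intro r hr F hF0 hFs
  have hr0 : (0 : ℝ) < r := by exact_mod_cast hr
  have hT := eq_zero_off_box hFs
  set R : ℕ := L * r + 1 with hR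
  set T := box d (R : ℝ) with hTdef
  have hRle : (R : ℝ) ^ d ≤ a * (r : ℝ) ^ d := by
    rw [ha, ← mul_pow]
    refine pow_le_pow_left₀ (Nat.cast_nonneg _) ?_ d
    rw [hR]; push_cast
    have : (1 : ℝ) ≤ r := by exact_mod_cast hr
    nlinarith
  set N := (r : ℝ) ^ d with hN
  have hN0 : 0 < N := pow_pos hr0 d
  have hE0 := energy_nonneg ω F
  set E := energy d ω F
  set A := ∑ e ∈ (Finset.univ : Finset (Fin d)) ×ˢ T, ω.1 (e.2, e.1) ^ (-q) with hA
  have hA0 : 0 ≤ A := Finset.sum_nonneg fun e _ => Real.rpow_nonneg (ω.2 _).le _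
  have hAle : A ≤ (CQ * a) * N := by
    refine (hCQ R (by omega)).trans ?_
    rw [mul_assoc]
    exact mul_le_mul_of_nonneg_left hRle hCQ0.le
  have hPle : ∑ x ∈ T, piOf d ω x ^ p ≤ (CP * a) * N := by
    refine (hCP R (by omega)).trans ?_
    rw [mul_assoc]
    exact mul_le_mul_of_nonneg_left hRle hCP0.le
  have hpi0 : ∀ x, 0 ≤ piOf d ω x := fun x => (piOf_pos (by omega) ω x).le
  have hsob := sobolev_two_le hd hq ω hρ hF0 hT
  rw [← hK, ← hA] at hsob
  set Z := ∑' x, F x ^ (1 / ρ) with hZ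
  have hZ0 : 0 ≤ Z := tsum_nonneg fun x => Real.rpow_nonneg (hF0 x) _
  have hconj : (p / (p - 1)).HolderConjugate p :=
    ((Real.holderConjugate_iff_eq_conjExponent hp).2 rfl).symm
  have hhol := Real.inner_le_Lp_mul_Lq_of_nonneg T hconj (f := fun x => F x ^ (2 * κ))
    (g := fun x => piOf d ω x) (fun x _ => Real.rpow_nonneg (hF0 x) _) (fun x _ => hpi0 x)
  have e1 : ∑ x ∈ T, (F x ^ (2 * κ)) ^ (p / (p - 1)) = Z := by
    rw [hZ, tsum_eq_sum (s := T) fun x hx => by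
      rw [(hT x hx).1]; exact Real.zero_rpow (by positivity)]
    refine Finset.sum_congr rfl fun x _ => ?_
    rw [← Real.rpow_mul (hF0 x)]
    congr 1
    have : p - 1 ≠ 0 := by linarith
    rw [hκ]; field_simp
  have e2 : 1 / (p / (p - 1)) = ρ * (2 * κ) := by
    rw [show ρ * (2 * κ) = κ * (2 * ρ) by ring, hκρ]; field_simp
  rw [e1, e2, Real.rpow_mul hZ0] at hhol
  rw [tsum_eq_sum (s := T) fun x hx => by
    rw [(hT x hx).1, Real.zero_rpow (by positivity), zero_mul]]
  refine hhol.trans ?_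
  have hκ0 : 0 < κ := by linarith
  calc (Z ^ ρ) ^ (2 * κ) * (∑ x ∈ T, piOf d ω x ^ p) ^ (1 / p)
      ≤ (K * E ^ (1 / 2 : ℝ) * A ^ (1 / (2 * q))) ^ (2 * κ) * ((CP * a) * N) ^ (1 / p) := by
        refine mul_le_mul (Real.rpow_le_rpow (Real.rpow_nonneg hZ0 _) hsob (by positivity))
          (Real.rpow_le_rpow (Finset.sum_nonneg fun x _ => Real.rpow_nonneg (hpi0 x) _) hPle
            (by positivity)) (Real.rpow_nonneg (Finset.sum_nonneg fun x _ =>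
              Real.rpow_nonneg (hpi0 x) _) _) (by positivity)
    _ = K ^ (2 * κ) * E ^ κ * A ^ (κ / q) * ((CP * a) * N) ^ (1 / p) := by
        rw [Real.mul_rpow (by positivity) (by positivity), Real.mul_rpow hK0.le (by positivity),
          ← Real.rpow_mul hE0, ← Real.rpow_mul hA0,
          show (1 / 2 : ℝ) * (2 * κ) = κ by ring,
          show 1 / (2 * q) * (2 * κ) = κ / q by field_simp]
    _ ≤ K ^ (2 * κ) * E ^ κ * ((CQ * a) * N) ^ (κ / q) * ((CP * a) * N) ^ (1 / p) := by
        gcongr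
    _ = _ := by
        rw [Real.mul_rpow (x := CQ * a) (by positivity) hN0.le,
          Real.mul_rpow (x := CP * a) (by positivity) hN0.le,
          Real.mul_rpow (by positivity) hE0]
        have e3 : N ^ (κ / q) * N ^ (1 / p) = N ^ (1 - κ) * ((r : ℝ) ^ 2) ^ κ := by
          rw [← Real.rpow_add hN0, hN, ← Real.rpow_natCast, ← Real.rpow_natCast,
            ← Real.rpow_mul hr0.le, ← Real.rpow_mul hr0.le, ← Real.rpow_mul hr0.le,
            ← Real.rpow_add hr0]
          congr 1
          have h3 : κ * (1 + 1 / q - 2 / d) = 1 - 1 / p := by rw [← hκρ, hρ]; ring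
          have h4 : (d : ℝ) * (2 / d) = 2 := by field_simp
          push_cast
          linear_combination (d : ℝ) * h3 + κ * h4
        linear_combination (K ^ (2 * κ) * E ^ κ * (CQ * a) ^ (κ / q) * (CP * a) ^ (1 / p)) * e3

lemma le_sum_abs_grad {d : ℕ} {F : Vert d → ℝ} (hF0 : ∀ x, 0 ≤ F x) {T : Finset (Vert d)}
    (hT : ∀ x ∉ T, F x = 0 ∧ ∀ i, F (x + unitv d i) = 0) (i : Fin d) (x : Vert d) :
    F x ≤ ∑ y ∈ T, |F (y + unitv d i) - F y| := by
  have hFS : FS F := T.finite_toSet.subset fun x hx => by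
    by_contra h
    exact hx (hT x h).1
  have h1 := (ofReal_abs_le_tsum_line hFS x i).trans
    (ENNReal.tsum_comp_le_tsum_of_injective (Function.update_injective x i)
      fun y => ENNReal.ofReal |F (y + unitv d i) - F y|)
  rw [tsum_eq_sum (s := T) fun y hy => by rw [(hT y hy).1, (hT y hy).2 i]; simp,
    ← ENNReal.ofReal_sum_of_nonneg fun _ _ => abs_nonneg _,
    ENNReal.ofReal_le_ofReal_iff (Finset.sum_nonneg fun _ _ => abs_nonneg _),
    abs_of_nonneg (hF0 x)] at h1
  exact h1

lemma weighted_sobolev_one {p q : ℝ} (hp : 1 < p) (hq : 1 < q)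
    {ω : EnvSp 1} (hmom : InOmegaPQ 1 p q ω) :
    ∀ L : ℕ, ∃ C : ℝ, 0 < C ∧ ∀ r : ℕ, 1 ≤ r → ∀ F : Vert 1 → ℝ,
      (∀ x, 0 ≤ F x) → (∀ x, F x ≠ 0 → ‖x‖ ≤ (L * r : ℕ)) →
      ∑' x, F x ^ (2 * 2 : ℝ) * piOf 1 ω x ≤
        C * ((r : ℝ) ^ 1) ^ (1 - 2 : ℝ) * ((r : ℝ) ^ 2 * energy 1 ω F) ^ (2 : ℝ) := by
  intro L
  obtain ⟨CP, hCP0, hCP⟩ := exists_sum_piOf_rpow_le hp.le hmom.1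
  obtain ⟨CQ, hCQ0, hCQ⟩ := exists_sum_inv_rpow_le hmom.2
  obtain ⟨a, ha⟩ : ∃ a : ℝ, a = (L : ℝ) + 1 := ⟨_, rfl⟩
  have ha0 : 0 < a := by rw [ha]; positivity
  refine ⟨((3 + CQ) * a) ^ 2 * ((3 + CP) * a), by positivity, fun r hr F hF0 hFs => ?_⟩
  have hr0 : (0 : ℝ) < r := by exact_mod_cast hr
  have hT := eq_zero_off_box hFs
  set R : ℕ := L * r + 1 with hR
  set T := box 1 (R : ℝ) with hTdef
  have hRle : (R : ℝ) ≤ a * r := by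
    rw [ha, hR]; push_cast
    have : (1 : ℝ) ≤ r := by exact_mod_cast hr
    nlinarith
  have hcard : (T.card : ℝ) ≤ 3 * R := by simpa using card_box_le 1 (n := R) (by omega)
  have hE0 := energy_nonneg ω F
  have hone : ∀ {t s : ℝ}, 0 < t → 1 ≤ s → t ≤ 1 + t ^ s := fun {t s} ht hs => by
    rcases le_total t 1 with h | h
    · linarith [Real.rpow_pos_of_pos ht s]
    · have := Real.rpow_le_rpow_of_exponent_le h hs
      rw [Real.rpow_one] at this
      linarith
  have hpi0 : ∀ x, 0 < piOf 1 ω x := fun x => piOf_pos le_rfl ω x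
  have hc0 : ∀ x, 0 < ω.1 (x, 0) := fun x => ω.2 _
  have hA : ∑ x ∈ T, (ω.1 (x, 0))⁻¹ ≤ ((3 + CQ) * a) * r := by
    have h1 := hCQ R (by omega)
    rw [Finset.sum_product, Fin.sum_univ_one, pow_one] at h1
    calc ∑ x ∈ T, (ω.1 (x, 0))⁻¹ ≤ ∑ x ∈ T, (1 + ω.1 (x, 0) ^ (-q)) :=
          Finset.sum_le_sum fun x _ => by
            rw [Real.rpow_neg (hc0 x).le, ← Real.inv_rpow (hc0 x).le]
            exact hone (inv_pos.2 (hc0 x)) hq.le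
      _ ≤ 3 * R + CQ * R := by
          rw [Finset.sum_add_distrib, Finset.sum_const, nsmul_eq_mul, mul_one]
          exact add_le_add hcard h1
      _ ≤ _ := by nlinarith
  have hP : ∑ x ∈ T, piOf 1 ω x ≤ ((3 + CP) * a) * r := by
    have h1 := hCP R (by omega)
    rw [pow_one] at h1
    calc ∑ x ∈ T, piOf 1 ω x ≤ ∑ x ∈ T, (1 + piOf 1 ω x ^ p) :=
          Finset.sum_le_sum fun x _ => hone (hpi0 x) hp.le
      _ ≤ 3 * R + CP * R := by
          rw [Finset.sum_add_distrib, Finset.sum_const, nsmul_eq_mul, mul_one]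
          exact add_le_add hcard h1
      _ ≤ _ := by nlinarith
  have hE : energy 1 ω F = ∑ x ∈ T, ω.1 (x, 0) * |F (x + unitv 1 0) - F x| ^ 2 := by
    rw [energy_eq_sum ω hT, Finset.sum_product, Fin.sum_univ_one]
  have hcs := Finset.sum_mul_sq_le_sq_mul_sq T
    (fun x => √(ω.1 (x, 0)) * |F (x + unitv 1 0) - F x|) fun x => (√(ω.1 (x, 0)))⁻¹
  have hsq : ∀ x, F x ^ 2 ≤ energy 1 ω F * (((3 + CQ) * a) * r) := fun x => by
    calc F x ^ 2 ≤ (∑ y ∈ T, |F (y + unitv 1 0) - F y|) ^ 2 :=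
          pow_le_pow_left₀ (hF0 x) (le_sum_abs_grad hF0 hT 0 x) 2
      _ = (∑ x ∈ T, √(ω.1 (x, 0)) * |F (x + unitv 1 0) - F x| * (√(ω.1 (x, 0)))⁻¹) ^ 2 := by
          congr 1
          refine Finset.sum_congr rfl fun y _ => ?_
          have := (Real.sqrt_pos.2 (hc0 y)).ne'
          field_simp
      _ ≤ _ := hcs
      _ = energy 1 ω F * ∑ x ∈ T, (ω.1 (x, 0))⁻¹ := by
          rw [hE]
          simp only [mul_pow, inv_pow, Real.sq_sqrt (hc0 _).le]
      _ ≤ _ := mul_le_mul_of_nonneg_left hA hE0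
  rw [tsum_eq_sum (s := T) fun x hx => by
    rw [(hT x hx).1, Real.zero_rpow (by norm_num), zero_mul]]
  have h4 : ∀ x, F x ^ (2 * 2 : ℝ) ≤ (energy 1 ω F * (((3 + CQ) * a) * r)) ^ 2 := fun x => by
    rw [Real.rpow_mul (hF0 x), Real.rpow_two, Real.rpow_two]
    exact pow_le_pow_left₀ (sq_nonneg _) (hsq x) 2
  calc ∑ x ∈ T, F x ^ (2 * 2 : ℝ) * piOf 1 ω x
      ≤ ∑ x ∈ T, (energy 1 ω F * (((3 + CQ) * a) * r)) ^ 2 * piOf 1 ω x :=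
        Finset.sum_le_sum fun x _ => mul_le_mul_of_nonneg_right (h4 x) (hpi0 x).le
    _ ≤ (energy 1 ω F * (((3 + CQ) * a) * r)) ^ 2 * (((3 + CP) * a) * r) := by
        rw [← Finset.mul_sum]
        exact mul_le_mul_of_nonneg_left hP (sq_nonneg _)
    _ = _ := by
        rw [show (1 - 2 : ℝ) = -1 by norm_num, Real.rpow_neg_one, Real.rpow_two, pow_one]
        field_simp

lemma weighted_sobolev {d : ℕ} (hd : 1 ≤ d) {p q : ℝ} (hp : 1 < p) (hq : 1 < q)
    (hpq : 2 ≤ d → 1 / p + 1 / q < 2 / (d : ℝ)) {ω : EnvSp d} (hmom : InOmegaPQ d p q ω) :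
    ∃ κ : ℝ, 1 < κ ∧ ∀ L : ℕ, ∃ C : ℝ, 0 < C ∧ ∀ r : ℕ, 1 ≤ r → ∀ F : Vert d → ℝ,
      (∀ x, 0 ≤ F x) → (∀ x, F x ≠ 0 → ‖x‖ ≤ (L * r : ℕ)) →
      ∑' x, F x ^ (2 * κ) * piOf d ω x ≤
        C * ((r : ℝ) ^ d) ^ (1 - κ) * ((r : ℝ) ^ 2 * energy d ω F) ^ κ := by
  rcases hd.eq_or_lt with rfl | h
  · exact ⟨2, one_lt_two, weighted_sobolev_one hp hq hmom⟩
  · exact weighted_sobolev_two h hp hq (hpq h) hmom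

/-! ### Polynomial weights and the induction over scales -/

/-- The weight `(1 + ‖x‖ / r) ^ m`. -/
def wgt (d m r : ℕ) (x : Vert d) : ℝ := (1 + ‖x‖ / r) ^ m

lemma one_le_wgt {d : ℕ} (m r : ℕ) (x : Vert d) : 1 ≤ wgt d m r x :=
  one_le_pow₀ (by linarith [div_nonneg (norm_nonneg x) (Nat.cast_nonneg (α := ℝ) r)])

lemma abs_norm_add_unitv_sub_le {d : ℕ} (x : Vert d) (i : Fin d) :
    |‖x + unitv d i‖ - ‖x‖| ≤ 1 :=
  (abs_norm_sub_norm_le _ _).trans (by simpa using norm_unitv_le i)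

lemma sq_pow_sub_pow_le {a b δ : ℝ} (m : ℕ) (ha : 1 ≤ a) (hb : 1 ≤ b) (hδ : δ ≤ 1)
    (hab : |a - b| ≤ δ) : (a ^ m - b ^ m) ^ 2 ≤ (m * 2 ^ m) ^ 2 * δ ^ 2 * (b ^ m) ^ 2 := by
  have hδ0 : 0 ≤ δ := (abs_nonneg _).trans hab
  have hmax : max a b ≤ 2 * b := max_le (by linarith [(abs_le.1 hab).2]) (by linarith)
  have hmax1 : 1 ≤ max a b := ha.trans (le_max_left _ _)
  have h1 : |a ^ m - b ^ m| ≤ m * 2 ^ m * δ * b ^ m := by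
    have h2 := abs_pow_sub_pow_le a b m
    rw [abs_of_nonneg (by linarith : 0 ≤ a), abs_of_nonneg (by linarith : 0 ≤ b)] at h2
    calc |a ^ m - b ^ m| ≤ |a - b| * m * max a b ^ (m - 1) := h2
      _ ≤ δ * m * (2 * b) ^ m := by
          have h3 : max a b ^ (m - 1) ≤ (2 * b) ^ m :=
            (pow_le_pow_right₀ hmax1 (Nat.sub_le m 1)).trans
              (pow_le_pow_left₀ (by linarith) hmax m)
          exact mul_le_mul (mul_le_mul_of_nonneg_right hab (Nat.cast_nonneg m)) h3
            (by positivity) (by positivity)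
      _ = _ := by rw [mul_pow]; ring
  calc (a ^ m - b ^ m) ^ 2 = |a ^ m - b ^ m| ^ 2 := (sq_abs _).symm
    _ ≤ (m * 2 ^ m * δ * b ^ m) ^ 2 := pow_le_pow_left₀ (abs_nonneg _) h1 2
    _ = _ := by ring

lemma sq_wgt_grad_le {d m r : ℕ} (hr : 1 ≤ r) (x : Vert d) (i : Fin d) :
    (wgt d m r (x + unitv d i) - wgt d m r x) ^ 2
        ≤ (((m * 2 ^ m : ℝ) ^ 2 + 1) / (r : ℝ) ^ 2) * wgt d m r x ^ 2 ∧
      (wgt d m r (x + unitv d i) - wgt d m r x) ^ 2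
        ≤ (((m * 2 ^ m : ℝ) ^ 2 + 1) / (r : ℝ) ^ 2) * wgt d m r (x + unitv d i) ^ 2 := by
  have hr0 : (0 : ℝ) < r := by exact_mod_cast hr
  have hr1 : (1 : ℝ) ≤ r := by exact_mod_cast hr
  have hδ : 1 / (r : ℝ) ≤ 1 := (div_le_one hr0).2 hr1
  have h1 : ∀ y : Vert d, 1 ≤ 1 + ‖y‖ / r := fun y => by
    linarith [div_nonneg (norm_nonneg y) hr0.le]
  have hab : |1 + ‖x + unitv d i‖ / r - (1 + ‖x‖ / r)| ≤ 1 / r := by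
    rw [show 1 + ‖x + unitv d i‖ / r - (1 + ‖x‖ / r) = (‖x + unitv d i‖ - ‖x‖) / r by ring,
      abs_div, abs_of_pos hr0]
    exact div_le_div_of_nonneg_right (abs_norm_add_unitv_sub_le x i) hr0.le
  have h2 := sq_pow_sub_pow_le m (h1 (x + unitv d i)) (h1 x) hδ hab
  have h3 := sq_pow_sub_pow_le m (h1 x) (h1 (x + unitv d i)) hδ (by rwa [abs_sub_comm])
  have h4 : ∀ t : ℝ, (m * 2 ^ m : ℝ) ^ 2 * (1 / (r : ℝ)) ^ 2 * t ^ 2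
      ≤ (((m * 2 ^ m : ℝ) ^ 2 + 1) / (r : ℝ) ^ 2) * t ^ 2 := fun t => by
    rw [one_div, inv_pow, ← div_eq_mul_inv]
    gcongr
    linarith
  refine ⟨h2.trans (h4 _), ?_⟩
  rw [sub_sq_comm]
  exact h3.trans (h4 _)

/-- A cutoff function equal to one on the ball of radius `R` and vanishing off the ball of
radius `2 * R`. -/
def cutoff (d R : ℕ) (x : Vert d) : ℝ := max 0 (min 1 (2 - ‖x‖ / R))

lemma cutoff_nonneg {d : ℕ} (R : ℕ) (x : Vert d) : 0 ≤ cutoff d R x := le_max_left _ _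

lemma cutoff_le_one {d : ℕ} (R : ℕ) (x : Vert d) : cutoff d R x ≤ 1 :=
  max_le zero_le_one (min_le_left _ _)

lemma cutoff_eq_one {d R : ℕ} (hR : 1 ≤ R) {x : Vert d} (hx : ‖x‖ ≤ R) : cutoff d R x = 1 := by
  have hR0 : (0 : ℝ) < R := by exact_mod_cast hR
  have : ‖x‖ / R ≤ 1 := (div_le_one hR0).2 hx
  rw [cutoff, min_eq_left (by linarith), max_eq_right zero_le_one]

lemma norm_le_of_cutoff_ne_zero {d R : ℕ} (hR : 1 ≤ R) {x : Vert d} (hx : cutoff d R x ≠ 0) :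
    ‖x‖ ≤ 2 * R := by
  have hR0 : (0 : ℝ) < R := by exact_mod_cast hR
  by_contra! h
  refine hx (max_eq_left ((min_le_right _ _).trans ?_))
  have : 2 ≤ ‖x‖ / R := (le_div_iff₀ hR0).2 h.le
  linarith

lemma abs_cutoff_grad_le {d R : ℕ} (x : Vert d) (i : Fin d) :
    |cutoff d R (x + unitv d i) - cutoff d R x| ≤ 1 / R := by
  refine (abs_max_sub_max_le_max _ _ _ _).trans ?_
  rw [sub_self, abs_zero]
  refine max_le (by positivity) ((abs_min_sub_min_le_max _ _ _ _).trans ?_)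
  rw [sub_self, abs_zero]
  refine max_le (by positivity) ?_
  rw [show 2 - ‖x + unitv d i‖ / R - (2 - ‖x‖ / R) = -((‖x + unitv d i‖ - ‖x‖) / R) by ring,
    abs_neg, abs_div, abs_of_nonneg (Nat.cast_nonneg (α := ℝ) R)]
  exact div_le_div_of_nonneg_right (abs_norm_add_unitv_sub_le x i) (Nat.cast_nonneg R)

/-- The weighted `ℓ^(2 k + 2)` functional. -/
def wnorm (d : ℕ) (ω : EnvSp d) (k m r : ℕ) (u : Vert d → ℝ) : ℝ :=
  ∑' x, u x ^ (2 * k + 2) * wgt d m r x ^ 2 * piOf d ω x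

lemma wnorm_nonneg {d : ℕ} (hd : 1 ≤ d) (ω : EnvSp d) (k m r : ℕ) {u : Vert d → ℝ}
    (hu : ∀ x, 0 ≤ u x) : 0 ≤ wnorm d ω k m r u :=
  tsum_nonneg fun x => mul_nonneg (mul_nonneg (pow_nonneg (hu x) _) (sq_nonneg _))
    (piOf_pos hd ω x).le

/-- The time step (in units of `r ^ 2`) used at scale `r`. -/
def stepc (k m : ℕ) : ℝ := 1 / (16 * ((k : ℝ) + 1) * ((m * 2 ^ m : ℝ) ^ 2 + 1))

lemma stepc_pos (k m : ℕ) : 0 < stepc k m := by unfold stepc; positivity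

lemma step_bounds {d : ℕ} (hd : 1 ≤ d) (ω : EnvSp d) (k m : ℕ) {r R : ℕ} (hr : 1 ≤ r)
    (hrR : r ≤ R) {u v : Vert d → ℝ} (hu : ∀ x, 0 ≤ u x) (hv : ∀ x, 0 ≤ v x)
    (hus : FS u) (hvs : FS v)
    (hsub : ∀ x, u x + stepc k m * (r : ℝ) ^ 2 * (u x - avgOp d ω u x) ≤ v x) :
    wnorm d ω k m r u ≤ 2 * wnorm d ω k m r v ∧
    (r : ℝ) ^ 2 * energy d ω (fun x => u x ^ (k + 1) * cutoff d R x)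
      ≤ (4 * ((k : ℝ) + 1) / stepc k m) * wnorm d ω k m r v := by
  have hr0 : (0 : ℝ) < r := by exact_mod_cast hr
  have hε := stepc_pos k m
  have hpi : ∀ x, 0 ≤ piOf d ω x := fun x => (piOf_pos hd ω x).le
  obtain ⟨D, hD⟩ : ∃ D : ℝ, D = (m * 2 ^ m : ℝ) ^ 2 + 1 := ⟨_, rfl⟩
  have hD1 : 1 ≤ D := by rw [hD]; linarith [sq_nonneg (m * 2 ^ m : ℝ)]
  have hεD : 8 * ((k : ℝ) + 1) * (stepc k m * (r : ℝ) ^ 2) * (D / (r : ℝ) ^ 2) = 1 / 2 := by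
    rw [stepc, ← hD]; field_simp; norm_num
  have hw0 : ∀ x, 0 ≤ wgt d m r x := fun x => zero_le_one.trans (one_le_wgt m r x)
  have hGsum : ∑' x, u x ^ (2 * k + 2) * (D / (r : ℝ) ^ 2 * wgt d m r x ^ 2) * piOf d ω x
      = D / (r : ℝ) ^ 2 * wnorm d ω k m r u := by
    rw [wnorm, ← tsum_mul_left]
    exact tsum_congr fun x => by ring
  have hE1 := energy_nonneg ω (fun x => u x ^ (k + 1) * wgt d m r x)
  have h1 := energy_step hd ω k (h := stepc k m * (r : ℝ) ^ 2) (by positivity) hu hv hw0 hus hvs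
    hsub (G := fun x => D / (r : ℝ) ^ 2 * wgt d m r x ^ 2)
    (fun x i => by rw [hD]; exact sq_wgt_grad_le hr x i)
  rw [hGsum, ← mul_assoc, hεD] at h1
  have hA0 := wnorm_nonneg hd ω k m r hu
  have hfirst : wnorm d ω k m r u ≤ 2 * wnorm d ω k m r v := by
    have : 0 ≤ stepc k m * (r : ℝ) ^ 2 / (2 * ((k : ℝ) + 1)) *
      energy d ω (fun x => u x ^ (k + 1) * wgt d m r x) := by positivity
    unfold wnorm at *
    linarith
  refine ⟨hfirst, ?_⟩
  have hG2 : ∀ x i, (cutoff d R (x + unitv d i) - cutoff d R x) ^ 2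
        ≤ D / (r : ℝ) ^ 2 * wgt d m r x ^ 2 ∧
      (cutoff d R (x + unitv d i) - cutoff d R x) ^ 2
        ≤ D / (r : ℝ) ^ 2 * wgt d m r (x + unitv d i) ^ 2 := by
    intro x i
    have h2 : (cutoff d R (x + unitv d i) - cutoff d R x) ^ 2 ≤ D / (r : ℝ) ^ 2 := by
      rw [← sq_abs]
      calc |cutoff d R (x + unitv d i) - cutoff d R x| ^ 2 ≤ (1 / (r : ℝ)) ^ 2 := by
            refine pow_le_pow_left₀ (abs_nonneg _) ((abs_cutoff_grad_le x i).trans ?_) 2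
            exact one_div_le_one_div_of_le hr0 (by exact_mod_cast hrR)
        _ ≤ _ := by
            rw [div_pow, one_pow]
            exact div_le_div_of_nonneg_right hD1 (by positivity)
    have h3 : ∀ y : Vert d, D / (r : ℝ) ^ 2 ≤ D / (r : ℝ) ^ 2 * wgt d m r y ^ 2 := fun y =>
      le_mul_of_one_le_right (by positivity) (one_le_pow₀ (one_le_wgt m r y))
    exact ⟨h2.trans (h3 _), h2.trans (h3 _)⟩
  have h4 := energy_step hd ω k (h := stepc k m * (r : ℝ) ^ 2) (by positivity) hu hv
    (cutoff_nonneg R) hus hvs hsub hG2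
  rw [hGsum, ← mul_assoc, hεD] at h4
  have h5 : ∑' x, v x ^ (2 * k + 2) * cutoff d R x ^ 2 * piOf d ω x ≤ wnorm d ω k m r v := by
    refine Summable.tsum_le_tsum (fun x => ?_) (hvs.summable fun x hx => by simp [hx])
      (hvs.summable fun x hx => by simp [hx])
    refine mul_le_mul_of_nonneg_right (mul_le_mul_of_nonneg_left ?_ (pow_nonneg (hv x) _)) (hpi x)
    exact pow_le_pow_left₀ (cutoff_nonneg R x) ((cutoff_le_one R x).trans (one_le_wgt m r x)) 2
  have h6 : 0 ≤ ∑' x, u x ^ (2 * k + 2) * cutoff d R x ^ 2 * piOf d ω x :=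
    tsum_nonneg fun x => mul_nonneg (mul_nonneg (pow_nonneg (hu x) _) (sq_nonneg _)) (hpi x)
  set E := energy d ω (fun x => u x ^ (k + 1) * cutoff d R x)
  have h7 : stepc k m * (r : ℝ) ^ 2 / (2 * ((k : ℝ) + 1)) * E ≤ 2 * wnorm d ω k m r v := by
    linarith
  have h8 : (r : ℝ) ^ 2 * E = (2 * ((k : ℝ) + 1) / stepc k m) *
      (stepc k m * (r : ℝ) ^ 2 / (2 * ((k : ℝ) + 1)) * E) := by
    field_simp
  rw [h8]
  calc _ ≤ (2 * ((k : ℝ) + 1) / stepc k m) * (2 * wnorm d ω k m r v) :=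
        mul_le_mul_of_nonneg_left h7 (by positivity)
    _ = _ := by ring

lemma wnorm_scale_le {d : ℕ} (hd : 1 ≤ d) (ω : EnvSp d) (k m : ℕ) {r L : ℕ} (hr : 1 ≤ r)
    (hL : 1 ≤ L) {u : Vert d → ℝ} (hu : ∀ x, 0 ≤ u x) (hus : FS u) :
    wnorm d ω k m (L * r) u ≤
      4 ^ m * ∑' x, u x ^ (2 * k + 2) * cutoff d (L * r) x ^ 2 * piOf d ω x
        + (2 / L) ^ (2 * m) * wnorm d ω k m r u := by
  have hr0 : (0 : ℝ) < r := by exact_mod_cast hr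
  have hL0 : (0 : ℝ) < L := by exact_mod_cast hL
  have hLr : 1 ≤ L * r := Nat.mul_pos hL hr
  have hpi : ∀ x, 0 ≤ piOf d ω x := fun x => (piOf_pos hd ω x).le
  rw [wnorm, wnorm, ← tsum_mul_left, ← tsum_mul_left, ← Summable.tsum_add]
  rotate_left
  · exact hus.summable fun x hx => by simp [hx]
  · exact hus.summable fun x hx => by simp [hx]
  refine Summable.tsum_le_tsum (fun x => ?_) (hus.summable fun x hx => by simp [hx])
    (hus.summable fun x hx => by simp [hx])
  have hup := pow_nonneg (hu x) (2 * k + 2)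
  have key : wgt d m (L * r) x ^ 2 ≤
      4 ^ m * cutoff d (L * r) x ^ 2 + (2 / L) ^ (2 * m) * wgt d m r x ^ 2 := by
    have hx0 := norm_nonneg x
    rcases le_or_gt ‖x‖ ((L * r : ℕ) : ℝ) with h | h
    · rw [cutoff_eq_one hLr h, one_pow, mul_one]
      have h1 : 1 + ‖x‖ / ((L * r : ℕ) : ℝ) ≤ 2 := by
        have : ‖x‖ / ((L * r : ℕ) : ℝ) ≤ 1 := (div_le_one (by exact_mod_cast hLr)).2 h
        linarith
      have h2 : wgt d m (L * r) x ^ 2 ≤ 4 ^ m := by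
        rw [wgt, ← pow_mul, mul_comm m 2, pow_mul]
        refine pow_le_pow_left₀ (sq_nonneg _) ?_ m
        calc _ ≤ (2 : ℝ) ^ 2 := pow_le_pow_left₀ (by positivity) h1 2
          _ = 4 := by norm_num
      have : 0 ≤ (2 / (L : ℝ)) ^ (2 * m) * wgt d m r x ^ 2 := by positivity
      linarith
    · have h1 : wgt d m (L * r) x ^ 2 ≤ (2 / L) ^ (2 * m) * wgt d m r x ^ 2 := by
        rw [wgt, wgt, ← pow_mul, ← pow_mul, mul_comm m 2, ← mul_pow]
        refine pow_le_pow_left₀ (by positivity) ?_ _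
        push_cast at h ⊢
        have h2 : 1 ≤ ‖x‖ / (L * r) := (one_le_div (by positivity)).2 h.le
        have h3 : ‖x‖ / (L * r) = (1 / L) * (‖x‖ / r) := by field_simp
        have h4 : 0 < 1 / (L : ℝ) := by positivity
        rw [h3] at h2 ⊢
        have h5 : (2 / (L : ℝ)) = 2 * (1 / L) := by ring
        rw [h5]
        nlinarith
      have : 0 ≤ (4 : ℝ) ^ m * cutoff d (L * r) x ^ 2 := by positivity
      linarith
  calc _ = (u x ^ (2 * k + 2) * piOf d ω x) * wgt d m (L * r) x ^ 2 := by ring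
    _ ≤ (u x ^ (2 * k + 2) * piOf d ω x) *
        (4 ^ m * cutoff d (L * r) x ^ 2 + (2 / L) ^ (2 * m) * wgt d m r x ^ 2) :=
        mul_le_mul_of_nonneg_left key (mul_nonneg hup (hpi x))
    _ = _ := by ring

lemma le_of_recurrence {K : ℕ → ℝ} {C K₀ t : ℝ} (hK : ∀ j, 0 ≤ K j) (hC : 0 < C) (ht0 : 0 ≤ t)
    (ht1 : t < 1) (h0 : K 0 ≤ K₀) (hstep : ∀ j, K (j + 1) ≤ C * K j ^ t + K j / 2) (j : ℕ) :
    K j ≤ max K₀ ((2 * C) ^ (1 / (1 - t))) := by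
  set B := max K₀ ((2 * C) ^ (1 / (1 - t))) with hB
  have hBpos : 0 < B := lt_max_of_lt_right (by positivity)
  have h1 : C * B ^ t ≤ B / 2 := by
    have h2 : 2 * C ≤ B ^ (1 - t) := by
      calc 2 * C = ((2 * C) ^ (1 / (1 - t))) ^ (1 - t) := by
            rw [← Real.rpow_mul (by positivity), one_div_mul_cancel (by linarith), Real.rpow_one]
        _ ≤ _ := Real.rpow_le_rpow (by positivity) (le_max_right _ _) (by linarith)
    have h3 : B ^ (1 - t) * B ^ t = B := by
      rw [← Real.rpow_add hBpos]; simp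
    have h4 := mul_le_mul_of_nonneg_right h2 (Real.rpow_nonneg hBpos.le t)
    rw [h3] at h4
    linarith
  induction j with
  | zero => exact h0.trans (le_max_left _ _)
  | succ j ih =>
    have := Real.rpow_le_rpow (hK j) ih ht0
    have := mul_le_mul_of_nonneg_left this hC.le
    linarith [hstep j]

lemma interpolation {d : ℕ} (hd : 1 ≤ d) (ω : EnvSp d) (k : ℕ) {κ a : ℝ} (hκ : 1 < κ)
    (ha : a = (2 * (k : ℝ) + 1) / ((2 * k + 2) * κ - 1)) {u φ : Vert d → ℝ}
    (hu : ∀ x, 0 ≤ u x) (hus : FS u) (hmass : ∑' x, u x * piOf d ω x ≤ 1)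
    (hφ0 : ∀ x, 0 ≤ φ x) (hφ1 : ∀ x, φ x ≤ 1) :
    ∑' x, u x ^ (2 * k + 2) * φ x ^ 2 * piOf d ω x ≤
      (∑' x, (u x ^ (k + 1) * φ x) ^ (2 * κ) * piOf d ω x) ^ a := by
  have hpi : ∀ x, 0 < piOf d ω x := piOf_pos hd ω
  have hk : (0 : ℝ) ≤ k := Nat.cast_nonneg k
  have hden : 0 < (2 * (k : ℝ) + 2) * κ - 1 := by nlinarith
  have ha0 : 0 < a := by rw [ha]; positivity
  have ha1 : a < 1 := by rw [ha, div_lt_one hden]; nlinarith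
  have haκ : κ * a ≤ 1 := by rw [ha, ← mul_div_assoc, div_le_one hden]; nlinarith
  have haeq : a * ((2 * (k : ℝ) + 2) * κ - 1) = 2 * k + 1 := by
    rw [ha, div_mul_cancel₀ _ hden.ne']
  set T := hus.toFinset with hT
  have hTn : ∀ x ∉ T, u x = 0 := fun x hx => by simpa [hT] using hx
  have hTp : ∀ x ∈ T, 0 < u x := fun x hx =>
    lt_of_le_of_ne (hu x) (Ne.symm (by simpa [hT] using hx))
  rw [tsum_eq_sum (s := T) fun x hx => by rw [hTn x hx]; simp,
    tsum_eq_sum (s := T) fun x hx => by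
      rw [hTn x hx, zero_pow (Nat.succ_ne_zero k), zero_mul, Real.zero_rpow (by linarith),
        zero_mul]]
  rw [tsum_eq_sum (s := T) fun x hx => by rw [hTn x hx]; simp] at hmass
  have hconj : (1 / a).HolderConjugate (1 / (1 - a)) := by
    rw [Real.holderConjugate_iff]
    exact ⟨(one_lt_div ha0).2 ha1, by simp⟩
  have hF0 : ∀ x, 0 ≤ (u x ^ (k + 1) * φ x) ^ (2 * κ) := fun x =>
    Real.rpow_nonneg (mul_nonneg (pow_nonneg (hu x) _) (hφ0 x)) _
  have hhol := Real.inner_le_Lp_mul_Lq_of_nonneg T hconj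
    (f := fun x => ((u x ^ (k + 1) * φ x) ^ (2 * κ) * piOf d ω x) ^ a)
    (g := fun x => (u x * piOf d ω x) ^ (1 - a))
    (fun x _ => Real.rpow_nonneg (mul_nonneg (hF0 x) (hpi x).le) _)
    (fun x _ => Real.rpow_nonneg (mul_nonneg (hu x) (hpi x).le) _)
  have e1 : ∀ x, (((u x ^ (k + 1) * φ x) ^ (2 * κ) * piOf d ω x) ^ a) ^ (1 / a)
      = (u x ^ (k + 1) * φ x) ^ (2 * κ) * piOf d ω x := fun x => by
    rw [← Real.rpow_mul (mul_nonneg (hF0 x) (hpi x).le), mul_one_div_cancel ha0.ne', Real.rpow_one]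
  have e2 : ∀ x, ((u x * piOf d ω x) ^ (1 - a)) ^ (1 / (1 - a)) = u x * piOf d ω x := fun x => by
    rw [← Real.rpow_mul (mul_nonneg (hu x) (hpi x).le), mul_one_div_cancel (by linarith),
      Real.rpow_one]
  simp only [e1, e2, one_div_one_div] at hhol
  have hlast : (∑ x ∈ T, u x * piOf d ω x) ^ (1 - a) ≤ 1 :=
    Real.rpow_le_one (Finset.sum_nonneg fun x _ => mul_nonneg (hu x) (hpi x).le) hmass
      (by linarith)
  have hX : 0 ≤ (∑ x ∈ T, (u x ^ (k + 1) * φ x) ^ (2 * κ) * piOf d ω x) ^ a :=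
    Real.rpow_nonneg (Finset.sum_nonneg fun x _ => mul_nonneg (hF0 x) (hpi x).le) _
  refine le_trans (Finset.sum_le_sum fun x hx => ?_) (hhol.trans (mul_le_of_le_one_right hX hlast))
  have hux := hTp x hx
  have hp := hpi x
  rw [Real.mul_rpow (pow_nonneg (hu x) _) (hφ0 x), Real.mul_rpow (by have := hφ0 x; positivity)
    hp.le, Real.mul_rpow (by positivity) (Real.rpow_nonneg (hφ0 x) _),
    Real.mul_rpow hux.le hp.le, ← Real.rpow_mul (hφ0 x), ← Real.rpow_natCast (u x) (k + 1),
    ← Real.rpow_mul hux.le, ← Real.rpow_mul hux.le]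
  have e3 : u x ^ (((k + 1 : ℕ) : ℝ) * (2 * κ) * a) * u x ^ (1 - a) = u x ^ (2 * k + 2) := by
    rw [← Real.rpow_add hux, ← Real.rpow_natCast (u x) (2 * k + 2)]
    congr 1
    push_cast
    linear_combination haeq
  have e4 : piOf d ω x ^ a * piOf d ω x ^ (1 - a) = piOf d ω x := by
    rw [← Real.rpow_add hp]; simp
  have e5 : φ x ^ 2 ≤ φ x ^ (2 * κ * a) := by
    rcases (hφ0 x).eq_or_lt with h | h
    · rw [← h, zero_pow two_ne_zero]; exact Real.rpow_nonneg le_rfl _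
    · rw [← Real.rpow_two]
      exact Real.rpow_le_rpow_of_exponent_ge h (hφ1 x) (by linarith)
  calc u x ^ (2 * k + 2) * φ x ^ 2 * piOf d ω x
      ≤ u x ^ (2 * k + 2) * φ x ^ (2 * κ * a) * piOf d ω x := by gcongr
    _ = _ := by
        rw [← e3]
        linear_combination (-(u x ^ (((k + 1 : ℕ) : ℝ) * (2 * κ) * a) * u x ^ (1 - a) *
          φ x ^ (2 * κ * a))) * e4

/-- The geometric sequence of spatial scales. -/
def scl (m j : ℕ) : ℕ := (4 ^ (m + 1)) ^ j

lemma one_le_scl (m j : ℕ) : 1 ≤ scl m j := Nat.one_le_pow _ _ (by positivity)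

lemma scl_succ (m j : ℕ) : scl m (j + 1) = 4 ^ (m + 1) * scl m j := by
  rw [scl, pow_succ, mul_comm]; rfl

lemma scale_bound {d : ℕ} (hd : 1 ≤ d) {p q : ℝ} (hp : 1 < p) (hq : 1 < q)
    (hpq : 2 ≤ d → 1 / p + 1 / q < 2 / (d : ℝ)) {ω : EnvSp d} (hmom : InOmegaPQ d p q ω)
    (k m : ℕ) (hm : d * (2 * k + 1) + 1 ≤ 2 * m) :
    ∃ B : ℝ, 0 < B ∧ ∀ u : ℕ → Vert d → ℝ, (∀ j x, 0 ≤ u j x) → (∀ j, FS (u j)) →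
      (∀ j, ∑' x, u j x * piOf d ω x ≤ 1) →
      (∀ x, u 0 x ≤ if x = 0 then 1 / piOf d ω 0 else 0) →
      (∀ j x, u (j + 1) x + stepc k m * (scl m j : ℝ) ^ 2 *
        (u (j + 1) x - avgOp d ω (u (j + 1)) x) ≤ u j x) →
      ∀ j, ((scl m j : ℝ) ^ d) ^ (2 * k + 1) * wnorm d ω k m (scl m j) (u j) ≤ B := by
  obtain ⟨κ, hκ1, hsob⟩ := weighted_sobolev hd hp hq hpq hmom
  obtain ⟨L, hL⟩ : ∃ L : ℕ, L = 4 ^ (m + 1) := ⟨_, rfl⟩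
  have hL1 : 1 ≤ L := by rw [hL]; exact Nat.one_le_pow _ _ (by norm_num)
  obtain ⟨C, hC0, hC⟩ := hsob (2 * L)
  have hk : (0 : ℝ) ≤ k := Nat.cast_nonneg k
  have hden : 0 < (2 * (k : ℝ) + 2) * κ - 1 := by nlinarith
  obtain ⟨a, ha⟩ : ∃ a : ℝ, a = (2 * (k : ℝ) + 1) / ((2 * k + 2) * κ - 1) := ⟨_, rfl⟩
  have ha0 : 0 < a := by rw [ha]; positivity
  have haeq : a * ((2 * (k : ℝ) + 2) * κ - 1) = 2 * k + 1 := by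
    rw [ha, div_mul_cancel₀ _ hden.ne']
  have haκ : κ * a < 1 := by rw [ha, ← mul_div_assoc, div_lt_one hden]; nlinarith
  have hκ0 : 0 < κ := by linarith
  have hε := stepc_pos k m
  obtain ⟨C₁, hC₁⟩ : ∃ C₁ : ℝ, C₁ = 4 * ((k : ℝ) + 1) / stepc k m := ⟨_, rfl⟩
  have hC₁0 : 0 < C₁ := by rw [hC₁]; positivity
  obtain ⟨C₂, hC₂⟩ : ∃ C₂ : ℝ, C₂ = (L : ℝ) ^ (d * (2 * k + 1)) * (4 ^ m * (C * C₁ ^ κ) ^ a) :=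
    ⟨_, rfl⟩
  have hL0 : (0 : ℝ) < L := by exact_mod_cast hL1
  have hC₂0 : 0 < C₂ := by rw [hC₂]; positivity
  have hLsmall : (L : ℝ) ^ (d * (2 * k + 1)) * ((2 / L) ^ (2 * m) * 2) ≤ 1 / 2 := by
    have h1 : (L : ℝ) ^ (d * (2 * k + 1)) * L ≤ (L : ℝ) ^ (2 * m) := by
      rw [← pow_succ]; exact pow_le_pow_right₀ (by exact_mod_cast hL1) hm
    have h2 : (L : ℝ) = 4 * 4 ^ m := by rw [hL]; push_cast; ring
    have h3 : (2 : ℝ) ^ (2 * m) = 4 ^ m := by rw [pow_mul]; norm_num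
    rw [div_pow, h3]
    rw [div_mul_eq_mul_div, ← mul_div_assoc, div_le_iff₀ (by positivity)]
    have h4 : (L : ℝ) ^ (d * (2 * k + 1)) * (4 * 4 ^ m) ≤ (L : ℝ) ^ (2 * m) := by
      rw [← h2]; exact h1
    linarith
  refine ⟨max (1 / piOf d ω 0 ^ (2 * k + 1)) ((2 * C₂) ^ (1 / (1 - κ * a))),
    lt_max_of_lt_right (by positivity), ?_⟩
  intro u hu hus hmass h0 hstep
  refine le_of_recurrence (C := C₂) (t := κ * a) (fun j => ?_) hC₂0 (by positivity) haκ ?_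
    fun j => ?_
  · have := wnorm_nonneg hd ω k m (scl m j) (hu j)
    positivity
  · have hpi0 := piOf_pos hd ω 0
    simp only [scl, pow_zero, Nat.cast_one, one_pow, one_mul]
    rw [wnorm, tsum_eq_single 0]
    · have h1 : u 0 0 ≤ 1 / piOf d ω 0 := by simpa using h0 0
      have h2 : wgt d m 1 0 = 1 := by simp [wgt]
      rw [h2, one_pow, mul_one]
      calc u 0 0 ^ (2 * k + 2) * piOf d ω 0 ≤ (1 / piOf d ω 0) ^ (2 * k + 2) * piOf d ω 0 :=
            mul_le_mul_of_nonneg_right (pow_le_pow_left₀ (hu 0 0) h1 _) hpi0.le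
        _ = _ := by rw [div_pow, one_pow, pow_succ]; field_simp
    · intro x hx
      have : u 0 x = 0 := le_antisymm (by simpa [hx] using h0 x) (hu 0 x)
      simp [this]
  · have hr := one_le_scl m j
    rw [scl_succ, ← hL]
    set r := scl m j with hrdef
    have hr0 : (0 : ℝ) < r := by exact_mod_cast hr
    obtain ⟨hb1, hb2⟩ := step_bounds hd ω k m hr (Nat.le_mul_of_pos_left r hL1)
      (hu (j + 1)) (hu j) (hus (j + 1)) (hus j) (hstep j)
    rw [← hC₁] at hb2
    have hsc := wnorm_scale_le hd ω k m hr hL1 (hu (j + 1)) (hus (j + 1))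
    have hint := interpolation hd ω k hκ1 ha (hu (j + 1)) (hus (j + 1)) (hmass (j + 1))
      (cutoff_nonneg (L * r)) (cutoff_le_one (L * r))
    have hS := hC r hr (fun x => u (j + 1) x ^ (k + 1) * cutoff d (L * r) x)
      (fun x => mul_nonneg (pow_nonneg (hu _ x) _) (cutoff_nonneg _ x)) fun x hx => by
        have := norm_le_of_cutoff_ne_zero (Nat.mul_pos hL1 hr) (right_ne_zero_of_mul hx)
        push_cast at this ⊢
        linarith
    set A := wnorm d ω k m r (u j) with hA
    have hA0 : 0 ≤ A := wnorm_nonneg hd ω k m r (hu j)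
    set N := (r : ℝ) ^ d with hN
    have hN0 : 0 < N := pow_pos hr0 d
    have hE0 := energy_nonneg ω fun x => u (j + 1) x ^ (k + 1) * cutoff d (L * r) x
    have hSS0 : 0 ≤ ∑' x, (u (j + 1) x ^ (k + 1) * cutoff d (L * r) x) ^ (2 * κ) * piOf d ω x :=
      tsum_nonneg fun x => mul_nonneg (Real.rpow_nonneg (mul_nonneg (pow_nonneg (hu _ x) _)
        (cutoff_nonneg _ x)) _) (piOf_pos hd ω x).le
    have hmain : ∑' x, u (j + 1) x ^ (2 * k + 2) * cutoff d (L * r) x ^ 2 * piOf d ω x ≤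
        (C * N ^ (1 - κ) * (C₁ * A) ^ κ) ^ a :=
      hint.trans (Real.rpow_le_rpow hSS0 (hS.trans (mul_le_mul_of_nonneg_left
        (Real.rpow_le_rpow (by positivity) hb2 hκ0.le) (by positivity))) ha0.le)
    have hconv : N ^ (2 * k + 1) * (C * N ^ (1 - κ) * (C₁ * A) ^ κ) ^ a =
        (C * C₁ ^ κ) ^ a * (N ^ (2 * k + 1) * A) ^ (κ * a) := by
      have hNκ : 0 ≤ N ^ (1 - κ) := by positivity
      have hC₁κ : 0 ≤ C₁ ^ κ := by positivity
      have hAκ : 0 ≤ A ^ κ := by positivity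
      rw [Real.mul_rpow hC₁0.le hA0, Real.mul_rpow (mul_nonneg hC0.le hNκ) (mul_nonneg hC₁κ hAκ),
        Real.mul_rpow hC0.le hNκ, Real.mul_rpow hC₁κ hAκ, Real.mul_rpow hC0.le hC₁κ,
        Real.mul_rpow (y := A) (by positivity) hA0, ← Real.rpow_mul hA0, ← Real.rpow_mul hN0.le,
        ← Real.rpow_natCast N (2 * k + 1), ← Real.rpow_mul hN0.le]
      have e : N ^ (((2 * k + 1 : ℕ)) : ℝ) * N ^ ((1 - κ) * a) =
          N ^ (((2 * k + 1 : ℕ) : ℝ) * (κ * a)) := by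
        rw [← Real.rpow_add hN0]
        congr 1
        push_cast
        linear_combination -haeq
      linear_combination (C ^ a * (C₁ ^ κ) ^ a * A ^ (κ * a)) * e
    have hNL : (((L * r : ℕ) : ℝ) ^ d) ^ (2 * k + 1) =
        (L : ℝ) ^ (d * (2 * k + 1)) * N ^ (2 * k + 1) := by
      push_cast
      rw [mul_pow, mul_pow, hN, ← pow_mul]
    rw [hNL]
    calc (L : ℝ) ^ (d * (2 * k + 1)) * N ^ (2 * k + 1) * wnorm d ω k m (L * r) (u (j + 1))
        ≤ (L : ℝ) ^ (d * (2 * k + 1)) * N ^ (2 * k + 1) *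
          (4 ^ m * (C * N ^ (1 - κ) * (C₁ * A) ^ κ) ^ a + (2 / L) ^ (2 * m) * (2 * A)) := by
          refine mul_le_mul_of_nonneg_left (hsc.trans (add_le_add ?_ ?_)) (by positivity)
          · exact mul_le_mul_of_nonneg_left hmain (by positivity)
          · exact mul_le_mul_of_nonneg_left hb1 (by positivity)
      _ = C₂ * (N ^ (2 * k + 1) * A) ^ (κ * a) +
          (L : ℝ) ^ (d * (2 * k + 1)) * ((2 / L) ^ (2 * m) * 2) * (N ^ (2 * k + 1) * A) := by
          rw [hC₂]
          linear_combination ((L : ℝ) ^ (d * (2 * k + 1)) * 4 ^ m) * hconv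
      _ ≤ C₂ * (N ^ (2 * k + 1) * A) ^ (κ * a) + (1 / 2) * (N ^ (2 * k + 1) * A) :=
          add_le_add le_rfl (mul_le_mul_of_nonneg_right hLsmall (by positivity))
      _ = _ := by ring

/-! ### Heat kernel and time weights -/

/-- The heat kernel of the walk started at the origin, with respect to `π`. -/
def hk (d : ℕ) (ω : EnvSp d) : ℕ → Vert d → ℝ
  | 0 => fun x => if x = 0 then 1 / piOf d ω 0 else 0
  | n + 1 => avgOp d ω (hk d ω n)

lemma hk_nonneg {d : ℕ} (hd : 1 ≤ d) (ω : EnvSp d) (n : ℕ) : ∀ x, 0 ≤ hk d ω n x := by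
  induction n with
  | zero =>
    intro x
    have := piOf_pos hd ω 0
    by_cases h : x = 0 <;> simp [hk, h, this.le]
  | succ n ih => exact avgOp_nonneg ω ih

lemma hk_fs {d : ℕ} (ω : EnvSp d) (n : ℕ) : FS (hk d ω n) := by
  induction n with
  | zero =>
    refine (Set.finite_singleton 0).subset fun x hx => ?_
    by_contra h
    exact hx (by simp [hk, show x ≠ 0 from h])
  | succ n ih => exact FS.avgOp ω ih

lemma avgOp_const {d : ℕ} (hd : 1 ≤ d) (ω : EnvSp d) (c : ℝ) (x : Vert d) :
    avgOp d ω (fun _ => c) x = c := by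
  rw [avgOp, div_eq_iff (piOf_pos hd ω x).ne', piOf, Finset.mul_sum]
  exact Finset.sum_congr rfl fun i _ => by ring

lemma tsum_avgOp_mul_piOf {d : ℕ} (hd : 1 ≤ d) (ω : EnvSp d) {u : Vert d → ℝ} (hu : FS u)
    (g : Vert d → ℝ) :
    ∑' x, g x * avgOp d ω u x * piOf d ω x = ∑' x, avgOp d ω g x * u x * piOf d ω x := by
  -- replace `g` by a finitely supported function agreeing with it near the support of `u`
  set S : Set (Vert d) := Function.support u ∪ Function.support (avgOp d ω u) ∪
    ⋃ i, ((fun x => x - unitv d i) ⁻¹' Function.support u ∪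
      (fun x => x + unitv d i) ⁻¹' Function.support u) with hS
  have hSf : S.Finite := by
    refine (hu.union (FS.avgOp ω hu)).union (Set.finite_iUnion fun i => Set.Finite.union ?_ ?_)
    · exact hu.shift_sub (unitv d i)
    · exact hu.shift (unitv d i)
  set g' : Vert d → ℝ := S.indicator g with hg'
  have hg's : FS g' := hSf.subset Set.support_indicator_subset
  have key := tsum_avgOp hd ω hg's hu
  have e1 : ∀ x, g x * avgOp d ω u x * piOf d ω x = g' x * avgOp d ω u x * piOf d ω x := fun x => by
    by_cases hx : avgOp d ω u x = 0
    · rw [hx]; ring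
    · have m : x ∈ S := Or.inl (Or.inr (by simpa using hx))
      rw [hg', Set.indicator_of_mem m]
  have e2 : ∀ x, avgOp d ω g x * u x * piOf d ω x = avgOp d ω g' x * u x * piOf d ω x := fun x => by
    by_cases hx : u x = 0
    · rw [hx]; ring
    · congr 2
      rw [avgOp, avgOp]
      congr 1
      refine Finset.sum_congr rfl fun i _ => ?_
      have m1 : x + unitv d i ∈ S := Or.inr (Set.mem_iUnion.2 ⟨i, Or.inl (by simpa using hx)⟩)
      have m2 : x - unitv d i ∈ S := Or.inr (Set.mem_iUnion.2 ⟨i, Or.inr (by simpa using hx)⟩)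
      rw [hg', Set.indicator_of_mem m1, Set.indicator_of_mem m2]
  rw [tsum_congr e1, tsum_congr e2, key]

lemma tsum_hk {d : ℕ} (hd : 1 ≤ d) (ω : EnvSp d) (n : ℕ) :
    ∑' x, hk d ω n x * piOf d ω x = 1 := by
  induction n with
  | zero =>
    rw [tsum_eq_single 0 fun x hx => by simp [hk, hx]]
    simp [hk, (piOf_pos hd ω 0).ne']
  | succ n ih =>
    have h := tsum_avgOp_mul_piOf hd ω (hk_fs ω n) fun _ => 1
    simp only [avgOp_const hd, one_mul] at h
    rw [← ih, ← h]
    rfl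

/-- The time weights: convolutions of geometric laws with means `h 0, …, h (j - 1)`. -/
def tw (h : ℕ → ℝ) : ℕ → ℕ → ℝ
  | 0, 0 => 1
  | 0, _ + 1 => 0
  | j + 1, 0 => tw h j 0 / (1 + h j)
  | j + 1, n + 1 => (tw h j (n + 1) + h j * tw h (j + 1) n) / (1 + h j)

section tw
variable {h : ℕ → ℝ}

lemma tw_succ_zero (hh : ∀ j, 0 < h j) (j : ℕ) : (1 + h j) * tw h (j + 1) 0 = tw h j 0 := by
  rw [tw, mul_div_cancel₀]
  linarith [hh j]

lemma tw_succ_succ (hh : ∀ j, 0 < h j) (j n : ℕ) :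
    (1 + h j) * tw h (j + 1) (n + 1) = tw h j (n + 1) + h j * tw h (j + 1) n := by
  rw [tw, mul_div_cancel₀]
  linarith [hh j]

lemma tw_nonneg (hh : ∀ j, 0 < h j) (j : ℕ) : ∀ n, 0 ≤ tw h j n := by
  induction j with
  | zero => rintro (_ | n) <;> simp [tw]
  | succ j ih =>
    intro n
    have hj := hh j
    induction n with
    | zero =>
      rw [tw]; exact div_nonneg (ih 0) (by linarith)
    | succ n ihn =>
      rw [tw]
      exact div_nonneg (add_nonneg (ih _) (mul_nonneg hj.le ihn)) (by linarith)

lemma sum_tw_succ (hh : ∀ j, 0 < h j) (j K : ℕ) :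
    (1 + h j) * ∑ n ∈ Finset.range (K + 1), tw h (j + 1) n =
      ∑ n ∈ Finset.range (K + 1), tw h j n + h j * ∑ n ∈ Finset.range K, tw h (j + 1) n := by
  rw [Finset.sum_range_succ', Finset.sum_range_succ' (fun n => tw h j n), mul_add,
    tw_succ_zero hh, Finset.mul_sum, Finset.mul_sum]
  simp only [tw_succ_succ hh, Finset.sum_add_distrib]
  ring

lemma sum_tw_le_one (hh : ∀ j, 0 < h j) (j : ℕ) : ∀ K, ∑ n ∈ Finset.range K, tw h j n ≤ 1 := by
  induction j with
  | zero =>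
    rintro (_ | K)
    · simp
    · rw [Finset.sum_range_succ']; simp [tw]
  | succ j ih =>
    intro K
    have hj := hh j
    induction K with
    | zero => simp
    | succ K ihK =>
      have h1 := sum_tw_succ hh j K
      have h2 := ih (K + 1)
      have h3 := mul_le_mul_of_nonneg_left ihK hj.le
      nlinarith

lemma sum_tail_le (hh : ∀ j, 0 < h j) (N : ℕ) (j : ℕ) :
    ∑ K ∈ Finset.range N, (1 - ∑ n ∈ Finset.range (K + 1), tw h j n)
      ≤ ∑ i ∈ Finset.range j, h i := by
  induction j with
  | zero =>
    simp [Finset.sum_range_succ', tw]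
  | succ j ih =>
    have hj := hh j
    rw [Finset.sum_range_succ]
    set Z := ∑ K ∈ Finset.range N, (1 - ∑ n ∈ Finset.range (K + 1), tw h (j + 1) n) with hZ
    have h1 : (1 + h j) * Z = ∑ K ∈ Finset.range N, (1 - ∑ n ∈ Finset.range (K + 1), tw h j n)
        + h j * ∑ K ∈ Finset.range N, (1 - ∑ n ∈ Finset.range K, tw h (j + 1) n) := by
      rw [hZ, Finset.mul_sum, Finset.mul_sum, ← Finset.sum_add_distrib]
      refine Finset.sum_congr rfl fun K _ => ?_
      linear_combination -(sum_tw_succ hh j K)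
    have h2 : ∑ K ∈ Finset.range N, (1 - ∑ n ∈ Finset.range K, tw h (j + 1) n) ≤ 1 + Z := by
      have h3 := Finset.sum_range_succ' (fun K => 1 - ∑ n ∈ Finset.range K, tw h (j + 1) n) N
      rw [Finset.sum_range_succ] at h3
      have h4 := sum_tw_le_one hh (j + 1) N
      simp only [Finset.range_zero, Finset.sum_empty, sub_zero] at h3
      linarith
    have := mul_le_mul_of_nonneg_left h2 hj.le
    nlinarith

lemma half_le_sum_tw (hh : ∀ j, 0 < h j) (j N : ℕ) (hN : 2 * ∑ i ∈ Finset.range j, h i ≤ N) :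
    1 / 2 ≤ ∑ n ∈ Finset.range (N + 1), tw h j n := by
  have h1 := sum_tail_le hh (N + 1) j
  have h2 : ((N + 1 : ℕ) : ℝ) * (1 - ∑ n ∈ Finset.range (N + 1), tw h j n) ≤
      ∑ K ∈ Finset.range (N + 1), (1 - ∑ n ∈ Finset.range (K + 1), tw h j n) := by
    have := Finset.card_nsmul_le_sum (Finset.range (N + 1))
      (fun K => 1 - ∑ n ∈ Finset.range (K + 1), tw h j n)
      (1 - ∑ n ∈ Finset.range (N + 1), tw h j n) fun K hK => by
        have hs : Finset.range (K + 1) ⊆ Finset.range (N + 1) :=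
          Finset.range_mono (by simpa using hK)
        have := Finset.sum_le_sum_of_subset_of_nonneg (f := tw h j) hs
          fun n _ _ => tw_nonneg hh j n
        linarith
    rwa [Finset.card_range, nsmul_eq_mul] at this
  push_cast at h2
  have hN0 : (0 : ℝ) ≤ N := Nat.cast_nonneg N
  nlinarith

lemma pow_mul_sum_tw_le (hh : ∀ j, 0 < h j) (j n : ℕ) :
    (h j / (1 + h j)) ^ n * ∑ i ∈ Finset.range (n + 1), tw h j i
      ≤ (1 + h j) * tw h (j + 1) n := by
  have hj := hh j
  have hθ0 : 0 ≤ h j / (1 + h j) := by positivity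
  have hθ1 : h j / (1 + h j) ≤ 1 := (div_le_one (by linarith)).2 (by linarith)
  induction n with
  | zero => simp [tw_succ_zero hh]
  | succ n ih =>
    rw [tw_succ_succ hh, Finset.sum_range_succ, mul_add]
    have h1 : h j * tw h (j + 1) n = h j / (1 + h j) * ((1 + h j) * tw h (j + 1) n) := by
      field_simp
    have h2 : (h j / (1 + h j)) ^ (n + 1) * tw h j (n + 1) ≤ tw h j (n + 1) :=
      mul_le_of_le_one_left (tw_nonneg hh _ _) (pow_le_one₀ hθ0 hθ1)
    have h3 := mul_le_mul_of_nonneg_left ih hθ0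
    rw [h1, pow_succ]
    rw [pow_succ] at h2
    linarith

lemma exp_le_tw (hh : ∀ j, 0 < h j) (j n : ℕ) (hn : 2 * ∑ i ∈ Finset.range j, h i ≤ n)
    (hn' : (n : ℝ) ≤ 4 * h j) : Real.exp (-4) / 2 ≤ (1 + h j) * tw h (j + 1) n := by
  have hj := hh j
  refine le_trans ?_ (pow_mul_sum_tw_le hh j n)
  have h1 : Real.exp (-4) ≤ (h j / (1 + h j)) ^ n := by
    have h2 : Real.exp (-(1 / h j)) ≤ h j / (1 + h j) := by
      rw [Real.exp_neg, inv_le_comm₀ (Real.exp_pos _) (by positivity), inv_div]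
      have := Real.add_one_le_exp (1 / h j)
      have e : (1 + h j) / h j = 1 / h j + 1 := by field_simp
      rwa [e]
    calc Real.exp (-4) ≤ Real.exp (n * -(1 / h j)) := by
          rw [Real.exp_le_exp, mul_neg, neg_le_neg_iff, mul_one_div, div_le_iff₀ hj]
          exact hn'
      _ = Real.exp (-(1 / h j)) ^ n := Real.exp_nat_mul _ n
      _ ≤ _ := pow_le_pow_left₀ (Real.exp_pos _).le h2 n
  have := mul_le_mul h1 (half_le_sum_tw hh j n hn) (by norm_num) (by positivity)
  linarith

end tw

/-- Time averages of the heat kernel. -/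
def avk (d : ℕ) (ω : EnvSp d) (h : ℕ → ℝ) (K j : ℕ) (x : Vert d) : ℝ :=
  ∑ n ∈ Finset.range (K + 1), tw h j n * hk d ω n x

lemma avgOp_sum {d : ℕ} (ω : EnvSp d) {ι : Type*} (s : Finset ι) (c : ι → ℝ)
    (u : ι → Vert d → ℝ) (x : Vert d) :
    avgOp d ω (fun y => ∑ n ∈ s, c n * u n y) x = ∑ n ∈ s, c n * avgOp d ω (u n) x := by
  simp only [avgOp, ← mul_div_assoc, ← Finset.sum_div, Finset.mul_sum]
  rw [Finset.sum_comm]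
  congr 1
  refine Finset.sum_congr rfl fun i _ => ?_
  rw [← Finset.sum_add_distrib]
  exact Finset.sum_congr rfl fun n _ => by ring

lemma avk_nonneg {d : ℕ} (hd : 1 ≤ d) (ω : EnvSp d) {h : ℕ → ℝ} (hh : ∀ j, 0 < h j) (K j : ℕ)
    (x : Vert d) : 0 ≤ avk d ω h K j x :=
  Finset.sum_nonneg fun n _ => mul_nonneg (tw_nonneg hh j n) (hk_nonneg hd ω n x)

lemma avk_fs {d : ℕ} (ω : EnvSp d) (h : ℕ → ℝ) (K j : ℕ) : FS (avk d ω h K j) :=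
  FS.sum _ fun n _ => (hk_fs ω n).of_imp fun x hx => by simp [hx]

lemma tsum_mul_avk {d : ℕ} (ω : EnvSp d) (h : ℕ → ℝ) (K j : ℕ) (g : Vert d → ℝ) :
    ∑' x, g x * avk d ω h K j x * piOf d ω x =
      ∑ n ∈ Finset.range (K + 1), tw h j n * ∑' x, g x * hk d ω n x * piOf d ω x := by
  simp only [← tsum_mul_left]
  rw [← Summable.tsum_finsetSum fun n _ => (hk_fs ω n).summable fun x hx => by simp [hx]]
  refine tsum_congr fun x => ?_
  rw [avk, Finset.mul_sum, Finset.sum_mul]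
  exact Finset.sum_congr rfl fun n _ => by ring

lemma avk_mass {d : ℕ} (hd : 1 ≤ d) (ω : EnvSp d) {h : ℕ → ℝ} (hh : ∀ j, 0 < h j) (K j : ℕ) :
    ∑' x, avk d ω h K j x * piOf d ω x ≤ 1 := by
  have := tsum_mul_avk ω h K j fun _ => 1
  simp only [one_mul, tsum_hk hd, mul_one] at this
  rw [this]
  exact sum_tw_le_one hh j _

lemma avk_zero {d : ℕ} (ω : EnvSp d) (h : ℕ → ℝ) (K : ℕ) (x : Vert d) :
    avk d ω h K 0 x = if x = 0 then 1 / piOf d ω 0 else 0 := by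
  rw [avk, Finset.sum_range_succ']
  simp [tw, hk]

lemma avk_sub {d : ℕ} (hd : 1 ≤ d) (ω : EnvSp d) {h : ℕ → ℝ} (hh : ∀ j, 0 < h j) (K j : ℕ)
    (x : Vert d) : avk d ω h K (j + 1) x +
      h j * (avk d ω h K (j + 1) x - avgOp d ω (avk d ω h K (j + 1)) x) ≤ avk d ω h K j x := by
  have h1 : (1 + h j) * avk d ω h K (j + 1) x = avk d ω h K j x +
      h j * ∑ n ∈ Finset.range K, tw h (j + 1) n * hk d ω (n + 1) x := by
    rw [avk, avk, Finset.sum_range_succ', Finset.sum_range_succ' (fun n => tw h j n * hk d ω n x),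
      mul_add, ← mul_assoc, tw_succ_zero hh, Finset.mul_sum, Finset.mul_sum]
    simp only [← mul_assoc, tw_succ_succ hh, add_mul, Finset.sum_add_distrib]
    ring
  have h2 : ∑ n ∈ Finset.range K, tw h (j + 1) n * hk d ω (n + 1) x
      ≤ avgOp d ω (avk d ω h K (j + 1)) x := by
    have : avgOp d ω (avk d ω h K (j + 1)) x =
        ∑ n ∈ Finset.range (K + 1), tw h (j + 1) n * hk d ω (n + 1) x :=
      avgOp_sum ω _ _ _ x
    rw [this, Finset.sum_range_succ]
    exact le_add_of_nonneg_right (mul_nonneg (tw_nonneg hh _ _) (hk_nonneg hd ω _ x))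
  have := mul_le_mul_of_nonneg_left h2 (hh j).le
  linarith

/-! ### Occupation bounds -/

lemma inv_pow_le_sum_indicator {y : ℝ} (D I : ℕ) (hy0 : 0 ≤ y) (hy : y ≤ 2 ^ I) :
    ((1 + y) ^ (2 * D))⁻¹ ≤
      ∑ i ∈ Finset.range (I + 1), if y ≤ 2 ^ i then (4 : ℝ) ^ D * ((4 : ℝ) ^ D)⁻¹ ^ i else 0 := by
  have hex : ∃ i : ℕ, y ≤ 2 ^ i := ⟨I, hy⟩
  classical
  set i := Nat.find hex with hi
  have h1 : y ≤ 2 ^ i := Nat.find_spec hex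
  have h2 : i ≤ I := Nat.find_min' hex hy
  have h3 : (2 : ℝ) ^ i ≤ 2 * (1 + y) := by
    rcases Nat.eq_zero_or_pos i with h0 | h0
    · rw [h0]; norm_num; linarith
    · have h4 : ¬ y ≤ 2 ^ (i - 1) := Nat.find_min hex (by omega)
      have h5 : (2 : ℝ) ^ i = 2 ^ (i - 1) * 2 := by rw [← pow_succ]; congr 1; omega
      push Not at h4
      linarith
  have h6 : ((1 + y) ^ (2 * D))⁻¹ ≤ (4 : ℝ) ^ D * ((4 : ℝ) ^ D)⁻¹ ^ i := by
    rw [inv_pow, ← div_eq_mul_inv, inv_le_comm₀ (by positivity) (by positivity), inv_div,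
      div_le_iff₀ (by positivity)]
    calc ((4 : ℝ) ^ D) ^ i = ((2 : ℝ) ^ i) ^ (2 * D) := by
          rw [← pow_mul, ← pow_mul, show (4 : ℝ) = 2 ^ 2 by norm_num, ← pow_mul]
          congr 1; ring
      _ ≤ (2 * (1 + y)) ^ (2 * D) := pow_le_pow_left₀ (by positivity) h3 _
      _ = _ := by rw [mul_pow, pow_mul 2 2 D]; norm_num; ring
  refine h6.trans ?_
  have h7 := Finset.single_le_sum (s := Finset.range (I + 1))
    (f := fun i => if y ≤ 2 ^ i then (4 : ℝ) ^ D * ((4 : ℝ) ^ D)⁻¹ ^ i else 0)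
    (fun i _ => by split_ifs <;> positivity) (Finset.mem_range.2 (Nat.lt_succ_of_le h2))
  simpa [h1] using h7

lemma sum_mul_inv_pow_le {d r : ℕ} (hr : 1 ≤ r) {G : Vert d → ℝ} (hG : ∀ x, 0 ≤ G x) {δ : ℝ}
    (hδ : ∀ n : ℕ, r ≤ n → ∑ x ∈ box d (n : ℝ), G x ≤ δ * (n : ℝ) ^ d) (T : Finset (Vert d)) :
    ∑ x ∈ T, G x * ((1 + ‖x‖ / r) ^ (2 * (d + 1)))⁻¹ ≤ 2 * 4 ^ (d + 1) * δ * (r : ℝ) ^ d := by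
  have hr0 : (0 : ℝ) < r := by exact_mod_cast hr
  have hδ0 : 0 ≤ δ := by
    have h1 := (Finset.sum_nonneg fun x _ => hG x).trans (hδ r le_rfl)
    exact nonneg_of_mul_nonneg_left h1 (by positivity)
  obtain ⟨I, hI⟩ : ∃ I : ℕ, ∀ x ∈ T, ‖x‖ / r ≤ 2 ^ I := by
    obtain ⟨M, hM⟩ := (T.image fun x => ‖x‖ / r).bddAbove
    obtain ⟨I, hI⟩ := pow_unbounded_of_one_lt M (one_lt_two : (1 : ℝ) < 2)
    exact ⟨I, fun x hx => (hM (by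
      simpa using ⟨x, hx, rfl⟩)).trans hI.le⟩
  set D := d + 1 with hD
  have hc : ∀ i : ℕ, (0 : ℝ) ≤ (4 : ℝ) ^ D * ((4 : ℝ) ^ D)⁻¹ ^ i := fun i => by positivity
  calc ∑ x ∈ T, G x * ((1 + ‖x‖ / r) ^ (2 * D))⁻¹
      ≤ ∑ x ∈ T, G x * ∑ i ∈ Finset.range (I + 1),
          (if ‖x‖ / r ≤ 2 ^ i then (4 : ℝ) ^ D * ((4 : ℝ) ^ D)⁻¹ ^ i else 0) :=
        Finset.sum_le_sum fun x hx => mul_le_mul_of_nonneg_left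
          (inv_pow_le_sum_indicator D I (by positivity) (hI x hx)) (hG x)
    _ = ∑ i ∈ Finset.range (I + 1), ∑ x ∈ T,
          (if ‖x‖ / r ≤ 2 ^ i then (4 : ℝ) ^ D * ((4 : ℝ) ^ D)⁻¹ ^ i * G x else 0) := by
        simp only [Finset.mul_sum]
        rw [Finset.sum_comm]
        refine Finset.sum_congr rfl fun i _ => Finset.sum_congr rfl fun x _ => ?_
        split_ifs <;> ring
    _ ≤ ∑ i ∈ Finset.range (I + 1), 4 ^ D * δ * (r : ℝ) ^ d * (1 / 2) ^ i := by
        refine Finset.sum_le_sum fun i _ => ?_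
        rw [← Finset.sum_filter, ← Finset.mul_sum]
        have h1 : ∑ x ∈ T with ‖x‖ / r ≤ 2 ^ i, G x ≤ δ * ((2 ^ i * r : ℕ) : ℝ) ^ d := by
          refine le_trans (Finset.sum_le_sum_of_subset_of_nonneg ?_ fun x _ _ => hG x)
            (hδ (2 ^ i * r) (Nat.le_mul_of_pos_left r (by positivity)))
          intro x hx
          rw [mem_box]
          have := (Finset.mem_filter.1 hx).2
          rw [div_le_iff₀ hr0] at this
          exact_mod_cast this
        refine (mul_le_mul_of_nonneg_left h1 (hc i)).trans ?_
        have h2 : ((4 : ℝ) ^ D)⁻¹ ^ i * ((2 : ℝ) ^ i) ^ d ≤ (1 / 2) ^ i := by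
          rw [← pow_mul, mul_comm i d, pow_mul, ← mul_pow]
          refine pow_le_pow_left₀ (by positivity) ?_ _
          rw [inv_mul_le_iff₀ (by positivity), hD, pow_succ]
          have h4 : (2 : ℝ) ^ d ≤ 4 ^ d := pow_le_pow_left₀ (by norm_num) (by norm_num) _
          have h5 : (0 : ℝ) ≤ 4 ^ d := by positivity
          linarith
        push_cast
        rw [mul_pow]
        calc (4 : ℝ) ^ D * ((4 : ℝ) ^ D)⁻¹ ^ i * (δ * ((2 ^ i) ^ d * (r : ℝ) ^ d))
            = 4 ^ D * δ * (r : ℝ) ^ d * (((4 : ℝ) ^ D)⁻¹ ^ i * ((2 : ℝ) ^ i) ^ d) := by ring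
          _ ≤ _ := mul_le_mul_of_nonneg_left h2 (by positivity)
    _ ≤ _ := by
        rw [← Finset.mul_sum]
        have h3 : ∑ i ∈ Finset.range (I + 1), (1 / 2 : ℝ) ^ i ≤ 2 := by
          refine (Summable.sum_le_tsum _ (fun i _ => by positivity) summable_geometric_two).trans ?_
          rw [tsum_geometric_two]
        have := mul_le_mul_of_nonneg_left h3
          (by positivity : (0 : ℝ) ≤ 4 ^ D * δ * (r : ℝ) ^ d)
        linarith

/-- The conjugate exponent of `2 * k + 2`. -/
def cexp (k : ℕ) : ℝ := (2 * k + 2) / (2 * k + 1)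

lemma cexp_pos (k : ℕ) : 0 < cexp k := by unfold cexp; positivity

lemma holderConjugate_cexp (k : ℕ) : (cexp k).HolderConjugate ((2 * k + 2 : ℕ) : ℝ) := by
  rw [Real.holderConjugate_iff]
  unfold cexp
  refine ⟨(one_lt_div (by positivity)).2 (by linarith), ?_⟩
  push_cast
  field_simp
  ring

lemma young_weighted (k : ℕ) {g U η ρ : ℝ} (hg : 0 ≤ g) (hU : 0 ≤ U) (hη : 0 < η) (hρ : 0 < ρ) :
    g * U ≤ η ^ (-cexp k) * (g ^ cexp k * ρ⁻¹) + η ^ (2 * k + 2) * (U ^ (2 * k + 2) * ρ ^ (2 * k + 1)) := by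
  have hc := holderConjugate_cexp k
  have hc0 := cexp_pos k
  set α := cexp k with hα
  have hs1 : (1 : ℝ) ≤ ((2 * k + 2 : ℕ) : ℝ) := by exact_mod_cast (by omega : 1 ≤ 2 * k + 2)
  have hα1 : 1 ≤ α := hc.lt.le
  have ha : 0 ≤ η⁻¹ * g * ρ ^ (-(1 / α)) := by positivity
  have hb : 0 ≤ η * U * ρ ^ (1 / α) := by positivity
  have hy := Real.young_inequality_of_nonneg ha hb hc
  have e0 : η⁻¹ * g * ρ ^ (-(1 / α)) * (η * U * ρ ^ (1 / α)) = g * U := by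
    rw [Real.rpow_neg hρ.le]
    have := (Real.rpow_pos_of_pos hρ (1 / α)).ne'
    field_simp
  have e1 : (η⁻¹ * g * ρ ^ (-(1 / α))) ^ α = η ^ (-α) * (g ^ α * ρ⁻¹) := by
    rw [Real.mul_rpow (by positivity) (by positivity), Real.mul_rpow (by positivity) hg,
      ← Real.rpow_mul hρ.le, Real.inv_rpow hη.le, Real.rpow_neg hη.le,
      show -(1 / α) * α = -1 by field_simp, Real.rpow_neg_one]
    ring
  have e2 : (η * U * ρ ^ (1 / α)) ^ ((2 * k + 2 : ℕ) : ℝ) =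
      η ^ (2 * k + 2) * (U ^ (2 * k + 2) * ρ ^ (2 * k + 1)) := by
    have e3 : (ρ ^ (1 / α)) ^ (2 * k + 2) = ρ ^ (2 * k + 1) := by
      rw [← Real.rpow_natCast, ← Real.rpow_mul hρ.le, ← Real.rpow_natCast]
      congr 1
      rw [hα, cexp]
      push_cast
      field_simp
    rw [Real.rpow_natCast, mul_pow, mul_pow, e3]
    ring
  rw [e0, e1, e2] at hy
  refine hy.trans (add_le_add (div_le_self (by positivity) hα1) (div_le_self (by positivity) hs1))

lemma pairing_le {d : ℕ} (hd : 1 ≤ d) (ω : EnvSp d) (k : ℕ) {r : ℕ} (hr : 1 ≤ r)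
    {g u : Vert d → ℝ} (hg : ∀ x, 0 ≤ g x) (hu : ∀ x, 0 ≤ u x) (huf : FS u) {δ η B : ℝ}
    (hη : 0 < η)
    (hδ : ∀ n : ℕ, r ≤ n →
      ∑ x ∈ box d (n : ℝ), g x ^ cexp k * piOf d ω x ≤ δ * (n : ℝ) ^ d)
    (hB : ((r : ℝ) ^ d) ^ (2 * k + 1) * wnorm d ω k ((d + 1) * (2 * k + 1)) r u ≤ B) :
    ∑' x, g x * u x * piOf d ω x ≤
      2 * 4 ^ (d + 1) * (η ^ (-cexp k) * δ) + η ^ (2 * k + 2) * B := by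
  have hr0 : (0 : ℝ) < r := by exact_mod_cast hr
  have hN : (0 : ℝ) < (r : ℝ) ^ d := by positivity
  set T := huf.toFinset with hT
  have hsupp : ∀ x ∉ T, u x = 0 := fun x hx => by simpa [hT] using hx
  have h1 := sum_mul_inv_pow_le hr
    (fun x => mul_nonneg (Real.rpow_nonneg (hg x) (cexp k)) (piOf_pos hd ω x).le) hδ T
  have h2 : wnorm d ω k ((d + 1) * (2 * k + 1)) r u =
      ∑ x ∈ T, u x ^ (2 * k + 2) * wgt d ((d + 1) * (2 * k + 1)) r x ^ 2 * piOf d ω x :=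
    tsum_eq_sum fun x hx => by simp [hsupp x hx]
  have h3 : (r : ℝ) ^ d * ∑ x ∈ T, g x * u x * piOf d ω x ≤
      η ^ (-cexp k) * (∑ x ∈ T, g x ^ cexp k * piOf d ω x *
        ((1 + ‖x‖ / r) ^ (2 * (d + 1)))⁻¹) +
      η ^ (2 * k + 2) * (((r : ℝ) ^ d) ^ (2 * k + 2) *
        ∑ x ∈ T, u x ^ (2 * k + 2) * wgt d ((d + 1) * (2 * k + 1)) r x ^ 2 * piOf d ω x) := by
    rw [Finset.mul_sum, Finset.mul_sum, Finset.mul_sum, Finset.mul_sum, ← Finset.sum_add_distrib]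
    refine Finset.sum_le_sum fun x _ => ?_
    have hρ : 0 < (1 + ‖x‖ / r) ^ (2 * (d + 1)) := by positivity
    have hy := young_weighted k (hg x) (mul_nonneg hN.le (hu x)) hη hρ
    have e : ((1 + ‖x‖ / r) ^ (2 * (d + 1))) ^ (2 * k + 1) =
        wgt d ((d + 1) * (2 * k + 1)) r x ^ 2 := by
      rw [wgt, ← pow_mul, ← pow_mul]; congr 1; ring
    rw [e, mul_pow] at hy
    have := mul_le_mul_of_nonneg_right hy (piOf_pos hd ω x).le
    linarith
  rw [← h2] at h3
  rw [tsum_eq_sum (s := T) fun x hx => by simp [hsupp x hx]]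
  have h4 := mul_le_mul_of_nonneg_left h1 (Real.rpow_nonneg hη.le (-cexp k))
  have h5 := mul_le_mul_of_nonneg_left hB (by positivity : 0 ≤ η ^ (2 * k + 2) * (r : ℝ) ^ d)
  refine le_of_mul_le_mul_left ?_ hN
  rw [pow_succ ((r : ℝ) ^ d) (2 * k + 1)] at h3
  linarith

lemma sum_le_of_tw {ε L : ℝ} (hε : 0 < ε) (hL : 2 ≤ L) {a : ℕ → ℝ} (ha : ∀ n, 0 ≤ a n)
    {h : ℕ → ℝ} (hh : ∀ j, h j = ε * L ^ j) {δ : ℝ} (hδ0 : 0 ≤ δ) (j₀ : ℕ)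
    (hδ : ∀ j, j₀ ≤ j → ∀ K, ∑ n ∈ Finset.range (K + 1), tw h (j + 1) n * a n ≤ δ) :
    ∃ C₀, ∀ N : ℕ, ∑ n ∈ Finset.range N, a n ≤
      C₀ + 2 * Real.exp 4 * (1 + 1 / ε) * L * δ * N := by
  have hp : ∀ j, 0 < h j := fun j => by rw [hh]; positivity
  have hsucc : ∀ j, h (j + 1) = L * h j := fun j => by rw [hh, hh, pow_succ]; ring
  have hεh : ∀ j, ε ≤ h j := fun j => by
    rw [hh]; exact le_mul_of_one_le_right hε.le (one_le_pow₀ (by linarith))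
  have hM : ∀ j, 2 * ∑ i ∈ Finset.range (j + 1), h i ≤ 4 * h j := by
    intro j
    induction j with
    | zero => simp; linarith [hp 0]
    | succ j ih =>
      rw [Finset.sum_range_succ, hsucc]
      nlinarith [hp j]
  set c := 2 * Real.exp 4 * (1 + 1 / ε) with hc
  have hc0 : 0 < c := by positivity
  have key : ∀ j n : ℕ, 4 * h j ≤ n → (n : ℝ) ≤ 4 * h (j + 1) →
      a n ≤ c * h (j + 1) * (tw h (j + 2) n * a n) := by
    intro j n h1 h2
    have h3 := exp_le_tw hp (j + 1) n ((hM j).trans h1) h2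
    have h4 : 1 + h (j + 1) ≤ (1 + 1 / ε) * h (j + 1) := by
      have : 1 ≤ 1 / ε * h (j + 1) := by
        rw [one_div, ← div_eq_inv_mul, one_le_div hε]; exact hεh _
      linarith
    have h5 := h3.trans (mul_le_mul_of_nonneg_right h4 (tw_nonneg hp (j + 2) n))
    have h6 : 1 ≤ c * h (j + 1) * tw h (j + 2) n := by
      have h7 := mul_le_mul_of_nonneg_left h5 (by positivity : 0 ≤ 2 * Real.exp 4)
      rw [Real.exp_neg] at h7
      have h8 : 2 * Real.exp 4 * ((Real.exp 4)⁻¹ / 2) = 1 := by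
        have := (Real.exp_pos 4).ne'
        field_simp
      rw [h8] at h7
      rw [hc]; linarith
    have := mul_le_mul_of_nonneg_right h6 (ha n)
    linarith
  set n₀ := ⌊4 * h j₀ + 1⌋₊ with hn₀
  set S : ℕ → ℝ := fun N => ∑ n ∈ Finset.range N, a n with hS
  have hSmono : Monotone S := fun N N' hNN =>
    Finset.sum_le_sum_of_subset_of_nonneg (Finset.range_mono hNN) fun n _ _ => ha n
  have base : ∀ N : ℕ, (N : ℝ) ≤ 4 * h j₀ + 1 → S N ≤ S n₀ := fun N hN =>
    hSmono (Nat.le_floor hN)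
  have hA : ∀ j, j₀ ≤ j → ∀ N : ℕ, (N : ℝ) ≤ 4 * h j + 1 → S N ≤ S n₀ + 2 * c * h j * δ := by
    intro j hj
    induction j, hj using Nat.le_induction with
    | base =>
      intro N hN
      have := base N hN
      have := hp j₀
      have : 0 ≤ 2 * c * h j₀ * δ := by positivity
      linarith
    | succ j hj ih =>
      intro N hN
      by_cases hN' : (N : ℝ) ≤ 4 * h j + 1
      · have h1 := ih N hN'
        have h2 : h j ≤ h (j + 1) := by rw [hsucc]; nlinarith [hp j]
        have : 2 * c * h j * δ ≤ 2 * c * h (j + 1) * δ := by gcongr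
        linarith
      push Not at hN'
      have hj0 := hp j
      set N' := ⌈4 * h j⌉₊ with hN'def
      have h1 : (N' : ℝ) ≤ 4 * h j + 1 := (Nat.ceil_lt_add_one (by positivity)).le
      have h2 : N' ≤ N := by exact_mod_cast h1.trans hN'.le
      have h3 := ih N' h1
      have h4 : S N = S N' + ∑ n ∈ Finset.Ico N' N, a n :=
        (Finset.sum_range_add_sum_Ico a h2).symm
      have h5 : ∑ n ∈ Finset.Ico N' N, a n ≤ c * h (j + 1) * δ := by
        have h6 := hp (j + 1)
        calc ∑ n ∈ Finset.Ico N' N, a n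
            ≤ ∑ n ∈ Finset.Ico N' N, c * h (j + 1) * (tw h (j + 2) n * a n) := by
              refine Finset.sum_le_sum fun n hn => key j n ?_ ?_
              · exact (Nat.le_ceil _).trans (by exact_mod_cast (Finset.mem_Ico.1 hn).1)
              · have : n + 1 ≤ N := (Finset.mem_Ico.1 hn).2
                have : (n : ℝ) + 1 ≤ N := by exact_mod_cast this
                linarith
          _ = c * h (j + 1) * ∑ n ∈ Finset.Ico N' N, tw h (j + 2) n * a n := by
              rw [Finset.mul_sum]
          _ ≤ c * h (j + 1) * ∑ n ∈ Finset.range (N + 1), tw h (j + 2) n * a n := by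
              refine mul_le_mul_of_nonneg_left
                (Finset.sum_le_sum_of_subset_of_nonneg ?_ fun n _ _ =>
                  mul_nonneg (tw_nonneg hp _ _) (ha n)) (by positivity)
              intro n hn
              have := (Finset.mem_Ico.1 hn).2
              exact Finset.mem_range.2 (by omega)
          _ ≤ _ := mul_le_mul_of_nonneg_left (hδ (j + 1) (by omega) N) (by positivity)
      have h6 : 2 * h j ≤ h (j + 1) := by
        rw [hsucc]; exact mul_le_mul_of_nonneg_right hL hj0.le
      have : 2 * c * h j * δ ≤ c * h (j + 1) * δ := by
        have := mul_le_mul_of_nonneg_left h6 (mul_nonneg hc0.le hδ0)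
        linarith
      linarith
  have hBd : ∀ j, j₀ ≤ j → ∀ N : ℕ, (N : ℝ) ≤ 4 * h j + 1 → S N ≤ S n₀ + c * L * δ * N := by
    intro j hj
    induction j, hj using Nat.le_induction with
    | base =>
      intro N hN
      have := base N hN
      have : 0 ≤ c * L * δ * N := by positivity
      linarith
    | succ j hj ih =>
      intro N hN
      by_cases hN' : (N : ℝ) ≤ 4 * h j + 1
      · exact ih N hN'
      push Not at hN'
      have h1 := hA (j + 1) (by omega) N hN
      rw [hsucc] at h1
      have h2 : 2 * h j ≤ N := by linarith [hp j]
      have := mul_le_mul_of_nonneg_left h2 (by positivity : 0 ≤ c * L * δ)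
      linarith
  refine ⟨S n₀, fun N => ?_⟩
  obtain ⟨j, hj⟩ := pow_unbounded_of_one_lt ((N : ℝ) / (4 * ε)) (by linarith : 1 < L)
  refine hBd (max j j₀) (le_max_right _ _) N ?_
  rw [div_lt_iff₀ (by positivity)] at hj
  have : L ^ j ≤ L ^ (max j j₀) := pow_le_pow_right₀ (by linarith) (le_max_left _ _)
  rw [hh]
  nlinarith

/-- Bound on the expected additive functionals of the walk in terms of block averages. -/
theorem occupation {d : ℕ} (hd : 1 ≤ d) {p q : ℝ} (hp : 1 < p) (hq : 1 < q)
    (hpq : 2 ≤ d → 1 / p + 1 / q < 2 / (d : ℝ)) {ω : EnvSp d} (hmom : InOmegaPQ d p q ω)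
    (k : ℕ) : ∃ C > 0, ∀ (g : Vert d → ℝ) (δ η : ℝ), (∀ x, 0 ≤ g x) → 0 ≤ δ → 0 < η →
      (∀ᶠ n : ℕ in atTop,
        ∑ x ∈ box d (n : ℝ), g x ^ cexp k * piOf d ω x ≤ δ * (n : ℝ) ^ d) →
      ∃ C₀, ∀ N : ℕ, ∑ n ∈ Finset.range N, ∑' x, g x * hk d ω n x * piOf d ω x ≤
        C₀ + C * (η ^ (-cexp k) * δ + η ^ (2 * k + 2)) * N := by
  set m := (d + 1) * (2 * k + 1) with hm
  obtain ⟨B, hB0, hB⟩ := scale_bound hd hp hq hpq hmom k m (by rw [hm]; nlinarith)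
  have hε := stepc_pos k m
  set ε := stepc k m with hεdef
  set L : ℝ := ((4 : ℝ) ^ (m + 1)) ^ 2 with hLdef
  have hL : 2 ≤ L := by
    have h1 : (4 : ℝ) ≤ 4 ^ (m + 1) := le_self_pow₀ (by norm_num) (by omega)
    nlinarith
  set h : ℕ → ℝ := fun j => ε * (scl m j : ℝ) ^ 2 with hhdef
  have hh : ∀ j, h j = ε * L ^ j := fun j => by
    change ε * (scl m j : ℝ) ^ 2 = ε * L ^ j
    rw [hLdef, scl]; push_cast
    rw [← pow_mul, ← pow_mul, ← pow_mul, ← pow_mul]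
    congr 2; ring
  have hp' : ∀ j, 0 < h j := fun j => by rw [hh]; positivity
  set A := 2 * Real.exp 4 * (1 + 1 / ε) * L with hA
  refine ⟨A * (2 * 4 ^ (d + 1) + B), by positivity, fun g δ η hg hδ hη hev => ?_⟩
  obtain ⟨r₀, hr₀⟩ := eventually_atTop.1 hev
  set δ' := 2 * 4 ^ (d + 1) * (η ^ (-cexp k) * δ) + η ^ (2 * k + 2) * B with hδ'
  have hscl : ∀ j, j ≤ scl m j := fun j => by
    rw [scl]; exact (Nat.lt_pow_self (Nat.one_lt_pow (by omega) (by norm_num))).le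
  obtain ⟨C₀, hC₀⟩ := sum_le_of_tw (a := fun n => ∑' x, g x * hk d ω n x * piOf d ω x) hε hL
    (fun n => tsum_nonneg fun x => mul_nonneg (mul_nonneg (hg x) (hk_nonneg hd ω n x))
      (piOf_pos hd ω x).le) hh (by positivity : 0 ≤ δ') r₀ (fun j hj K => by
        rw [← tsum_mul_avk ω h K (j + 1) g]
        refine pairing_le hd ω k (one_le_scl m (j + 1)) hg (avk_nonneg hd ω hp' K (j + 1))
          (avk_fs ω h K (j + 1)) hη (fun n hn => hr₀ n (by have := hscl (j + 1); omega)) ?_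
        exact hB (avk d ω h K) (fun j x => avk_nonneg hd ω hp' K j x) (fun j => avk_fs ω h K j)
          (fun j => avk_mass hd ω hp' K j) (fun x => (avk_zero ω h K x).le)
          (fun j x => avk_sub hd ω hp' K j x) (j + 1))
  refine ⟨C₀, fun N => (hC₀ N).trans ?_⟩
  have h1 : δ' ≤ (2 * 4 ^ (d + 1) + B) * (η ^ (-cexp k) * δ + η ^ (2 * k + 2)) := by
    have h2 : 0 ≤ η ^ (-cexp k) * δ := by positivity
    have h3 : 0 ≤ η ^ (2 * k + 2) := by positivity
    have h4 : (0 : ℝ) ≤ 2 * 4 ^ (d + 1) := by positivity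
    rw [hδ']
    nlinarith [mul_nonneg hB0.le h2, mul_nonneg h4 h3]
  have h2 : A * δ' * N ≤ A * ((2 * 4 ^ (d + 1) + B) * (η ^ (-cexp k) * δ + η ^ (2 * k + 2))) * N := by
    gcongr
  linarith

/-! ### The law of the walk -/

/-- The one-step transition measure of the walk. -/
def stepM (d : ℕ) (ω : EnvSp d) (x : Vert d) : Measure (Vert d) :=
  ∑ i, (ENNReal.ofReal (ω.1 (x, i) / piOf d ω x) • Measure.dirac (x + unitv d i) +
    ENNReal.ofReal (ω.1 (x - unitv d i, i) / piOf d ω x) • Measure.dirac (x - unitv d i))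

lemma stepM_univ {d : ℕ} (hd : 1 ≤ d) (ω : EnvSp d) (x : Vert d) : stepM d ω x Set.univ = 1 := by
  have hπ := piOf_pos hd ω x
  simp only [stepM, Measure.finsetSum_apply, Measure.add_apply, Measure.smul_apply, measure_univ,
    smul_eq_mul, mul_one]
  have h : ∀ i, ENNReal.ofReal (ω.1 (x, i) / piOf d ω x) +
      ENNReal.ofReal (ω.1 (x - unitv d i, i) / piOf d ω x) =
      ENNReal.ofReal ((ω.1 (x, i) + ω.1 (x - unitv d i, i)) / piOf d ω x) := fun i => by
    rw [add_div, ENNReal.ofReal_add (div_nonneg (ω.2 _).le hπ.le) (div_nonneg (ω.2 _).le hπ.le)]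
  simp only [h]
  rw [← ENNReal.ofReal_sum_of_nonneg fun i _ =>
    div_nonneg (add_nonneg (ω.2 _).le (ω.2 _).le) hπ.le, ← Finset.sum_div]
  change ENNReal.ofReal (piOf d ω x / piOf d ω x) = 1
  rw [div_self hπ.ne', ENNReal.ofReal_one]

lemma stepM_singleton {d : ℕ} (hd : 1 ≤ d) (ω : EnvSp d) (x y : Vert d) :
    stepM d ω x {y} = ENNReal.ofReal (transP d ω x y) := by
  have hπ := piOf_pos hd ω x
  have h0 : ∀ e, 0 ≤ ω.1 e / piOf d ω x := fun e => div_nonneg (ω.2 _).le hπ.le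
  simp only [stepM, Measure.finsetSum_apply, Measure.add_apply, Measure.smul_apply,
    smul_eq_mul, transP, cnd, Finset.sum_div]
  rw [ENNReal.ofReal_sum_of_nonneg]
  · refine Finset.sum_congr rfl fun i _ => ?_
    rw [add_div, ENNReal.ofReal_add]
    · congr 1
      · by_cases h : y = x + unitv d i
        · simp [h]
        · simp [h, Ne.symm h]
      · by_cases h : x = y + unitv d i
        · simp [h]
        · have h' : x - unitv d i ≠ y := fun h' => h (by rw [← h']; simp)
          simp [h, h']
    · split_ifs
      · exact h0 _
      · simp
    · split_ifs
      · exact div_nonneg (ω.2 _).le hπ.le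
      · simp
  · intro i _
    refine div_nonneg (add_nonneg ?_ ?_) hπ.le
    · split_ifs
      · exact (ω.2 _).le
      · exact le_rfl
    · split_ifs
      · exact (ω.2 _).le
      · exact le_rfl

lemma integral_stepM {d : ℕ} (hd : 1 ≤ d) (ω : EnvSp d) (x : Vert d) (G : Vert d → ℝ) :
    ∫ y, G y ∂(stepM d ω x) = avgOp d ω G x := by
  have hπ := piOf_pos hd ω x
  have hi : ∀ (c : ℝ) (z : Vert d), Integrable G (ENNReal.ofReal c • Measure.dirac z) :=
    fun c z => (integrable_dirac (by simp)).smul_measure ENNReal.ofReal_ne_top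
  rw [stepM, integral_finsetSum_measure fun i _ => (hi _ _).add_measure (hi _ _), avgOp,
    Finset.sum_div]
  refine Finset.sum_congr rfl fun i _ => ?_
  rw [integral_add_measure (hi _ _) (hi _ _), integral_smul_measure, integral_smul_measure,
    integral_dirac, integral_dirac, ENNReal.toReal_ofReal (div_nonneg (ω.2 _).le hπ.le),
    ENNReal.toReal_ofReal (div_nonneg (ω.2 _).le hπ.le), smul_eq_mul, smul_eq_mul]
  ring

/-- The restriction of a path to the times `0, …, n`. -/
def trunc (d n : ℕ) (w : Path d) : Fin (n + 1) → Vert d := fun i => w i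

/-- Extension of a finite path by zero. -/
def extend (d n : ℕ) (t : Fin (n + 1) → Vert d) : Path d :=
  fun i => if h : i < n + 1 then t ⟨i, h⟩ else 0

lemma extend_trunc {d n : ℕ} (w : Path d) {i : ℕ} (hi : i ≤ n) :
    extend d n (trunc d n w) i = w i := by
  simp [extend, trunc, Nat.lt_succ_of_le hi]

lemma measurable_trunc (d n : ℕ) : Measurable (trunc d n) :=
  measurable_pi_lambda _ fun _ => measurable_pi_apply _

/-- The transition kernel from finite paths to the next position. -/
def stepK (d : ℕ) (ω : EnvSp d) (n : ℕ) : ProbabilityTheory.Kernel (Fin (n + 1) → Vert d) (Vert d) :=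
  ProbabilityTheory.Kernel.ofFunOfCountable fun t => stepM d ω (t (Fin.last n))

lemma isMarkovKernel_stepK {d : ℕ} (hd : 1 ≤ d) (ω : EnvSp d) (n : ℕ) :
    ProbabilityTheory.IsMarkovKernel (stepK d ω n) :=
  ⟨fun t => ⟨stepM_univ hd ω (t (Fin.last n))⟩⟩

lemma map_trunc_eq {d : ℕ} (hd : 1 ≤ d) {ω : EnvSp d} {x₀ : Vert d} {μ : Measure (Path d)}
    (hμ : IsWalkLaw d ω x₀ μ) (n : ℕ) :
    μ.map (fun w => (trunc d n w, w (n + 1))) = (μ.map (trunc d n)).compProd (stepK d ω n) := by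
  have hprob := hμ.1
  have := isMarkovKernel_stepK hd ω n
  have hm := measurable_trunc d n
  have : IsProbabilityMeasure (μ.map (trunc d n)) := Measure.isProbabilityMeasure_map hm.aemeasurable
  refine Measure.ext_of_singleton fun ⟨t, y⟩ => ?_
  rw [Measure.map_apply (hm.prodMk (measurable_pi_apply _)) (measurableSet_singleton _),
    ← Set.singleton_prod_singleton,
    Measure.compProd_apply_prod (measurableSet_singleton _) (measurableSet_singleton _),
    lintegral_singleton, Measure.map_apply hm (measurableSet_singleton _)]
  change _ = stepM d ω (t (Fin.last n)) {y} * _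
  rw [stepM_singleton hd]
  set γ : ℕ → Vert d := fun i => if h : i < n + 1 then t ⟨i, h⟩ else y with hγ
  have hγi : ∀ i (h : i < n + 1), γ i = t ⟨i, h⟩ := fun i h => dif_pos h
  have hγn : γ (n + 1) = y := by simp [hγ]
  have e1 : (fun w => (trunc d n w, w (n + 1))) ⁻¹' ({t} ×ˢ {y}) =
      {w | ∀ k ≤ n + 1, w k = γ k} := by
    ext w
    simp only [Set.mem_preimage, Set.mem_prod, Set.mem_singleton_iff, Set.mem_ofPred_eq]
    constructor
    · rintro ⟨h1, h2⟩ k hk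
      rcases Nat.lt_or_ge k (n + 1) with h | h
      · rw [hγi k h, ← h1]; rfl
      · rw [show k = n + 1 by omega, hγn, h2]
    · intro h
      refine ⟨?_, (h (n + 1) le_rfl).trans hγn⟩
      ext1 i
      rw [← hγi i i.2]
      exact h i (by omega)
  have e2 : trunc d n ⁻¹' {t} = {w | ∀ k ≤ n, w k = γ k} := by
    ext w
    simp only [Set.mem_preimage, Set.mem_singleton_iff, Set.mem_ofPred_eq]
    constructor
    · rintro h1 k hk
      rw [hγi k (by omega), ← h1]; rfl
    · intro h
      ext1 i
      rw [← hγi i i.2]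
      exact h i (by omega)
  rw [e1, e2, hμ.2, hμ.2, Finset.prod_range_succ, hγn, hγi n (by omega)]
  change _ = ENNReal.ofReal (transP d ω (t (Fin.last n)) y) * _
  rw [← mul_assoc, mul_comm]
  rfl

lemma integrable_of_dep {d : ℕ} {μ : Measure (Path d)} [IsProbabilityMeasure μ] {n : ℕ}
    {F : Path d → ℝ} (hF : ∀ w w', (∀ i ≤ n, w i = w' i) → F w = F w') {K : ℝ}
    (hK : ∀ w, |F w| ≤ K) : Integrable F μ := by
  have h : F = (fun t => F (extend d n t)) ∘ trunc d n :=
    funext fun w => hF _ _ fun i hi => (extend_trunc w hi).symm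
  have hm : Measurable F := by
    rw [h]
    exact (Measurable.of_discrete).comp (measurable_trunc d n)
  exact Integrable.of_bound hm.aestronglyMeasurable K (Eventually.of_forall hK)

lemma walk_markov {d : ℕ} (hd : 1 ≤ d) {ω : EnvSp d} {x₀ : Vert d} {μ : Measure (Path d)}
    (hμ : IsWalkLaw d ω x₀ μ) {n : ℕ} {F : Path d → ℝ}
    (hF : ∀ w w', (∀ i ≤ n, w i = w' i) → F w = F w') {K : ℝ} (hK : ∀ w, |F w| ≤ K)
    {G : Vert d → ℝ} {K' : ℝ} (hG : ∀ x, |G x| ≤ K') :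
    ∫ w, F w * G (w (n + 1)) ∂μ = ∫ w, F w * avgOp d ω G (w n) ∂μ := by
  have hprob := hμ.1
  have := isMarkovKernel_stepK hd ω n
  have hm := measurable_trunc d n
  have : IsProbabilityMeasure (μ.map (trunc d n)) := Measure.isProbabilityMeasure_map hm.aemeasurable
  set F' : (Fin (n + 1) → Vert d) → ℝ := fun t => F (extend d n t) with hF'
  have h : ∀ w, F w = F' (trunc d n w) := fun w => hF _ _ fun i hi => (extend_trunc w hi).symm
  set Φ : (Fin (n + 1) → Vert d) × Vert d → ℝ := fun z => F' z.1 * G z.2 with hΦ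
  have hΦm : Measurable Φ := Measurable.of_discrete
  have hΦi : Integrable Φ ((μ.map (trunc d n)).compProd (stepK d ω n)) :=
    Integrable.of_bound hΦm.aestronglyMeasurable (K * K') (Eventually.of_forall fun z => by
      rw [Real.norm_eq_abs, abs_mul]
      exact mul_le_mul (hK _) (hG _) (abs_nonneg _) ((abs_nonneg _).trans (hK (extend d n z.1))))
  have e1 : ∫ w, F w * G (w (n + 1)) ∂μ =
      ∫ z, Φ z ∂(μ.map (fun w => (trunc d n w, w (n + 1)))) := by
    rw [integral_map (hm.prodMk (measurable_pi_apply _)).aemeasurable hΦm.aestronglyMeasurable]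
    exact integral_congr_ae (Eventually.of_forall fun w => by simp [hΦ, h w])
  rw [e1, map_trunc_eq hd hμ, Measure.integral_compProd hΦi]
  have e2 : ∀ t : Fin (n + 1) → Vert d, ∫ y, Φ (t, y) ∂(stepK d ω n t) =
      F' t * avgOp d ω G (t (Fin.last n)) := fun t => by
    rw [← integral_stepM hd, ← integral_const_mul]
    rfl
  simp only [e2]
  rw [integral_map hm.aemeasurable (Measurable.of_discrete).aestronglyMeasurable]
  exact integral_congr_ae (Eventually.of_forall fun w => by simp [h w, trunc])

lemma abs_avgOp_le {d : ℕ} (hd : 1 ≤ d) (ω : EnvSp d) {G : Vert d → ℝ} {K : ℝ}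
    (hG : ∀ x, |G x| ≤ K) (x : Vert d) : |avgOp d ω G x| ≤ K := by
  rw [← avgOp_const hd ω K x, abs_le]
  constructor
  · have := avgOp_mono ω (u := fun _ => -K) (v := G) (fun y => (abs_le.1 (hG y)).1) x
    rw [avgOp_const hd] at this ⊢
    exact this
  · exact avgOp_mono ω (fun y => (abs_le.1 (hG y)).2) x

lemma integral_walk_of_bdd {d : ℕ} (hd : 1 ≤ d) {ω : EnvSp d} {μ : Measure (Path d)}
    (hμ : IsWalkLaw d ω 0 μ) (n : ℕ) : ∀ {G : Vert d → ℝ} {K : ℝ}, (∀ x, |G x| ≤ K) →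
      ∫ w, G (w n) ∂μ = ∑' x, G x * hk d ω n x * piOf d ω x := by
  have hprob := hμ.1
  induction n with
  | zero =>
    intro G K hG
    have h0 : ∀ᵐ w ∂μ, w 0 = 0 := by
      have h1 := hμ.2 0 fun _ => 0
      simp only [if_true, Finset.range_zero, Finset.prod_empty, mul_one, nonpos_iff_eq_zero,
        forall_eq] at h1
      exact (prob_compl_eq_zero_iff ((measurableSet_singleton (0 : Vert d)).preimage
        (measurable_pi_apply 0))).2 h1
    rw [integral_congr_ae (g := fun _ => G 0) (h0.mono fun w hw => by
      change G (w 0) = G 0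
      rw [hw]), integral_const, tsum_eq_single 0 fun x hx => by simp [hk, hx]]
    simp [hk, (piOf_pos hd ω 0).ne']
  | succ n ih =>
    intro G K hG
    have h1 := walk_markov hd hμ (n := n) (F := fun _ => 1) (fun _ _ _ => rfl)
      (K := 1) (fun _ => by simp) hG
    simp only [one_mul] at h1
    rw [h1, ih (abs_avgOp_le hd ω hG), ← tsum_avgOp_mul_piOf hd ω (hk_fs ω n)]
    rfl

lemma ae_walk_mem {d : ℕ} (hd : 1 ≤ d) {ω : EnvSp d} {μ : Measure (Path d)}
    (hμ : IsWalkLaw d ω 0 μ) (n : ℕ) : ∀ᵐ w ∂μ, w n ∈ Function.support (hk d ω n) := by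
  have hprob := hμ.1
  set S := Function.support (hk d ω n) with hS
  have hm : MeasurableSet {w : Path d | w n ∈ Sᶜ} :=
    (measurable_pi_apply n) (MeasurableSet.of_discrete (s := Sᶜ))
  have h1 := integral_walk_of_bdd hd hμ n (G := Sᶜ.indicator fun _ => 1) (K := 1) fun x => by
    by_cases hx : x ∈ Sᶜ <;> simp [hx]
  have h2 : ∀ x, Sᶜ.indicator (fun _ => (1 : ℝ)) x * hk d ω n x * piOf d ω x = 0 := fun x => by
    by_cases hx : x ∈ Sᶜ
    · have : hk d ω n x = 0 := by simpa [hS] using hx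
      simp [this]
    · rw [Set.indicator_of_notMem hx]; simp
  rw [tsum_congr h2, tsum_zero] at h1
  have h3 : (fun w : Path d => Sᶜ.indicator (fun _ => (1 : ℝ)) (w n)) =
      {w : Path d | w n ∈ Sᶜ}.indicator 1 := by
    ext w
    rfl
  rw [h3, integral_indicator_one hm, measureReal_eq_zero_iff] at h1
  exact h1

lemma walk_aeeq {d : ℕ} (hd : 1 ≤ d) {ω : EnvSp d} {μ : Measure (Path d)}
    (hμ : IsWalkLaw d ω 0 μ) (n : ℕ) (g : Vert d → ℝ) :
    (fun w => g (w n)) =ᵐ[μ] fun w => (Function.support (hk d ω n)).indicator g (w n) :=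
  (ae_walk_mem hd hμ n).mono fun w hw => by
    change g (w n) = (Function.support (hk d ω n)).indicator g (w n)
    rw [Set.indicator_of_mem hw]

lemma exists_bound_indicator {d : ℕ} (ω : EnvSp d) (n : ℕ) (g : Vert d → ℝ) :
    ∃ K, ∀ x, |(Function.support (hk d ω n)).indicator g x| ≤ K := by
  obtain ⟨K, hK⟩ := ((hk_fs ω n).image fun x => |g x|).bddAbove
  refine ⟨max K 0, fun x => ?_⟩
  by_cases hx : x ∈ Function.support (hk d ω n)
  · rw [Set.indicator_of_mem hx]
    exact (hK ⟨x, hx, rfl⟩).trans (le_max_left _ _)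
  · rw [Set.indicator_of_notMem hx]; simp

lemma integrable_walk {d : ℕ} (hd : 1 ≤ d) {ω : EnvSp d} {μ : Measure (Path d)}
    (hμ : IsWalkLaw d ω 0 μ) (n : ℕ) (g : Vert d → ℝ) : Integrable (fun w => g (w n)) μ := by
  have hprob := hμ.1
  obtain ⟨K, hK⟩ := exists_bound_indicator ω n g
  rw [integrable_congr (walk_aeeq hd hμ n g)]
  exact integrable_of_dep (n := n) (fun w w' h => by rw [h n le_rfl]) fun w => hK (w n)

lemma integral_walk {d : ℕ} (hd : 1 ≤ d) {ω : EnvSp d} {μ : Measure (Path d)}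
    (hμ : IsWalkLaw d ω 0 μ) (n : ℕ) (g : Vert d → ℝ) :
    ∫ w, g (w n) ∂μ = ∑' x, g x * hk d ω n x * piOf d ω x := by
  obtain ⟨K, hK⟩ := exists_bound_indicator ω n g
  rw [integral_congr_ae (walk_aeeq hd hμ n g), integral_walk_of_bdd hd hμ n hK]
  refine tsum_congr fun x => ?_
  by_cases hx : x ∈ Function.support (hk d ω n)
  · rw [Set.indicator_of_mem hx]
  · have : hk d ω n x = 0 := by simpa using hx
    simp [this]

/-- The martingale part of `∑ G (X_{k+1})`. -/
def mart (d : ℕ) (ω : EnvSp d) (G : Vert d → ℝ) (n : ℕ) (w : Path d) : ℝ :=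
  ∑ k ∈ Finset.range n, (G (w (k + 1)) - avgOp d ω G (w k))

lemma mart_dep {d : ℕ} (ω : EnvSp d) (G : Vert d → ℝ) (n : ℕ) (w w' : Path d)
    (h : ∀ i ≤ n, w i = w' i) : mart d ω G n w = mart d ω G n w' := by
  refine Finset.sum_congr rfl fun k hk => ?_
  have := Finset.mem_range.1 hk
  rw [h k (by omega), h (k + 1) (by omega)]

lemma abs_mart_le {d : ℕ} (hd : 1 ≤ d) (ω : EnvSp d) {G : Vert d → ℝ} {K : ℝ}
    (hG : ∀ x, |G x| ≤ K) (n : ℕ) (w : Path d) : |mart d ω G n w| ≤ n * (2 * K) := by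
  refine (Finset.abs_sum_le_sum_abs _ _).trans ?_
  refine (Finset.sum_le_card_nsmul _ _ (2 * K) fun k _ => ?_).trans (by simp)
  have h1 := abs_le.1 (hG (w (k + 1)))
  have h2 := abs_le.1 (abs_avgOp_le hd ω hG (w k))
  rw [abs_le]
  constructor <;> linarith

lemma integrable_mart_sq {d : ℕ} (hd : 1 ≤ d) {ω : EnvSp d} {μ : Measure (Path d)}
    [IsProbabilityMeasure μ] {G : Vert d → ℝ} {K : ℝ} (hG : ∀ x, |G x| ≤ K) (n : ℕ) :
    Integrable (fun w => mart d ω G n w ^ 2) μ :=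
  integrable_of_dep (n := n) (fun w w' h => by rw [mart_dep ω G n w w' h])
    (K := (n * (2 * K)) ^ 2) fun w => by
      rw [abs_pow]
      exact pow_le_pow_left₀ (abs_nonneg _) (abs_mart_le hd ω hG n w) 2

lemma integral_mart_sq_le {d : ℕ} (hd : 1 ≤ d) {ω : EnvSp d} {μ : Measure (Path d)}
    (hμ : IsWalkLaw d ω 0 μ) {G : Vert d → ℝ} {K : ℝ} (hG : ∀ x, |G x| ≤ K) (n : ℕ) :
    ∫ w, mart d ω G n w ^ 2 ∂μ ≤ n * (2 * K) ^ 2 := by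
  have hprob := hμ.1
  induction n with
  | zero => simp [mart]
  | succ n ih =>
    have hA := abs_avgOp_le hd ω hG
    have i1 : Integrable (fun w => mart d ω G n w * G (w (n + 1))) μ :=
      integrable_of_dep (n := n + 1) (K := n * (2 * K) * K)
        (fun w w' h => by
          rw [h (n + 1) le_rfl, mart_dep ω G n w w' fun i hi => h i (by omega)])
        fun w => by
          rw [abs_mul]
          exact mul_le_mul (abs_mart_le hd ω hG n w) (hG _) (abs_nonneg _)
            ((abs_nonneg _).trans (abs_mart_le hd ω hG n w))
    have i2 : Integrable (fun w => mart d ω G n w * avgOp d ω G (w n)) μ :=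
      integrable_of_dep (n := n) (K := n * (2 * K) * K)
        (fun w w' h => by rw [h n le_rfl, mart_dep ω G n w w' h])
        fun w => by
          rw [abs_mul]
          exact mul_le_mul (abs_mart_le hd ω hG n w) (hA _) (abs_nonneg _)
            ((abs_nonneg _).trans (abs_mart_le hd ω hG n w))
    have i3 : Integrable (fun w => mart d ω G n w ^ 2) μ := integrable_mart_sq hd hG n
    have horth := walk_markov hd hμ (mart_dep ω G n) (abs_mart_le hd ω hG n) hG
    have hle : ∀ w, mart d ω G (n + 1) w ^ 2 ≤ mart d ω G n w ^ 2 +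
        2 * (mart d ω G n w * G (w (n + 1)) - mart d ω G n w * avgOp d ω G (w n)) +
        (2 * K) ^ 2 := fun w => by
      have h1 := abs_le.1 (hG (w (n + 1)))
      have h2 := abs_le.1 (hA (w n))
      have h3 : (G (w (n + 1)) - avgOp d ω G (w n)) ^ 2 ≤ (2 * K) ^ 2 :=
        sq_le_sq' (by linarith) (by linarith)
      rw [mart, Finset.sum_range_succ]
      change (mart d ω G n w + _) ^ 2 ≤ _
      nlinarith
    have i4 : Integrable (fun w => 2 * (mart d ω G n w * G (w (n + 1)) -
        mart d ω G n w * avgOp d ω G (w n))) μ := (i1.sub i2).const_mul 2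
    have i5 : Integrable (fun w => mart d ω G n w ^ 2 + 2 * (mart d ω G n w * G (w (n + 1)) -
        mart d ω G n w * avgOp d ω G (w n))) μ := i3.add i4
    have hint := integral_mono (integrable_mart_sq hd hG (n + 1))
      (i5.add (integrable_const ((2 * K) ^ 2))) hle
    have e : ∫ w, (mart d ω G n w ^ 2 +
        2 * (mart d ω G n w * G (w (n + 1)) - mart d ω G n w * avgOp d ω G (w n)) +
        (2 * K) ^ 2) ∂μ = ∫ w, mart d ω G n w ^ 2 ∂μ + (2 * K) ^ 2 := by
      rw [integral_add i5 (integrable_const _), integral_add i3 i4, integral_const_mul, integral_sub i1 i2, horth]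
      simp
    push_cast
    refine hint.trans ?_
    change ∫ w, (mart d ω G n w ^ 2 +
        2 * (mart d ω G n w * G (w (n + 1)) - mart d ω G n w * avgOp d ω G (w n)) +
        (2 * K) ^ 2) ∂μ ≤ _
    rw [e]
    linarith

lemma sum_sub_avgOp_eq {d : ℕ} (ω : EnvSp d) (G : Vert d → ℝ) (n : ℕ) (w : Path d) :
    ∑ k ∈ Finset.range n, (G (w k) - avgOp d ω G (w k)) = mart d ω G n w + (G (w 0) - G (w n)) := by
  induction n with
  | zero => simp [mart]
  | succ n ih =>
    rw [Finset.sum_range_succ, ih, mart, mart, Finset.sum_range_succ]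
    ring

/-- Additive functionals of coboundaries are negligible. -/
lemma integral_abs_coboundary_le {d : ℕ} (hd : 1 ≤ d) {ω : EnvSp d} {μ : Measure (Path d)}
    (hμ : IsWalkLaw d ω 0 μ) {G : Vert d → ℝ} {K : ℝ} (hG : ∀ x, |G x| ≤ K) (n : ℕ) :
    ∫ w, |∑ k ∈ Finset.range n, (G (w k) - avgOp d ω G (w k))| ∂μ ≤
      2 * K * Real.sqrt n + 2 * K := by
  have hprob := hμ.1
  have hK : 0 ≤ K := (abs_nonneg _).trans (hG 0)
  have i1 : Integrable (fun w => |mart d ω G n w|) μ :=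
    (integrable_of_dep (mart_dep ω G n) (abs_mart_le hd ω hG n)).abs
  have h1 : ∫ w, |mart d ω G n w| ∂μ ≤ Real.sqrt (n * (2 * K) ^ 2) := by
    refine Real.le_sqrt_of_sq_le (le_trans ?_ (integral_mart_sq_le hd hμ hG n))
    have i2 := integrable_mart_sq (μ := μ) (ω := ω) hd hG n
    set a := ∫ w, |mart d ω G n w| ∂μ with ha
    have h2 : ∀ w, 2 * a * |mart d ω G n w| - a ^ 2 ≤ mart d ω G n w ^ 2 := fun w => by
      rw [← sq_abs (mart d ω G n w)]
      nlinarith [sq_nonneg (|mart d ω G n w| - a)]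
    have h3 := integral_mono ((i1.const_mul (2 * a)).sub (integrable_const _)) i2 h2
    have h4 : ∫ w, (2 * a * |mart d ω G n w| - a ^ 2) ∂μ = a ^ 2 := by
      rw [integral_sub (i1.const_mul _) (integrable_const _), integral_const_mul, ← ha]
      simp; ring
    exact h4.symm.le.trans h3
  rw [Real.sqrt_mul (Nat.cast_nonneg n), Real.sqrt_sq (by positivity)] at h1
  simp only [sum_sub_avgOp_eq]
  have h2 : ∀ w : Path d, |mart d ω G n w + (G (w 0) - G (w n))| ≤ |mart d ω G n w| + 2 * K :=
    fun w => by
      refine (abs_add_le _ _).trans (add_le_add le_rfl ?_)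
      have h3 := abs_le.1 (hG (w 0))
      have h4 := abs_le.1 (hG (w n))
      rw [abs_le]
      constructor <;> linarith
  have h3 := integral_mono_of_nonneg (μ := μ) (Eventually.of_forall fun w => abs_nonneg _)
    (i1.add (integrable_const _)) (Eventually.of_forall h2)
  refine h3.trans ?_
  change ∫ w, (|mart d ω G n w| + 2 * K) ∂μ ≤ _
  rw [integral_add i1 (integrable_const _)]
  simp
  linarith

/-! ### The environment law -/

instance instMetrizableEnv (d : ℕ) : TopologicalSpace.MetrizableSpace (EnvSp d) :=
  Topology.IsEmbedding.subtypeVal.metrizableSpace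

lemma shift_shift {d : ℕ} (z x : Vert d) (ω : EnvSp d) :
    shift d z (shift d x ω) = shift d (z + x) ω := by
  apply Subtype.ext
  funext e
  simp [shift, add_assoc]

lemma shift_zero {d : ℕ} (ω : EnvSp d) : shift d 0 ω = ω := by
  apply Subtype.ext
  funext e
  simp [shift]

lemma continuous_coord {d : ℕ} (e : EdgeIx d) : Continuous fun ω : EnvSp d => ω.1 e :=
  (continuous_apply e).comp continuous_subtype_val

lemma continuous_shift {d : ℕ} (x : Vert d) : Continuous (shift d x) :=
  Continuous.subtype_mk (continuous_pi fun _ => continuous_coord _) _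

lemma piOf_shift {d : ℕ} (x : Vert d) (ω : EnvSp d) (y : Vert d) :
    piOf d (shift d x ω) y = piOf d ω (y + x) := by
  simp only [piOf, shift]
  refine Finset.sum_congr rfl fun i _ => ?_
  rw [sub_add_eq_add_sub]

lemma continuous_piOf {d : ℕ} (x : Vert d) : Continuous fun ω : EnvSp d => piOf d ω x :=
  continuous_finsetSum _ fun _ _ => (continuous_coord _).add (continuous_coord _)

lemma tendsto_card_box_ratio (d K : ℕ) :
    Tendsto (fun n : ℕ => ((box d ((n + K : ℕ) : ℝ)).card : ℝ) / (box d (n : ℝ)).card)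
      atTop (𝓝 1) := by
  have h1 : Tendsto (fun n : ℕ => (1 + 2 * (K : ℝ) / (2 * n + 1)) ^ d) atTop (𝓝 ((1 + 0) ^ d)) := by
    refine (tendsto_const_nhds.add (Tendsto.div_atTop tendsto_const_nhds ?_)).pow d
    exact tendsto_atTop_add_const_right _ _
      (tendsto_natCast_atTop_atTop.const_mul_atTop (by norm_num))
  rw [add_zero, one_pow] at h1
  refine h1.congr fun n => ?_
  rw [card_box, card_box]
  push_cast
  rw [← div_pow]
  congr 1
  have : (0 : ℝ) < 2 * n + 1 := by positivity
  field_simp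
  ring

lemma card_box_pos (d n : ℕ) : (0 : ℝ) < (box d (n : ℝ)).card := by
  rw [card_box]
  positivity

lemma IsEnvLaw.integral_le {d : ℕ} {ω : EnvSp d} {P : Measure (EnvSp d)} (hP : IsEnvLaw d ω P)
    {f : EnvSp d → ℝ} (hf : Continuous f) (hb : IsBdd d f) {C : ℝ}
    (h : ∀ᶠ n : ℕ in atTop, ∑ x ∈ box d (n : ℝ), f (shift d x ω) ≤ C * (box d (n : ℝ)).card) :
    ∫ ω', f ω' ∂P ≤ C := by
  refine le_of_tendsto (hP.2 f hf hb) (h.mono fun n hn => ?_)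
  rwa [div_le_iff₀ (card_box_pos d n)]

lemma IsEnvLaw.eventually_sum_le {d : ℕ} {ω : EnvSp d} {P : Measure (EnvSp d)}
    (hP : IsEnvLaw d ω P) {f : EnvSp d → ℝ} (hf : Continuous f) (hb : IsBdd d f) {C : ℝ}
    (h : ∫ ω', f ω' ∂P < C) :
    ∀ᶠ n : ℕ in atTop, ∑ x ∈ box d (n : ℝ), f (shift d x ω) ≤ C * (box d (n : ℝ)).card := by
  filter_upwards [(hP.2 f hf hb).eventually (gt_mem_nhds h)] with n hn
  rw [div_lt_iff₀ (card_box_pos d n)] at hn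
  exact hn.le

lemma integrable_of_isBdd {d : ℕ} {P : Measure (EnvSp d)} [IsFiniteMeasure P]
    {f : EnvSp d → ℝ} (hf : Continuous f) (hb : IsBdd d f) : Integrable f P := by
  obtain ⟨M, hM⟩ := hb
  exact Integrable.of_bound hf.measurable.aestronglyMeasurable M (ae_of_all _ hM)

lemma IsEnvLaw.integral_shift_le_of_nonneg {d : ℕ} {ω : EnvSp d} {P : Measure (EnvSp d)}
    (hP : IsEnvLaw d ω P) (z : Vert d) {f : EnvSp d → ℝ} (hf : Continuous f) (hb : IsBdd d f)
    (h0 : ∀ ω', 0 ≤ f ω') : ∫ ω', f (shift d z ω') ∂P ≤ ∫ ω', f ω' ∂P := by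
  obtain ⟨K, hK⟩ := exists_nat_ge ‖z‖
  have hb' : IsBdd d fun ω' => f (shift d z ω') := hb.imp fun M hM ω' => hM _
  have h1 := hP.2 _ (hf.comp (continuous_shift z)) hb'
  have h2 := (((hP.2 f hf hb).comp (tendsto_add_atTop_nat K))).mul (tendsto_card_box_ratio d K)
  rw [mul_one] at h2
  refine le_of_tendsto_of_tendsto' h1 h2 fun n => ?_
  simp only [Function.comp]
  rw [div_mul_div_cancel₀ (card_box_pos d (n + K)).ne']
  refine div_le_div_of_nonneg_right ?_ (card_box_pos d n).le
  calc ∑ x ∈ box d (n : ℝ), f (shift d z (shift d x ω))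
      = ∑ x ∈ (box d (n : ℝ)).map (addLeftEmbedding z), f (shift d x ω) := by
        rw [Finset.sum_map]
        simp only [shift_shift, addLeftEmbedding_apply]
    _ ≤ ∑ x ∈ box d ((n + K : ℕ) : ℝ), f (shift d x ω) := by
        refine Finset.sum_le_sum_of_subset_of_nonneg (fun y hy => ?_) fun _ _ _ => h0 _
        obtain ⟨x, hx, rfl⟩ := Finset.mem_map.1 hy
        rw [mem_box] at hx ⊢
        push_cast
        refine (norm_add_le _ _).trans ?_
        linarith

lemma IsEnvLaw.integral_shift_le {d : ℕ} {ω : EnvSp d} {P : Measure (EnvSp d)}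
    (hP : IsEnvLaw d ω P) (z : Vert d) {f : EnvSp d → ℝ} (hf : Continuous f) (hb : IsBdd d f) :
    ∫ ω', f (shift d z ω') ∂P ≤ ∫ ω', f ω' ∂P := by
  have := hP.1
  obtain ⟨M, hM⟩ := hb
  have h := hP.integral_shift_le_of_nonneg z (f := fun ω' => f ω' + M) (hf.add continuous_const)
    ⟨|M| + |M|, fun ω' => (abs_add_le _ _).trans
      (add_le_add ((hM ω').trans (le_abs_self M)) le_rfl)⟩
    fun ω' => by linarith [neg_le_of_abs_le (hM ω')]
  have i1 : Integrable f P := integrable_of_isBdd hf ⟨M, hM⟩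
  have i2 : Integrable (fun ω' => f (shift d z ω')) P :=
    integrable_of_isBdd (hf.comp (continuous_shift z)) ⟨M, fun ω' => hM _⟩
  rw [integral_add i1 (integrable_const _), integral_add i2 (integrable_const _)] at h
  linarith

lemma IsEnvLaw.measurePreserving {d : ℕ} {ω : EnvSp d} {P : Measure (EnvSp d)}
    (hP : IsEnvLaw d ω P) (z : Vert d) : MeasurePreserving (shift d z) P P := by
  have := hP.1
  refine ⟨(continuous_shift z).measurable, ?_⟩
  have : IsProbabilityMeasure (P.map (shift d z)) :=
    Measure.isProbabilityMeasure_map (continuous_shift z).aemeasurable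
  refine ext_of_forall_integral_eq_of_IsFiniteMeasure fun f => ?_
  have hb : IsBdd d f := ⟨‖f‖, fun ω' => f.norm_coe_le_norm ω'⟩
  rw [integral_map (continuous_shift z).aemeasurable
    f.continuous.measurable.aestronglyMeasurable]
  refine le_antisymm (hP.integral_shift_le z f.continuous hb) ?_
  have h := hP.integral_shift_le (-z) (f.continuous.comp (continuous_shift z))
    ⟨‖f‖, fun ω' => f.norm_coe_le_norm _⟩
  simpa only [Function.comp, shift_shift, add_neg_cancel, shift_zero] using h

/-- A nonnegative continuous function with bounded block averages is integrable. -/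
lemma IsEnvLaw.integrable_of_sum_le {d : ℕ} {ω : EnvSp d} {P : Measure (EnvSp d)}
    (hP : IsEnvLaw d ω P) {φ : EnvSp d → ℝ} (hφ : Continuous φ) (h0 : ∀ ω', 0 ≤ φ ω') {C : ℝ}
    (h : ∀ n : ℕ, 1 ≤ n → ∑ x ∈ box d (n : ℝ), φ (shift d x ω) ≤ C * (n : ℝ) ^ d) :
    Integrable φ P := by
  have := hP.1
  have hC : 0 ≤ C := by
    have := h 1 le_rfl
    simp only [Nat.cast_one, one_pow, mul_one] at this
    exact (Finset.sum_nonneg fun _ _ => h0 _).trans this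
  have key : ∀ M : ℕ, ∫⁻ ω', ENNReal.ofReal (min (φ ω') M) ∂P ≤ ENNReal.ofReal C := fun M => by
    have hc : Continuous fun ω' => min (φ ω') (M : ℝ) := hφ.min continuous_const
    have hn : ∀ ω', 0 ≤ min (φ ω') (M : ℝ) := fun ω' => le_min (h0 ω') M.cast_nonneg
    have hb : IsBdd d fun ω' => min (φ ω') (M : ℝ) :=
      ⟨M, fun ω' => by rw [abs_of_nonneg (hn ω')]; exact min_le_right _ _⟩
    rw [← ofReal_integral_eq_lintegral_ofReal (integrable_of_isBdd hc hb) (ae_of_all _ hn)]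
    refine ENNReal.ofReal_le_ofReal (hP.integral_le hc hb ?_)
    filter_upwards [eventually_ge_atTop 1] with n hn1
    calc _ ≤ ∑ x ∈ box d (n : ℝ), φ (shift d x ω) :=
          Finset.sum_le_sum fun x _ => min_le_left _ _
      _ ≤ _ := (h n hn1).trans (mul_le_mul_of_nonneg_left (pow_le_card_box d n) hC)
  refine ⟨hφ.measurable.aestronglyMeasurable, ?_⟩
  rw [hasFiniteIntegral_iff_ofReal (ae_of_all _ h0)]
  have hsup : ∀ ω', ENNReal.ofReal (φ ω') = ⨆ M : ℕ, ENNReal.ofReal (min (φ ω') M) := fun ω' => by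
    refine le_antisymm ?_ (iSup_le fun M => ENNReal.ofReal_le_ofReal (min_le_left _ _))
    obtain ⟨M, hM⟩ := exists_nat_ge (φ ω')
    exact le_iSup_of_le M (by rw [min_eq_left hM])
  simp only [hsup]
  rw [lintegral_iSup]
  · exact (iSup_le key).trans_lt ENNReal.ofReal_lt_top
  · exact fun M => (hφ.min continuous_const).measurable.ennreal_ofReal
  · intro M N hMN ω'
    exact ENNReal.ofReal_le_ofReal (min_le_min le_rfl (by exact_mod_cast hMN))

lemma integral_Qmeas {d : ℕ} (hd : 1 ≤ d) (P : Measure (EnvSp d)) (φ : EnvSp d → ℝ) :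
    ∫ ω', φ ω' ∂(Qmeas d P) =
      (∫ ω', φ ω' * piOf d ω' 0 ∂P) / ∫ ω', piOf d ω' 0 ∂P := by
  have hm : 0 ≤ ∫ ω', piOf d ω' 0 ∂P := integral_nonneg fun ω' => (piOf_pos hd ω' 0).le
  rw [Qmeas, integral_withDensity_eq_integral_toReal_smul
    ((continuous_piOf 0).measurable.div_const _).ennreal_ofReal
    (ae_of_all _ fun _ => ENNReal.ofReal_lt_top), ← integral_div]
  refine integral_congr_ae (ae_of_all _ fun ω' => ?_)
  simp only [smul_eq_mul]
  rw [ENNReal.toReal_ofReal (div_nonneg (piOf_pos hd ω' 0).le hm)]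
  ring

lemma integral_piOf_pos {d : ℕ} (hd : 1 ≤ d) {P : Measure (EnvSp d)} [IsProbabilityMeasure P]
    (hπ : Integrable (fun ω' => piOf d ω' 0) P) : 0 < ∫ ω', piOf d ω' 0 ∂P := by
  rw [integral_pos_iff_support_of_nonneg (fun ω' => (piOf_pos hd ω' 0).le) hπ]
  have : Function.support (fun ω' : EnvSp d => piOf d ω' 0) = Set.univ :=
    Set.eq_univ_of_forall fun ω' => (piOf_pos hd ω' 0).ne'
  rw [this, measure_univ]
  exact one_pos

lemma integrable_Qmeas_iff {d : ℕ} (hd : 1 ≤ d) {P : Measure (EnvSp d)} [IsProbabilityMeasure P]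
    (hπ : Integrable (fun ω' => piOf d ω' 0) P) {φ : EnvSp d → ℝ} :
    Integrable φ (Qmeas d P) ↔ Integrable (fun ω' => φ ω' * piOf d ω' 0) P := by
  have hm := integral_piOf_pos hd hπ
  rw [Qmeas, integrable_withDensity_iff_integrable_smul'
    ((continuous_piOf 0).measurable.div_const _).ennreal_ofReal
    (ae_of_all _ fun _ => ENNReal.ofReal_lt_top),
    ← integrable_const_mul_iff (isUnit_iff_ne_zero.2 (inv_ne_zero hm.ne'))
      fun ω' => φ ω' * piOf d ω' 0]
  refine integrable_congr (ae_of_all _ fun ω' => ?_)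
  simp only [smul_eq_mul]
  rw [ENNReal.toReal_ofReal (div_nonneg (piOf_pos hd ω' 0).le hm.le)]
  ring

lemma isProbabilityMeasure_Qmeas {d : ℕ} (hd : 1 ≤ d) {P : Measure (EnvSp d)}
    [IsProbabilityMeasure P] (hπ : Integrable (fun ω' => piOf d ω' 0) P) :
    IsProbabilityMeasure (Qmeas d P) := by
  have hm := integral_piOf_pos hd hπ
  refine ⟨?_⟩
  rw [Qmeas, withDensity_apply _ MeasurableSet.univ, Measure.restrict_univ,
    ← ofReal_integral_eq_lintegral_ofReal (hπ.div_const _)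
      (ae_of_all _ fun ω' => div_nonneg (piOf_pos hd ω' 0).le hm.le), integral_div, div_self hm.ne',
    ENNReal.ofReal_one]

lemma ae_Qmeas_iff {d : ℕ} (hd : 1 ≤ d) {P : Measure (EnvSp d)} [IsProbabilityMeasure P]
    (hπ : Integrable (fun ω' => piOf d ω' 0) P) {p : EnvSp d → Prop} :
    (∀ᵐ ω' ∂(Qmeas d P), p ω') ↔ ∀ᵐ ω' ∂P, p ω' := by
  have hm := integral_piOf_pos hd hπ
  rw [Qmeas, ae_withDensity_iff ((continuous_piOf 0).measurable.div_const _).ennreal_ofReal]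
  refine eventually_congr (ae_of_all _ fun ω' => ?_)
  simp [piOf_pos hd ω' 0, hm]

/-- A function invariant under the unit shifts is constant under an ergodic law. -/
lemma ae_const_of_shift_invariant {d : ℕ} {P : Measure (EnvSp d)} [IsProbabilityMeasure P]
    (hinv : ∀ z, MeasurePreserving (shift d z) P P) (herg : ErgodicEnv d P)
    {φ : EnvSp d → ℝ} (hφ : Measurable φ)
    (h : ∀ i, ∀ᵐ ω' ∂P, φ (shift d (unitv d i) ω') = φ ω') :
    ∃ c : ℝ, ∀ᵐ ω' ∂P, φ ω' = c := by
  let S : AddSubgroup (Vert d) :=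
    { carrier := {x | ∀ᵐ ω' ∂P, φ (shift d x ω') = φ ω'}
      zero_mem' := ae_of_all _ fun ω' => by rw [shift_zero]
      add_mem' := fun {x y} hx hy => by
        change ∀ᵐ ω' ∂P, φ (shift d (x + y) ω') = φ ω'
        filter_upwards [(hinv y).quasiMeasurePreserving.ae hx, hy] with ω' h1 h2
        rw [← shift_shift, h1, h2]
      neg_mem' := fun {x} hx => by
        change ∀ᵐ ω' ∂P, φ (shift d (-x) ω') = φ ω'
        filter_upwards [(hinv (-x)).quasiMeasurePreserving.ae hx] with ω' h1
        rw [shift_shift, add_neg_cancel, shift_zero] at h1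
        exact h1.symm }
  have hS : ∀ x, ∀ᵐ ω' ∂P, φ (shift d x ω') = φ ω' := fun x => by
    have hx : x = ∑ i, x i • unitv d i := by
      funext j
      simp [unitv, Finset.sum_apply]
    have : x ∈ S := by
      rw [hx]
      exact S.sum_mem fun i _ => S.zsmul_mem (h i) _
    exact this
  have hall : ∀ᵐ ω' ∂P, ∀ x, φ (shift d x ω') = φ ω' := ae_all_iff.2 hS
  refine exists_eventuallyEq_const_of_forall_separating (l := ae P) (f := φ) MeasurableSet
    fun U hU => ?_
  set A : Set (EnvSp d) := ⋂ x, shift d x ⁻¹' (φ ⁻¹' U) with hA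
  have hAm : MeasurableSet A :=
    MeasurableSet.iInter fun x => (continuous_shift x).measurable (hφ hU)
  have hAi : ∀ z, shift d z ⁻¹' A = A := fun z => by
    ext ω'
    simp only [hA, Set.mem_preimage, Set.mem_iInter, shift_shift]
    exact ⟨fun H x => by simpa using H (x - z), fun H x => H (x + z)⟩
  have hAe : ∀ᵐ ω' ∂P, (ω' ∈ A ↔ φ ω' ∈ U) := by
    filter_upwards [hall] with ω' h1
    simp only [hA, Set.mem_preimage, Set.mem_iInter, h1, forall_const]
  rcases herg A hAm hAi with h0 | h1
  · right
    filter_upwards [hAe, measure_eq_zero_iff_ae_notMem.1 h0] with ω' h1 h2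
    rwa [← h1]
  · left
    filter_upwards [hAe, (mem_ae_iff_prob_eq_one hAm).2 h1] with ω' h1 h2
    exact h1.1 h2

lemma integrable_mul_mul_of_sq {X : Type*} [MeasurableSpace X] {P : Measure X} {w a b : X → ℝ}
    (hw : ∀ x, 0 ≤ w x) (hwm : Measurable w) (ham : Measurable a) (hbm : Measurable b)
    (ha : Integrable (fun x => w x * a x ^ 2) P) (hb : Integrable (fun x => w x * b x ^ 2) P) :
    Integrable (fun x => w x * (a x * b x)) P := by
  refine (ha.add hb).mono' (hwm.mul (ham.mul hbm)).aestronglyMeasurable (ae_of_all _ fun x => ?_)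
  simp only [Pi.add_apply]
  rw [Real.norm_eq_abs, abs_mul, abs_of_nonneg (hw x), ← mul_add, abs_mul]
  refine mul_le_mul_of_nonneg_left ?_ (hw x)
  nlinarith [sq_nonneg (|a x| - |b x|), sq_abs (a x), sq_abs (b x), sq_nonneg (a x),
    sq_nonneg (b x)]

/-- The averaging operator acting on functions of the environment. -/
def envAvg (d : ℕ) (g : EnvSp d → ℝ) (ω : EnvSp d) : ℝ :=
  avgOp d ω (fun x => g (shift d x ω)) 0

lemma avgOp_shift {d : ℕ} (g : EnvSp d → ℝ) (x : Vert d) (ω : EnvSp d) :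
    envAvg d g (shift d x ω) = avgOp d ω (fun y => g (shift d y ω)) x := by
  simp only [envAvg, avgOp, piOf_shift, shift_shift, zero_add]
  congr 1
  refine Finset.sum_congr rfl fun i _ => ?_
  have h1 : (shift d x ω).1 (0, i) = ω.1 (x, i) := by simp [shift]
  have h2 : (shift d x ω).1 (0 - unitv d i, i) = ω.1 (x - unitv d i, i) := by
    simp [shift, sub_eq_add_neg, add_comm]
  rw [h1, h2, add_comm (unitv d i) x, zero_sub, neg_add_eq_sub]

lemma continuous_envAvg {d : ℕ} (hd : 1 ≤ d) {g : EnvSp d → ℝ} (hg : Continuous g) :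
    Continuous (envAvg d g) := by
  refine Continuous.div (continuous_finsetSum _ fun i _ => ?_) (continuous_piOf 0)
    fun ω => (piOf_pos hd ω 0).ne'
  exact ((continuous_coord _).mul (hg.comp (continuous_shift _))).add
    ((continuous_coord _).mul (hg.comp (continuous_shift _)))

lemma abs_envAvg_le {d : ℕ} (hd : 1 ≤ d) {g : EnvSp d → ℝ} {M : ℝ} (hg : ∀ ω, |g ω| ≤ M)
    (ω : EnvSp d) : |envAvg d g ω| ≤ M :=
  abs_avgOp_le hd ω (fun _ => hg _) 0

lemma envAvg_add {d : ℕ} (g g' : EnvSp d → ℝ) (ω : EnvSp d) :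
    envAvg d (fun ω => g ω + g' ω) ω = envAvg d g ω + envAvg d g' ω := by
  simp only [envAvg, avgOp, ← add_div, ← Finset.sum_add_distrib]
  congr 1
  exact Finset.sum_congr rfl fun i _ => by ring

lemma envAvg_const_mul {d : ℕ} (c : ℝ) (g : EnvSp d → ℝ) (ω : EnvSp d) :
    envAvg d (fun ω => c * g ω) ω = c * envAvg d g ω := by
  simp only [envAvg, avgOp, ← mul_div_assoc, Finset.mul_sum]
  congr 1
  exact Finset.sum_congr rfl fun i _ => by ring

section form

variable {d : ℕ} {P : Measure (EnvSp d)}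

lemma coord_le_piOf (i : Fin d) (ω : EnvSp d) :
    ω.1 (0, i) ≤ piOf d ω 0 ∧ ω.1 (0 - unitv d i, i) ≤ piOf d ω 0 := by
  have h := Finset.single_le_sum (f := fun i => ω.1 (0, i) + ω.1 (0 - unitv d i, i))
    (fun i _ => (add_pos (ω.2 _) (ω.2 _)).le) (Finset.mem_univ i)
  have h1 := ω.2 (0, i)
  have h2 := ω.2 (0 - unitv d i, i)
  rw [piOf]
  exact ⟨by linarith, by linarith⟩

lemma integrable_coord_mul_sq {φ : EnvSp d → ℝ} (hφ : Measurable φ)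
    (h : Integrable (fun ω => φ ω ^ 2 * piOf d ω 0) P) (i : Fin d) :
    Integrable (fun ω => ω.1 (0, i) * φ ω ^ 2) P ∧
      Integrable (fun ω => ω.1 (0 - unitv d i, i) * φ ω ^ 2) P := by
  constructor <;>
  · refine h.mono' ((continuous_coord _).measurable.mul (hφ.pow_const 2)).aestronglyMeasurable
      (ae_of_all _ fun ω => ?_)
    rw [Real.norm_eq_abs, abs_of_nonneg (mul_nonneg (ω.2 _).le (sq_nonneg _)), mul_comm]
    exact mul_le_mul_of_nonneg_left (by first | exact (coord_le_piOf i ω).1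
                                              | exact (coord_le_piOf i ω).2) (sq_nonneg _)

lemma coord_shift_unitv (i : Fin d) (ω : EnvSp d) :
    (shift d (unitv d i) ω).1 (0 - unitv d i, i) = ω.1 (0, i) := by
  simp [shift]

lemma integrable_coord_mul_sq_shift (hinv : ∀ z, MeasurePreserving (shift d z) P P)
    {φ : EnvSp d → ℝ} (hφ : Measurable φ)
    (h : Integrable (fun ω => φ ω ^ 2 * piOf d ω 0) P) (i : Fin d) :
    Integrable (fun ω => ω.1 (0, i) * φ (shift d (unitv d i) ω) ^ 2) P := by
  have := (hinv (unitv d i)).integrable_comp_of_integrable (integrable_coord_mul_sq hφ h i).2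
  refine this.congr (ae_of_all _ fun ω => ?_)
  simp only [Function.comp, coord_shift_unitv]

/-- The Dirichlet form of the environment process. -/
def envForm (P : Measure (EnvSp d)) (φ ψ : EnvSp d → ℝ) : ℝ :=
  ∑ i, ∫ ω, ω.1 (0, i) * ((φ (shift d (unitv d i) ω) - φ ω) *
    (ψ (shift d (unitv d i) ω) - ψ ω)) ∂P

lemma measurable_grad {φ : EnvSp d → ℝ} (hφ : Measurable φ) (i : Fin d) :
    Measurable fun ω => φ (shift d (unitv d i) ω) - φ ω :=
  (hφ.comp (continuous_shift _).measurable).sub hφ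

lemma integrable_coord_mul_grad_sq
    (hinv : ∀ z, MeasurePreserving (shift d z) P P) {φ : EnvSp d → ℝ} (hφ : Measurable φ)
    (h : Integrable (fun ω => φ ω ^ 2 * piOf d ω 0) P) (i : Fin d) :
    Integrable (fun ω => ω.1 (0, i) * (φ (shift d (unitv d i) ω) - φ ω) ^ 2) P := by
  refine (((integrable_coord_mul_sq_shift hinv hφ h i).add
    (integrable_coord_mul_sq hφ h i).1).const_mul 2).mono'
    ((continuous_coord _).measurable.mul ((measurable_grad hφ i).pow_const 2)).aestronglyMeasurable
    (ae_of_all _ fun ω => ?_)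
  rw [Real.norm_eq_abs, abs_of_nonneg (mul_nonneg (ω.2 _).le (sq_nonneg _))]
  simp only [Pi.add_apply]
  nlinarith [mul_nonneg (ω.2 (0, i)).le (sq_nonneg (φ (shift d (unitv d i) ω) + φ ω))]

lemma integrable_coord_mul_grad
    (hinv : ∀ z, MeasurePreserving (shift d z) P P) {φ ψ : EnvSp d → ℝ} (hφ : Measurable φ)
    (h : Integrable (fun ω => φ ω ^ 2 * piOf d ω 0) P) (hψ : Measurable ψ)
    (h' : Integrable (fun ω => ψ ω ^ 2 * piOf d ω 0) P) (i : Fin d) :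
    Integrable (fun ω => ω.1 (0, i) * ((φ (shift d (unitv d i) ω) - φ ω) *
      (ψ (shift d (unitv d i) ω) - ψ ω))) P :=
  integrable_mul_mul_of_sq (fun ω => (ω.2 _).le) (continuous_coord _).measurable
    (measurable_grad hφ i) (measurable_grad hψ i)
    (integrable_coord_mul_grad_sq hinv hφ h i) (integrable_coord_mul_grad_sq hinv hψ h' i)

lemma envForm_self_nonneg (φ : EnvSp d → ℝ) (i : Fin d) :
    0 ≤ ∫ ω, ω.1 (0, i) * ((φ (shift d (unitv d i) ω) - φ ω) *
      (φ (shift d (unitv d i) ω) - φ ω)) ∂P :=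
  integral_nonneg fun ω => mul_nonneg (ω.2 _).le (mul_self_nonneg _)

lemma envForm_self_le (hinv : ∀ z, MeasurePreserving (shift d z) P P)
    {φ : EnvSp d → ℝ} (hφ : Measurable φ)
    (h : Integrable (fun ω => φ ω ^ 2 * piOf d ω 0) P) :
    envForm P φ φ ≤ 2 * ∫ ω, φ ω ^ 2 * piOf d ω 0 ∂P := by
  have h1 : ∫ ω, φ ω ^ 2 * piOf d ω 0 ∂P = ∑ i, (∫ ω, ω.1 (0, i) * φ ω ^ 2 ∂P +
      ∫ ω, ω.1 (0 - unitv d i, i) * φ ω ^ 2 ∂P) := by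
    simp only [piOf, Finset.mul_sum]
    rw [integral_finsetSum]
    · refine Finset.sum_congr rfl fun i _ => ?_
      rw [← integral_add (integrable_coord_mul_sq hφ h i).1
        (integrable_coord_mul_sq hφ h i).2]
      exact integral_congr_ae (ae_of_all _ fun ω => by ring)
    · intro i _
      refine ((integrable_coord_mul_sq hφ h i).1.add
        (integrable_coord_mul_sq hφ h i).2).congr (ae_of_all _ fun ω => ?_)
      simp only [Pi.add_apply]
      ring
  rw [h1, envForm, Finset.mul_sum]
  refine Finset.sum_le_sum fun i _ => ?_
  have h2 : ∫ ω, ω.1 (0 - unitv d i, i) * φ ω ^ 2 ∂P =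
      ∫ ω, ω.1 (0, i) * φ (shift d (unitv d i) ω) ^ 2 ∂P := by
    have hm : AEStronglyMeasurable (fun ω : EnvSp d => ω.1 (0 - unitv d i, i) * φ ω ^ 2) P :=
      ((continuous_coord _).measurable.mul (hφ.pow_const 2)).aestronglyMeasurable
    rw [← (hinv (unitv d i)).map_eq] at hm
    conv_lhs => rw [← (hinv (unitv d i)).map_eq]
    rw [integral_map (continuous_shift _).aemeasurable hm]
    simp only [coord_shift_unitv]
  have i1 := (integrable_coord_mul_sq hφ h i).1
  have i2 := integrable_coord_mul_sq_shift hinv hφ h i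
  rw [h2, ← integral_add i1 i2, ← integral_const_mul]
  refine integral_mono (integrable_coord_mul_grad hinv hφ h hφ h i)
    ((i1.add i2).const_mul 2) fun ω => ?_
  simp only
  nlinarith [mul_nonneg (ω.2 (0, i)).le (sq_nonneg (φ (shift d (unitv d i) ω) + φ ω))]

lemma integrable_sq_mul_piOf_of_bdd (hd : 1 ≤ d) (hπ : Integrable (fun ω => piOf d ω 0) P)
    {g : EnvSp d → ℝ} (hg : Measurable g) (hb : IsBdd d g) :
    Integrable (fun ω => g ω ^ 2 * piOf d ω 0) P := by
  obtain ⟨M, hM⟩ := hb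
  refine (hπ.const_mul (M ^ 2)).mono'
    ((hg.pow_const 2).mul (continuous_piOf 0).measurable).aestronglyMeasurable
    (ae_of_all _ fun ω => ?_)
  rw [Real.norm_eq_abs, abs_of_nonneg (mul_nonneg (sq_nonneg _) (piOf_pos hd ω 0).le)]
  refine mul_le_mul_of_nonneg_right ?_ (piOf_pos hd ω 0).le
  rw [← sq_abs]
  exact pow_le_pow_left₀ (abs_nonneg _) (hM ω) 2

lemma integral_sub_envAvg_mul (hd : 1 ≤ d) (hinv : ∀ z, MeasurePreserving (shift d z) P P)
    (hπ : Integrable (fun ω => piOf d ω 0) P)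
    {φ g : EnvSp d → ℝ} (hφ : Measurable φ)
    (h : Integrable (fun ω => φ ω ^ 2 * piOf d ω 0) P) (hg : Measurable g) (hb : IsBdd d g) :
    ∫ ω, (g ω - envAvg d g ω) * φ ω * piOf d ω 0 ∂P = envForm P φ g := by
  have hpt : ∀ ω, (g ω - envAvg d g ω) * φ ω * piOf d ω 0 =
      ∑ i, (ω.1 (0, i) * (φ ω * (g ω - g (shift d (unitv d i) ω))) +
        ω.1 (0 - unitv d i, i) * (φ ω * (g ω - g (shift d (0 - unitv d i) ω)))) := fun ω => by
    have h1 : envAvg d g ω * piOf d ω 0 = _ :=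
      (mul_comm _ _).trans (piOf_mul_avgOp hd ω (fun x => g (shift d x ω)) 0)
    have h2 : (g ω - envAvg d g ω) * φ ω * piOf d ω 0 =
      g ω * φ ω * piOf d ω 0 - φ ω * (envAvg d g ω * piOf d ω 0) := by ring
    rw [h2, h1, piOf, Finset.mul_sum, Finset.mul_sum, ← Finset.sum_sub_distrib]
    refine Finset.sum_congr rfl fun i _ => ?_
    rw [zero_add]
    ring
  have hgs : ∀ z, Integrable (fun ω => (g ω - g (shift d z ω)) ^ 2 * piOf d ω 0) P := fun z => by
    obtain ⟨M, hM⟩ := hb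
    refine integrable_sq_mul_piOf_of_bdd hd hπ
      (hg.sub (hg.comp (continuous_shift z).measurable)) ⟨M + M, fun ω => ?_⟩
    exact (abs_sub _ _).trans (add_le_add (hM _) (hM _))
  have hgm : ∀ z, Measurable fun ω => g ω - g (shift d z ω) := fun z =>
    hg.sub (hg.comp (continuous_shift z).measurable)
  have i1 : ∀ i, Integrable (fun ω : EnvSp d =>
      ω.1 (0, i) * (φ ω * (g ω - g (shift d (unitv d i) ω)))) P := fun i =>
    integrable_mul_mul_of_sq (fun ω => (ω.2 _).le) (continuous_coord _).measurable hφ (hgm _)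
      (integrable_coord_mul_sq hφ h i).1
      (integrable_coord_mul_sq (hgm _) (hgs _) i).1
  have i2 : ∀ i, Integrable (fun ω : EnvSp d =>
      ω.1 (0 - unitv d i, i) * (φ ω * (g ω - g (shift d (0 - unitv d i) ω)))) P := fun i =>
    integrable_mul_mul_of_sq (fun ω => (ω.2 _).le) (continuous_coord _).measurable hφ (hgm _)
      (integrable_coord_mul_sq hφ h i).2
      (integrable_coord_mul_sq (hgm _) (hgs _) i).2
  simp only [hpt]
  rw [integral_finsetSum]
  swap
  · exact fun i _ => (i1 i).add (i2 i)
  rw [envForm]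
  refine Finset.sum_congr rfl fun i _ => ?_
  have hm := (i2 i).aestronglyMeasurable
  have i3 := (hinv (unitv d i)).integrable_comp_of_integrable (i2 i)
  rw [integral_add (i1 i) (i2 i)]
  rw [← (hinv (unitv d i)).map_eq] at hm
  have e2 : ∫ ω, ω.1 (0 - unitv d i, i) * (φ ω * (g ω - g (shift d (0 - unitv d i) ω))) ∂P =
      ∫ ω, ω.1 (0, i) * (φ (shift d (unitv d i) ω) * (g (shift d (unitv d i) ω) - g ω)) ∂P := by
    conv_lhs => rw [← (hinv (unitv d i)).map_eq]
    rw [integral_map (continuous_shift _).aemeasurable hm]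
    simp only [coord_shift_unitv, shift_shift, sub_add_cancel, shift_zero]
  simp only [Function.comp_def, coord_shift_unitv, shift_shift, sub_add_cancel, shift_zero] at i3
  rw [e2, ← integral_add (i1 i) i3]
  exact integral_congr_ae (ae_of_all _ fun ω => by ring)

end form

lemma integral_sq_le_of_eLpNorm_le {X : Type*} [MeasurableSpace X] {Q : Measure X} {u : X → ℝ}
    (hu : MemLp u 2 Q) {δ : ℝ} (hδ : 0 ≤ δ) (h : eLpNorm u 2 Q ≤ ENNReal.ofReal δ) :
    ∫ x, u x ^ 2 ∂Q ≤ δ ^ 2 := by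
  rw [hu.eLpNorm_eq_integral_rpow_norm (by simp) (by simp), ENNReal.ofReal_le_ofReal_iff hδ] at h
  have h0 : 0 ≤ ∫ x, u x ^ 2 ∂Q := integral_nonneg fun x => sq_nonneg _
  simp only [ENNReal.toReal_ofNat, Real.rpow_ofNat, Real.norm_eq_abs, sq_abs] at h
  have h1 := pow_le_pow_left₀ (Real.rpow_nonneg h0 _) h 2
  rwa [← Real.rpow_natCast, ← Real.rpow_mul h0, Nat.cast_ofNat, inv_mul_cancel₀ two_ne_zero,
    Real.rpow_one] at h1

lemma abs_integral_le_of_integral_sq_le {X : Type*} [MeasurableSpace X] {Q : Measure X}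
    [IsProbabilityMeasure Q] {u : X → ℝ} (hu : Integrable u Q)
    (hu2 : Integrable (fun x => u x ^ 2) Q) {δ : ℝ} (hδ : 0 ≤ δ)
    (h : ∫ x, u x ^ 2 ∂Q ≤ δ ^ 2) : |∫ x, u x ∂Q| ≤ δ := by
  set a := ∫ x, u x ∂Q with ha
  have h1 : 0 ≤ ∫ x, (u x ^ 2 - 2 * a * u x + a ^ 2) ∂Q :=
    integral_nonneg fun x => by
      have := sq_nonneg (u x - a)
      simp only [Pi.zero_apply]
      linarith
  have h2 : Integrable (fun x => u x ^ 2 - 2 * a * u x) Q := hu2.sub (hu.const_mul _)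
  rw [integral_add h2 (integrable_const _), integral_sub hu2 (hu.const_mul _),
    integral_const_mul, ← ha] at h1
  simp only [integral_const, probReal_univ, smul_eq_mul, one_mul] at h1
  exact abs_le_of_sq_le_sq (by nlinarith) hδ

section form

variable {d : ℕ} {P : Measure (EnvSp d)}

lemma integrable_sub_sq_mul_piOf {φ g : EnvSp d → ℝ} (hd : 1 ≤ d)
    (hφ : Measurable φ) (h : Integrable (fun ω => φ ω ^ 2 * piOf d ω 0) P) (hg : Measurable g)
    (h' : Integrable (fun ω => g ω ^ 2 * piOf d ω 0) P) :
    Integrable (fun ω => (φ ω - g ω) ^ 2 * piOf d ω 0) P := by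
  refine ((h.add h').const_mul 2).mono' (((hφ.sub hg).pow_const 2).mul
    (continuous_piOf 0).measurable).aestronglyMeasurable (ae_of_all _ fun ω => ?_)
  have hp := piOf_pos hd ω 0
  rw [Real.norm_eq_abs, abs_of_nonneg (mul_nonneg (sq_nonneg _) hp.le)]
  simp only [Pi.add_apply]
  nlinarith [mul_nonneg hp.le (sq_nonneg (φ ω + g ω))]

lemma envForm_sub_self (hinv : ∀ z, MeasurePreserving (shift d z) P P) {φ g : EnvSp d → ℝ}
    (hφ : Measurable φ) (h : Integrable (fun ω => φ ω ^ 2 * piOf d ω 0) P) (hg : Measurable g)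
    (h' : Integrable (fun ω => g ω ^ 2 * piOf d ω 0) P) :
    envForm P (fun ω => φ ω - g ω) (fun ω => φ ω - g ω) =
      envForm P φ φ - 2 * envForm P φ g + envForm P g g := by
  simp only [envForm, Finset.mul_sum, ← Finset.sum_sub_distrib, ← Finset.sum_add_distrib]
  refine Finset.sum_congr rfl fun i _ => ?_
  have i1 := integrable_coord_mul_grad hinv hφ h hφ h i
  have i2 := integrable_coord_mul_grad hinv hφ h hg h' i
  have i3 := integrable_coord_mul_grad hinv hg h' hg h' i
  have i4 := i1.sub (i2.const_mul 2)
  simp only [Pi.sub_def] at i4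
  rw [← integral_const_mul, ← integral_sub i1 (i2.const_mul 2), ← integral_add i4 i3]
  exact integral_congr_ae (ae_of_all _ fun ω => by ring)

lemma exists_continuous_approx (hd : 1 ≤ d) [IsProbabilityMeasure P]
    (hπ : Integrable (fun ω => piOf d ω 0) P) {φ : EnvSp d → ℝ} (hφ : Measurable φ)
    (h : Integrable (fun ω => φ ω ^ 2 * piOf d ω 0) P) {ε : ℝ} (hε : 0 < ε) :
    ∃ g : EnvSp d → ℝ, Continuous g ∧ IsBdd d g ∧
      ∫ ω, (φ ω - g ω) ^ 2 * piOf d ω 0 ∂P ≤ ε := by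
  have hm := integral_piOf_pos hd hπ
  have := isProbabilityMeasure_Qmeas hd hπ
  have hL : MemLp φ 2 (Qmeas d P) :=
    (memLp_two_iff_integrable_sq hφ.aestronglyMeasurable).2 ((integrable_Qmeas_iff hd hπ).2 h)
  set m := ∫ ω, piOf d ω 0 ∂P
  have hδ : 0 < √(ε / m) := Real.sqrt_pos.2 (div_pos hε hm)
  obtain ⟨g, hg, hgL⟩ := hL.exists_boundedContinuous_eLpNorm_sub_le (by simp)
    (ENNReal.ofReal_pos.2 hδ).ne'
  refine ⟨g, g.continuous, ⟨‖g‖, fun ω => g.norm_coe_le_norm ω⟩, ?_⟩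
  have h1 := integral_sq_le_of_eLpNorm_le (hL.sub hgL) hδ.le hg
  rw [integral_Qmeas hd, Real.sq_sqrt (div_pos hε hm).le, div_le_div_iff_of_pos_right hm] at h1
  exact h1

/-- A square-integrable function orthogonal to all coboundaries is constant. -/
lemma ae_const_of_orthogonal (hd : 1 ≤ d) [IsProbabilityMeasure P]
    (hinv : ∀ z, MeasurePreserving (shift d z) P P) (herg : ErgodicEnv d P)
    (hπ : Integrable (fun ω => piOf d ω 0) P) {φ : EnvSp d → ℝ} (hφ : Measurable φ)
    (h : Integrable (fun ω => φ ω ^ 2 * piOf d ω 0) P)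
    (horth : ∀ g : EnvSp d → ℝ, Continuous g → IsBdd d g →
      ∫ ω, (g ω - envAvg d g ω) * φ ω * piOf d ω 0 ∂P = 0) :
    ∃ c : ℝ, ∀ᵐ ω ∂P, φ ω = c := by
  refine ae_const_of_shift_invariant hinv herg hφ fun i => ?_
  have hE : envForm P φ φ ≤ 0 := by
    refine le_of_forall_pos_le_add fun ε hε => ?_
    obtain ⟨g, hgc, hgb, hg⟩ := exists_continuous_approx hd hπ hφ h (half_pos hε)
    have hgm := hgc.measurable
    have h' := integrable_sq_mul_piOf_of_bdd hd hπ hgm hgb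
    have h0 : envForm P φ g = 0 := by
      rw [← integral_sub_envAvg_mul hd hinv hπ hφ h hgm hgb, horth g hgc hgb]
    have h1 := envForm_sub_self hinv hφ h hgm h'
    have h2 := envForm_self_le hinv (hφ.sub hgm)
      (integrable_sub_sq_mul_piOf hd hφ h hgm h')
    have h3 : 0 ≤ envForm P g g := Finset.sum_nonneg fun i _ => envForm_self_nonneg g i
    simp only [Pi.sub_def] at h2
    linarith
  have h0 : ∫ ω, ω.1 (0, i) * ((φ (shift d (unitv d i) ω) - φ ω) *
      (φ (shift d (unitv d i) ω) - φ ω)) ∂P = 0 := by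
    have hz := (Finset.sum_eq_zero_iff_of_nonneg fun i _ => envForm_self_nonneg φ i).1
      (le_antisymm hE (Finset.sum_nonneg fun i _ => envForm_self_nonneg φ i))
    exact hz i (Finset.mem_univ i)
  rw [integral_eq_zero_iff_of_nonneg
    (fun ω => mul_nonneg (ω.2 _).le (mul_self_nonneg _))
    (integrable_coord_mul_grad hinv hφ h hφ h i)] at h0
  filter_upwards [h0] with ω hω
  have := (mul_eq_zero.1 hω).resolve_left (ω.2 _).ne'
  exact sub_eq_zero.1 (mul_self_eq_zero.1 this)

lemma isBdd_sub_envAvg (hd : 1 ≤ d) {g : EnvSp d → ℝ} (hb : IsBdd d g) (c : ℝ) :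
    IsBdd d fun ω => c + (g ω - envAvg d g ω) := by
  obtain ⟨M, hM⟩ := hb
  refine ⟨|c| + (M + M), fun ω => ?_⟩
  exact (abs_add_le _ _).trans (add_le_add le_rfl
    ((abs_sub _ _).trans (add_le_add (hM ω) (abs_envAvg_le hd hM ω))))

lemma integral_sub_envAvg_Qmeas (hd : 1 ≤ d) [IsProbabilityMeasure P]
    (hinv : ∀ z, MeasurePreserving (shift d z) P P)
    (hπ : Integrable (fun ω => piOf d ω 0) P) {g : EnvSp d → ℝ} (hg : Continuous g)
    (hb : IsBdd d g) : ∫ ω, (g ω - envAvg d g ω) ∂(Qmeas d P) = 0 := by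
  have h1 := integral_sub_envAvg_mul hd hinv hπ (φ := fun _ => 1) measurable_const
    (by simpa using hπ) hg.measurable hb
  simp only [envForm, sub_self, zero_mul, mul_zero, integral_zero, Finset.sum_const_zero,
    mul_one] at h1
  rw [integral_Qmeas hd, h1, zero_div]

/-- Bounded continuous functions are `L²`-close to a constant plus a coboundary. -/
lemma exists_coboundary_approx (hd : 1 ≤ d) [IsProbabilityMeasure P]
    (hinv : ∀ z, MeasurePreserving (shift d z) P P) (herg : ErgodicEnv d P)
    (hπ : Integrable (fun ω => piOf d ω 0) P) {F : EnvSp d → ℝ} (hF : Continuous F)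
    (hFb : IsBdd d F) {δ : ℝ} (hδ : 0 < δ) :
    ∃ (c : ℝ) (g : EnvSp d → ℝ), Continuous g ∧ IsBdd d g ∧
      ∫ ω, (F ω - (c + (g ω - envAvg d g ω))) ^ 2 ∂(Qmeas d P) ≤ δ ^ 2 ∧
      |∫ ω, F ω ∂(Qmeas d P) - c| ≤ δ := by
  have hQ := isProbabilityMeasure_Qmeas hd hπ
  set Q := Qmeas d P with hQdef
  have hcont : ∀ (c : ℝ) {g : EnvSp d → ℝ}, Continuous g →
      Continuous fun ω => c + (g ω - envAvg d g ω) := fun c g hg =>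
    continuous_const.add (hg.sub (continuous_envAvg hd hg))
  have hLp : ∀ {u : EnvSp d → ℝ}, Continuous u → IsBdd d u → MemLp u 2 Q := fun hu hb => by
    obtain ⟨M, hM⟩ := hb
    exact MemLp.of_bound hu.measurable.aestronglyMeasurable M (ae_of_all _ hM)
  let K : Submodule ℝ (Lp ℝ 2 Q) :=
    { carrier := {u | ∃ (c : ℝ) (g : EnvSp d → ℝ), Continuous g ∧ IsBdd d g ∧
        ∀ᵐ ω ∂Q, u ω = c + (g ω - envAvg d g ω)}
      zero_mem' := ⟨0, fun _ => 0, continuous_const, ⟨0, fun _ => by simp⟩, by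
        filter_upwards [Lp.coeFn_zero ℝ 2 Q] with ω hω
        rw [hω, envAvg, avgOp_const hd]
        simp⟩
      add_mem' := by
        rintro u v ⟨c, g, hg, ⟨M, hM⟩, hu⟩ ⟨c', g', hg', ⟨M', hM'⟩, hv⟩
        refine ⟨c + c', fun ω => g ω + g' ω, hg.add hg', ⟨M + M', fun ω =>
          (abs_add_le _ _).trans (add_le_add (hM ω) (hM' ω))⟩, ?_⟩
        filter_upwards [Lp.coeFn_add u v, hu, hv] with ω h1 h2 h3
        rw [h1, Pi.add_apply, h2, h3, envAvg_add]
        ring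
      smul_mem' := by
        rintro a u ⟨c, g, hg, ⟨M, hM⟩, hu⟩
        refine ⟨a * c, fun ω => a * g ω, continuous_const.mul hg, ⟨|a| * M, fun ω => ?_⟩, ?_⟩
        · rw [abs_mul]
          exact mul_le_mul_of_nonneg_left (hM ω) (abs_nonneg a)
        filter_upwards [Lp.coeFn_smul a u, hu] with ω h1 h2
        rw [h1, Pi.smul_apply, h2, envAvg_const_mul, smul_eq_mul]
        ring }
  have horth : Kᗮ = ⊥ := by
    rw [Submodule.eq_bot_iff]
    intro φ hφK
    have hφm : Measurable φ := (Lp.stronglyMeasurable φ).measurable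
    have hφ2 := (integrable_Qmeas_iff hd hπ).1 (Lp.memLp φ).integrable_sq
    have hzero : ∀ (c : ℝ) (g : EnvSp d → ℝ), Continuous g → IsBdd d g →
        ∫ ω, (c + (g ω - envAvg d g ω)) * φ ω ∂Q = 0 := fun c g hg hgb => by
      have hmem := hLp (hcont c hg) (isBdd_sub_envAvg hd hgb c)
      have := (Submodule.mem_orthogonal K φ).1 hφK (hmem.toLp _) ⟨c, g, hg, hgb, hmem.coeFn_toLp⟩
      rw [L2.inner_def] at this
      refine Eq.trans (integral_congr_ae ?_) this
      filter_upwards [hmem.coeFn_toLp] with ω hω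
      rw [hω]
      simp [mul_comm]
    obtain ⟨c, hc⟩ := ae_const_of_orthogonal hd hinv herg hπ hφm hφ2 fun g hg hgb => by
      have := hzero 0 g hg hgb
      rw [integral_Qmeas hd, div_eq_zero_iff] at this
      simpa only [zero_add] using this.resolve_right (integral_piOf_pos hd hπ).ne'
    have hcQ : ∀ᵐ ω ∂Q, φ ω = c := (ae_Qmeas_iff hd hπ).2 hc
    have h1 := hzero 1 (fun _ => 0) continuous_const ⟨0, fun _ => by simp⟩
    have h2 : ∫ ω, (1 + ((fun _ => (0 : ℝ)) ω - envAvg d (fun _ => 0) ω)) * φ ω ∂Q =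
        ∫ _ω, c ∂Q := by
      refine integral_congr_ae (hcQ.mono fun ω hω => ?_)
      simp only [envAvg, avgOp_const hd, hω]
      ring
    rw [h1, integral_const, probReal_univ, one_smul] at h2
    rw [Lp.eq_zero_iff_ae_eq_zero]
    filter_upwards [hcQ] with ω hω
    rw [hω, ← h2, Pi.zero_apply]
  have hdense : Dense (K : Set (Lp ℝ 2 Q)) := by
    rw [Submodule.dense_iff_topologicalClosure_eq_top, Submodule.topologicalClosure_eq_top_iff,
      horth]
  obtain ⟨u, hdist, c, g, hg, hgb, hu⟩ :=
    Metric.dense_iff.1 hdense ((hLp hF hFb).toLp F) δ hδ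
  have hD : Continuous fun ω => F ω - (c + (g ω - envAvg d g ω)) := hF.sub (hcont c hg)
  have hDb : IsBdd d fun ω => F ω - (c + (g ω - envAvg d g ω)) := by
    obtain ⟨M, hM⟩ := hFb
    obtain ⟨M', hM'⟩ := isBdd_sub_envAvg hd hgb c
    exact ⟨M + M', fun ω => (abs_sub _ _).trans (add_le_add (hM ω) (hM' ω))⟩
  have hsq : ∫ ω, (F ω - (c + (g ω - envAvg d g ω))) ^ 2 ∂Q ≤ δ ^ 2 := by
    refine integral_sq_le_of_eLpNorm_le (hLp hD hDb) hδ.le ?_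
    have h1 : eLpNorm (fun ω => F ω - (c + (g ω - envAvg d g ω))) 2 Q =
        edist ((hLp hF hFb).toLp F) u := by
      rw [Lp.edist_def]
      refine eLpNorm_congr_ae ?_
      filter_upwards [(hLp hF hFb).coeFn_toLp, hu] with ω h2 h3
      rw [Pi.sub_apply, h2, h3]
    rw [h1, edist_dist, dist_comm]
    exact ENNReal.ofReal_le_ofReal (Metric.mem_ball.1 hdist).le
  refine ⟨c, g, hg, hgb, hsq, ?_⟩
  have iD : Integrable (fun ω => F ω - (c + (g ω - envAvg d g ω))) Q := integrable_of_isBdd hD hDb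
  have h2 := abs_integral_le_of_integral_sq_le iD ((hLp hD hDb).integrable_sq) hδ.le hsq
  have iF : Integrable F Q := integrable_of_isBdd hF hFb
  have ig : Integrable (fun ω => g ω - envAvg d g ω) Q := by
    simpa only [zero_add] using integrable_of_isBdd (hcont 0 hg) (isBdd_sub_envAvg hd hgb 0)
  have icg : Integrable (fun ω => c + (g ω - envAvg d g ω)) Q :=
    integrable_of_isBdd (hcont c hg) (isBdd_sub_envAvg hd hgb c)
  rwa [integral_sub iF icg, integral_add (integrable_const c) ig,
    integral_sub_envAvg_Qmeas hd hinv hπ hg hgb, integral_const, probReal_univ, one_smul,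
    add_zero] at h2

end form

/-! ### Averages along the walk -/

/-- Along the walk, a nonnegative function with small block averages has small time averages. -/
lemma exists_integral_abs_sum_walk_le {d : ℕ} (hd : 1 ≤ d) {p q : ℝ} (hp : 1 < p) (hq : 1 < q)
    (hpq : 2 ≤ d → 1 / p + 1 / q < 2 / (d : ℝ)) {ω : EnvSp d} (hmom : InOmegaPQ d p q ω)
    {μ : Measure (Path d)} (hμ : IsWalkLaw d ω 0 μ) (k : ℕ) {ε : ℝ} (hε : 0 < ε) :
    ∃ δ > 0, ∀ u g : Vert d → ℝ, (∀ x, |u x| ≤ g x) →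
      (∀ᶠ n : ℕ in atTop,
        ∑ x ∈ box d (n : ℝ), g x ^ cexp k * piOf d ω x ≤ δ * (n : ℝ) ^ d) →
      ∀ᶠ N : ℕ in atTop, ∫ w, |∑ n ∈ Finset.range N, u (w n)| ∂μ ≤ ε * N := by
  obtain ⟨C, hC, hocc⟩ := occupation hd hp hq hpq hmom k
  set η : ℝ := min 1 (ε / (4 * C)) with hη
  have hη0 : 0 < η := lt_min one_pos (by positivity)
  have hηC : C * η ^ (2 * k + 2) ≤ ε / 4 := by
    have h1 : η ^ (2 * k + 2) ≤ η := pow_le_of_le_one hη0.le (min_le_left _ _) (by omega)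
    have h2 : η ^ (2 * k + 2) ≤ ε / (4 * C) := h1.trans (min_le_right _ _)
    calc C * η ^ (2 * k + 2) ≤ C * (ε / (4 * C)) := mul_le_mul_of_nonneg_left h2 hC.le
      _ = ε / 4 := by field_simp
  have hr : 0 < η ^ (-cexp k) := Real.rpow_pos_of_pos hη0 _
  refine ⟨ε / (4 * C * η ^ (-cexp k)), by positivity, fun u g hug hg => ?_⟩
  have hg0 : ∀ x, 0 ≤ g x := fun x => (abs_nonneg _).trans (hug x)
  obtain ⟨C₀, hC₀⟩ := hocc g _ η hg0 (by positivity) hη0 hg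
  have hcoef : C * (η ^ (-cexp k) * (ε / (4 * C * η ^ (-cexp k))) + η ^ (2 * k + 2)) ≤ ε / 2 := by
    have : C * (η ^ (-cexp k) * (ε / (4 * C * η ^ (-cexp k)))) = ε / 4 := by field_simp
    rw [mul_add, this]
    linarith
  obtain ⟨N₀, hN₀⟩ := exists_nat_ge (2 * C₀ / ε)
  filter_upwards [eventually_ge_atTop N₀] with N hN
  have h1 : C₀ ≤ ε / 2 * N := by
    have : 2 * C₀ / ε ≤ N := hN₀.trans (by exact_mod_cast hN)
    rw [div_le_iff₀ hε] at this
    linarith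
  calc ∫ w, |∑ n ∈ Finset.range N, u (w n)| ∂μ
      ≤ ∫ w, ∑ n ∈ Finset.range N, g (w n) ∂μ := by
        refine integral_mono
          (integrable_finsetSum _ fun n _ => integrable_walk hd hμ n u).abs
          (integrable_finsetSum _ fun n _ => integrable_walk hd hμ n g) fun w => ?_
        exact (Finset.abs_sum_le_sum_abs _ _).trans (Finset.sum_le_sum fun n _ => hug _)
    _ = ∑ n ∈ Finset.range N, ∑' x, g x * hk d ω n x * piOf d ω x := by
        rw [integral_finsetSum _ fun n _ => integrable_walk hd hμ n g]
        exact Finset.sum_congr rfl fun n _ => integral_walk hd hμ n g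
    _ ≤ _ := hC₀ N
    _ ≤ ε / 2 * N + ε / 2 * N :=
        add_le_add h1 (mul_le_mul_of_nonneg_right hcoef N.cast_nonneg)
    _ = ε * N := by ring

lemma integrable_piOf {d : ℕ} (hd : 1 ≤ d) {p : ℝ} (hp : 1 < p) {ω : EnvSp d}
    {P : Measure (EnvSp d)} (hP : IsEnvLaw d ω P)
    (h : ∃ C : ℝ, ∀ n : ℕ, 1 ≤ n →
      (∑ e ∈ edgesIn d (box d (n : ℝ)), ω.1 e ^ p) / (n : ℝ) ^ d ≤ C) :
    Integrable (fun ω' => piOf d ω' 0) P := by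
  have := hP.1
  obtain ⟨C, -, hC⟩ := exists_sum_piOf_rpow_le hp.le h
  have hi : Integrable (fun ω' => piOf d ω' 0 ^ p) P :=
    hP.integrable_of_sum_le
      ((continuous_piOf 0).rpow_const fun ω' => Or.inl (piOf_pos hd ω' 0).ne')
      (fun ω' => Real.rpow_nonneg (piOf_pos hd ω' 0).le _) (C := C) fun n hn => by
        simpa only [piOf_shift, zero_add] using hC n hn
  refine ((integrable_const (1 : ℝ)).add hi).mono'
    (continuous_piOf 0).measurable.aestronglyMeasurable (ae_of_all _ fun ω' => ?_)
  have hpos := piOf_pos hd ω' 0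
  rw [Real.norm_eq_abs, abs_of_pos hpos, Pi.add_apply]
  rcases le_total (piOf d ω' 0) 1 with h1 | h1
  · linarith [Real.rpow_nonneg hpos.le p]
  · linarith [Real.self_le_rpow_of_one_le h1 hp.le]

/-- Block averages of a bounded continuous function weighted by `π`. -/
lemma eventually_sum_sq_mul_piOf_le {d : ℕ} (hd : 1 ≤ d) {p : ℝ} (hp : 1 < p) {ω : EnvSp d}
    {P : Measure (EnvSp d)} (hP : IsEnvLaw d ω P)
    (h : ∃ C : ℝ, ∀ n : ℕ, 1 ≤ n →
      (∑ e ∈ edgesIn d (box d (n : ℝ)), ω.1 e ^ p) / (n : ℝ) ^ d ≤ C)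
    {F : EnvSp d → ℝ} (hF : Continuous F) (hFb : IsBdd d F) {b : ℝ}
    (hb : ∫ ω', F ω' ^ 2 * piOf d ω' 0 ∂P < b) :
    ∀ᶠ n : ℕ in atTop, ∑ x ∈ box d (n : ℝ), F (shift d x ω) ^ 2 * piOf d ω x ≤
      b * 3 ^ d * (n : ℝ) ^ d := by
  have := hP.1
  have hπ := integrable_piOf hd hp hP h
  obtain ⟨C, hC0, hC⟩ := exists_sum_piOf_rpow_le hp.le h
  obtain ⟨B, hB⟩ := hFb
  set a := ∫ ω', F ω' ^ 2 * piOf d ω' 0 ∂P with ha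
  have ha0 : 0 ≤ a := integral_nonneg fun ω' => mul_nonneg (sq_nonneg _) (piOf_pos hd ω' 0).le
  -- truncation level for `π`
  have hlim : Tendsto (fun M : ℝ => B ^ 2 * C * M ^ (-(p - 1))) atTop (𝓝 (B ^ 2 * C * 0)) :=
    (tendsto_rpow_neg_atTop (sub_pos.2 hp)).const_mul _
  rw [mul_zero] at hlim
  obtain ⟨M, hMb, hM1⟩ :=
    ((hlim.eventually (gt_mem_nhds (half_pos (sub_pos.2 hb)))).and (eventually_ge_atTop 1)).exists
  have hM0 : 0 < M := one_pos.trans_le hM1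
  set φ : EnvSp d → ℝ := fun ω' => F ω' ^ 2 * min (piOf d ω' 0) M with hφ
  have hφc : Continuous φ := (hF.pow 2).mul ((continuous_piOf 0).min continuous_const)
  have hFB : ∀ ω', F ω' ^ 2 ≤ B ^ 2 := fun ω' => by
    rw [← sq_abs]
    exact pow_le_pow_left₀ (abs_nonneg _) (hB ω') 2
  have hmin : ∀ ω' : EnvSp d, 0 ≤ min (piOf d ω' 0) M := fun ω' =>
    le_min (piOf_pos hd ω' 0).le hM0.le
  have hφb : IsBdd d φ := ⟨B ^ 2 * M, fun ω' => by
    rw [abs_of_nonneg (mul_nonneg (sq_nonneg _) (hmin ω'))]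
    exact mul_le_mul (hFB ω') (min_le_right _ _) (hmin ω') (sq_nonneg _)⟩
  have hφa : ∫ ω', φ ω' ∂P < a + (b - a) / 2 := by
    have h1 : ∫ ω', φ ω' ∂P ≤ a :=
      integral_mono (integrable_of_isBdd hφc hφb)
        (integrable_sq_mul_piOf_of_bdd hd hπ hF.measurable ⟨B, hB⟩)
        fun ω' => mul_le_mul_of_nonneg_left (min_le_left _ _) (sq_nonneg _)
    linarith
  filter_upwards [hP.eventually_sum_le hφc hφb hφa, eventually_ge_atTop 1] with n hn hn1
  have hpt : ∀ x, F (shift d x ω) ^ 2 * piOf d ω x ≤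
      φ (shift d x ω) + B ^ 2 * M ^ (-(p - 1)) * piOf d ω x ^ p := fun x => by
    have hx := piOf_pos hd ω x
    simp only [hφ, piOf_shift, zero_add]
    have hnn : 0 ≤ B ^ 2 * M ^ (-(p - 1)) * piOf d ω x ^ p :=
      mul_nonneg (mul_nonneg (sq_nonneg _) (Real.rpow_nonneg hM0.le _)) (Real.rpow_nonneg hx.le _)
    rcases le_total (piOf d ω x) M with h1 | h1
    · rw [min_eq_left h1]
      linarith
    · have h2 : piOf d ω x ≤ M ^ (-(p - 1)) * piOf d ω x ^ p := by
        have h3 : piOf d ω x ^ (-(p - 1)) ≤ M ^ (-(p - 1)) :=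
          Real.rpow_le_rpow_of_nonpos hM0 h1 (by linarith)
        calc piOf d ω x = piOf d ω x ^ (-(p - 1)) * piOf d ω x ^ p := by
              rw [← Real.rpow_add hx, show -(p - 1) + p = 1 by ring, Real.rpow_one]
          _ ≤ _ := mul_le_mul_of_nonneg_right h3 (Real.rpow_nonneg hx.le _)
      have h4 : 0 ≤ F (shift d x ω) ^ 2 * min (piOf d ω x) M :=
        mul_nonneg (sq_nonneg _) (le_min hx.le hM0.le)
      have h5 : F (shift d x ω) ^ 2 * piOf d ω x ≤
          B ^ 2 * (M ^ (-(p - 1)) * piOf d ω x ^ p) :=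
        mul_le_mul (hFB _) h2 hx.le (sq_nonneg _)
      linarith
  have hnd : 0 ≤ (n : ℝ) ^ d := by positivity
  have h3d : (1 : ℝ) ≤ 3 ^ d := one_le_pow₀ (by norm_num)
  calc ∑ x ∈ box d (n : ℝ), F (shift d x ω) ^ 2 * piOf d ω x
      ≤ ∑ x ∈ box d (n : ℝ), φ (shift d x ω) +
          B ^ 2 * M ^ (-(p - 1)) * ∑ x ∈ box d (n : ℝ), piOf d ω x ^ p := by
        rw [Finset.mul_sum, ← Finset.sum_add_distrib]
        exact Finset.sum_le_sum fun x _ => hpt x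
    _ ≤ (a + (b - a) / 2) * (3 ^ d * (n : ℝ) ^ d) +
          B ^ 2 * M ^ (-(p - 1)) * (C * (n : ℝ) ^ d) := by
        refine add_le_add (hn.trans (mul_le_mul_of_nonneg_left (card_box_le d hn1)
          (by linarith))) (mul_le_mul_of_nonneg_left (hC n hn1)
          (mul_nonneg (sq_nonneg _) (Real.rpow_nonneg hM0.le _)))
    _ ≤ (a + (b - a) / 2) * (3 ^ d * (n : ℝ) ^ d) + (b - a) / 2 * (3 ^ d * (n : ℝ) ^ d) := by
        have h6 : (n : ℝ) ^ d ≤ 3 ^ d * (n : ℝ) ^ d := le_mul_of_one_le_left hnd h3d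
        have h7 : B ^ 2 * M ^ (-(p - 1)) * (C * (n : ℝ) ^ d) =
          B ^ 2 * C * M ^ (-(p - 1)) * (n : ℝ) ^ d := by ring
        rw [h7]
        exact add_le_add le_rfl (mul_le_mul hMb.le h6 hnd (by linarith))
    _ = b * 3 ^ d * (n : ℝ) ^ d := by ring

/-- Truncation of a real number to `[-M, M]`. -/
def clamp (M t : ℝ) : ℝ := max (-M) (min t M)

lemma continuous_clamp (M : ℝ) : Continuous (clamp M) :=
  continuous_const.max (continuous_id.min continuous_const)

lemma abs_clamp_le {M : ℝ} (hM : 0 ≤ M) (t : ℝ) : |clamp M t| ≤ M := by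
  rw [abs_le, clamp]
  exact ⟨le_max_left _ _, max_le (by linarith) (min_le_right _ _)⟩

lemma clamp_eq {M t : ℝ} (h : |t| ≤ M) : clamp M t = t := by
  rw [abs_le] at h
  rw [clamp, min_eq_left h.2, max_eq_right h.1]

lemma clamp_of_le {M t : ℝ} (hM : 0 ≤ M) (h : M ≤ |t|) :
    |clamp M t| ≤ |t| ∧ |t - clamp M t| ≤ |t| := by
  refine ⟨(abs_clamp_le hM t).trans h, ?_⟩
  rcases le_total 0 t with ht | ht
  · rw [abs_of_nonneg ht] at h ⊢
    rw [clamp, min_eq_right h, max_eq_right (by linarith), abs_of_nonneg (by linarith)]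
    linarith
  · rw [abs_of_nonpos ht] at h ⊢
    rw [clamp, max_eq_left ((min_le_left _ _).trans (by linarith)), abs_of_nonpos (by linarith)]
    linarith

lemma tendsto_integral_clamp {X : Type*} [MeasurableSpace X] {Q : Measure X} {f : X → ℝ}
    (hf : Measurable f) (hi : Integrable f Q) :
    Tendsto (fun M : ℕ => ∫ x, clamp M (f x) ∂Q) atTop (𝓝 (∫ x, f x ∂Q)) := by
  refine tendsto_integral_of_dominated_convergence (fun x => |f x|)
    (fun M => ((continuous_clamp M).measurable.comp hf).aestronglyMeasurable) hi.abs
    (fun M => ae_of_all _ fun x => ?_) (ae_of_all _ fun x => ?_)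
  · rw [Real.norm_eq_abs]
    rcases le_total |f x| M with h | h
    · rw [clamp_eq h]
    · exact (clamp_of_le M.cast_nonneg h).1
  · obtain ⟨M₀, hM₀⟩ := exists_nat_ge |f x|
    refine tendsto_const_nhds.congr' ?_
    filter_upwards [eventually_ge_atTop M₀] with M hM
    exact (clamp_eq (hM₀.trans (by exact_mod_cast hM))).symm

/-! ### The ergodic theorem along the walk -/

lemma integrable_Qmeas_of_dom {d : ℕ} (hd : 1 ≤ d) {ω : EnvSp d} {P : Measure (EnvSp d)}
    (hP : IsEnvLaw d ω P) (hπ : Integrable (fun ω' => piOf d ω' 0) P) {f h : EnvSp d → ℝ}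
    (hf : Continuous f) (hdom : ∀ ω', |f ω'| ≤ h ω') {α : ℝ} (hα : 1 < α) {C : ℝ}
    (hC : ∀ n : ℕ, 1 ≤ n →
      ∑ x ∈ box d (n : ℝ), h (shift d x ω) ^ α * piOf d ω x ≤ C * (n : ℝ) ^ d) :
    Integrable f (Qmeas d P) := by
  have := hP.1
  have hα0 : 0 < α := by linarith
  have hi : Integrable (fun ω' => |f ω'| ^ α * piOf d ω' 0) P :=
    hP.integrable_of_sum_le
      ((hf.abs.rpow_const fun _ => Or.inr hα0.le).mul (continuous_piOf 0))
      (fun ω' => mul_nonneg (Real.rpow_nonneg (abs_nonneg _) _) (piOf_pos hd ω' 0).le) (C := C)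
      fun n hn => by
        simp only [piOf_shift, zero_add]
        exact (Finset.sum_le_sum fun x _ => mul_le_mul_of_nonneg_right
          (Real.rpow_le_rpow (abs_nonneg _) (hdom _) hα0.le) (piOf_pos hd ω x).le).trans (hC n hn)
  refine (integrable_Qmeas_iff hd hπ).2 ((hπ.add hi).mono'
    (hf.mul (continuous_piOf 0)).measurable.aestronglyMeasurable (ae_of_all _ fun ω' => ?_))
  have hpos := piOf_pos hd ω' 0
  have h1 : |f ω'| ≤ 1 + |f ω'| ^ α := by
    have h0 := Real.rpow_nonneg (abs_nonneg (f ω')) α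
    rcases le_total |f ω'| 1 with h1 | h1
    · linarith
    · linarith [Real.self_le_rpow_of_one_le h1 hα.le]
  rw [Real.norm_eq_abs, abs_mul, abs_of_pos hpos, Pi.add_apply]
  calc |f ω'| * piOf d ω' 0 ≤ (1 + |f ω'| ^ α) * piOf d ω' 0 :=
        mul_le_mul_of_nonneg_right h1 hpos.le
    _ = _ := by ring

lemma ite_rpow_le {M t s α : ℝ} (hM : 0 < M) (ht : 0 ≤ t) (hs : 0 < s) (hsα : s ≤ α) :
    (if M < t then t else 0) ^ s ≤ M ^ (s - α) * t ^ α := by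
  split_ifs with h
  · have ht0 := hM.trans h
    calc t ^ s = t ^ (s - α) * t ^ α := by rw [← Real.rpow_add ht0, sub_add_cancel]
      _ ≤ _ := mul_le_mul_of_nonneg_right
        (Real.rpow_le_rpow_of_nonpos hM h.le (sub_nonpos.2 hsα)) (Real.rpow_nonneg ht _)
  · rw [Real.zero_rpow hs.ne']
    exact mul_nonneg (Real.rpow_nonneg hM.le _) (Real.rpow_nonneg ht _)

lemma exists_cexp_lt {α : ℝ} (hα : 1 < α) : ∃ k : ℕ, cexp k < α := by
  obtain ⟨k, hk⟩ := exists_nat_gt (1 / (α - 1))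
  refine ⟨k, ?_⟩
  have h0 : 0 < α - 1 := sub_pos.2 hα
  rw [div_lt_iff₀ h0] at hk
  have hk0 : (0 : ℝ) ≤ k := k.cast_nonneg
  rw [cexp, div_lt_iff₀ (by positivity)]
  nlinarith

/-- Along the walk, the tails of a dominated function are negligible in mean. -/
lemma eventually_exists_clamp {d : ℕ} (hd : 1 ≤ d) {p q : ℝ} (hp : 1 < p) (hq : 1 < q)
    (hpq : 2 ≤ d → 1 / p + 1 / q < 2 / (d : ℝ)) {ω : EnvSp d} (hmom : InOmegaPQ d p q ω)
    {μ : Measure (Path d)} (hμ : IsWalkLaw d ω 0 μ) {f h : EnvSp d → ℝ}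
    (hdom : ∀ ω', |f ω'| ≤ h ω') {α : ℝ} (hα : 1 < α) {C : ℝ}
    (hC : ∀ n : ℕ, 1 ≤ n →
      ∑ x ∈ box d (n : ℝ), h (shift d x ω) ^ α * piOf d ω x ≤ C * (n : ℝ) ^ d)
    {ε : ℝ} (hε : 0 < ε) :
    ∀ᶠ M : ℕ in atTop, ∀ᶠ N : ℕ in atTop,
      ∫ w, |∑ k ∈ Finset.range N,
        (f (shift d (w k) ω) - clamp M (f (shift d (w k) ω)))| ∂μ ≤ ε * N := by
  obtain ⟨k, hk⟩ := exists_cexp_lt hα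
  obtain ⟨δ, hδ, hδN⟩ := exists_integral_abs_sum_walk_le hd hp hq hpq hmom hμ k hε
  have hlim : Tendsto (fun M : ℕ => (M : ℝ) ^ (-(α - cexp k)) * C) atTop (𝓝 (0 * C)) :=
    ((tendsto_rpow_neg_atTop (sub_pos.2 hk)).comp tendsto_natCast_atTop_atTop).mul_const _
  rw [zero_mul] at hlim
  filter_upwards [hlim.eventually (gt_mem_nhds hδ), eventually_ge_atTop 1] with M hM hM1
  have hM0 : (0 : ℝ) < M := by exact_mod_cast hM1
  have hh : ∀ ω', 0 ≤ h ω' := fun ω' => (abs_nonneg _).trans (hdom ω')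
  refine hδN (fun x => f (shift d x ω) - clamp M (f (shift d x ω)))
    (fun x => if (M : ℝ) < h (shift d x ω) then h (shift d x ω) else 0) (fun x => ?_) ?_
  · rcases le_or_gt |f (shift d x ω)| M with h1 | h1
    · rw [clamp_eq h1, sub_self, abs_zero]
      split_ifs
      exacts [hh _, le_rfl]
    · rw [if_pos (h1.trans_le (hdom _))]
      exact (clamp_of_le hM0.le h1.le).2.trans (hdom _)
  · filter_upwards [eventually_ge_atTop 1] with n hn
    have hnd : 0 ≤ (n : ℝ) ^ d := by positivity
    calc _ ≤ ∑ x ∈ box d (n : ℝ), (M : ℝ) ^ (-(α - cexp k)) *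
          (h (shift d x ω) ^ α * piOf d ω x) := Finset.sum_le_sum fun x _ => by
            rw [← mul_assoc, neg_sub]
            exact mul_le_mul_of_nonneg_right (ite_rpow_le hM0 (hh _) (cexp_pos k) hk.le)
              (piOf_pos hd ω x).le
      _ ≤ (M : ℝ) ^ (-(α - cexp k)) * (C * (n : ℝ) ^ d) := by
          rw [← Finset.mul_sum]
          exact mul_le_mul_of_nonneg_left (hC n hn) (Real.rpow_nonneg hM0.le _)
      _ ≤ δ * (n : ℝ) ^ d := by
          rw [← mul_assoc]
          exact mul_le_mul_of_nonneg_right hM.le hnd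

/-- The ergodic theorem along the walk for bounded continuous functions. -/
lemma eventually_integral_abs_sum_sub_le {d : ℕ} (hd : 1 ≤ d) {p q : ℝ} (hp : 1 < p) (hq : 1 < q)
    (hpq : 2 ≤ d → 1 / p + 1 / q < 2 / (d : ℝ)) {ω : EnvSp d} (hmom : InOmegaPQ d p q ω)
    {μ : Measure (Path d)} (hμ : IsWalkLaw d ω 0 μ) {P : Measure (EnvSp d)}
    (hP : IsEnvLaw d ω P) (herg : ErgodicEnv d P) {F : EnvSp d → ℝ} (hF : Continuous F)
    (hFb : IsBdd d F) {ε : ℝ} (hε : 0 < ε) :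
    ∀ᶠ N : ℕ in atTop, ∫ w, |∑ k ∈ Finset.range N,
      (F (shift d (w k) ω) - ∫ ω', F ω' ∂(Qmeas d P))| ∂μ ≤ ε * N := by
  have := hP.1
  have := hμ.1
  have hπ := integrable_piOf hd hp hP hmom.1
  have hm := integral_piOf_pos hd hπ
  set m := ∫ ω', piOf d ω' 0 ∂P with hm_def
  set e := ∫ ω', F ω' ∂(Qmeas d P) with he_def
  have hε3 : 0 < ε / 3 := by positivity
  obtain ⟨δ, hδ, hδN⟩ := exists_integral_abs_sum_walk_le hd hp hq hpq hmom hμ 0 hε3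
  have hρ : 0 < min (ε / 3) (Real.sqrt (δ / (3 ^ d * (2 * m)))) :=
    lt_min hε3 (Real.sqrt_pos.2 (by positivity))
  obtain ⟨c, g, hg, hgb, hsq, hc⟩ :=
    exists_coboundary_approx hd (fun z => hP.measurePreserving z) herg hπ hF hFb hρ
  set R : EnvSp d → ℝ := fun ω' => F ω' - (c + (g ω' - envAvg d g ω')) with hR_def
  have hR : Continuous R := hF.sub (continuous_const.add (hg.sub (continuous_envAvg hd hg)))
  have hRb : IsBdd d R := by
    obtain ⟨A, hA⟩ := hFb
    obtain ⟨B, hB⟩ := isBdd_sub_envAvg hd hgb c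
    exact ⟨A + B, fun ω' => (abs_sub _ _).trans (add_le_add (hA _) (hB _))⟩
  have hR2 : ∫ ω', R ω' ^ 2 * piOf d ω' 0 ∂P < δ / 3 ^ d := by
    rw [integral_Qmeas hd, ← hm_def, div_le_iff₀ hm] at hsq
    have h1 : min (ε / 3) (Real.sqrt (δ / (3 ^ d * (2 * m)))) ^ 2 ≤ δ / (3 ^ d * (2 * m)) := by
      calc _ ≤ Real.sqrt (δ / (3 ^ d * (2 * m))) ^ 2 :=
            pow_le_pow_left₀ hρ.le (min_le_right _ _) 2
        _ = _ := Real.sq_sqrt (by positivity)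
    calc _ ≤ _ := hsq
      _ ≤ δ / (3 ^ d * (2 * m)) * m := mul_le_mul_of_nonneg_right h1 hm.le
      _ = δ / 3 ^ d / 2 := by field_simp
      _ < δ / 3 ^ d := half_lt_self (by positivity)
  have hRN := hδN (fun x => R (shift d x ω)) (fun x => |R (shift d x ω)|) (fun _ => le_rfl) (by
    filter_upwards [eventually_sum_sq_mul_piOf_le hd hp hP hmom.1 hR hRb hR2] with n hn
    rw [div_mul_cancel₀ δ (by positivity)] at hn
    refine le_of_eq_of_le (Finset.sum_congr rfl fun x _ => ?_) hn
    rw [show cexp 0 = ((2 : ℕ) : ℝ) by norm_num [cexp], Real.rpow_natCast, sq_abs])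
  obtain ⟨K, hK⟩ := hgb
  have hcob := integral_abs_coboundary_le hd hμ (G := fun x => g (shift d x ω))
    (fun x => hK (shift d x ω))
  have hlim : ∀ᶠ N : ℕ in atTop, 2 * K * Real.sqrt N + 2 * K ≤ ε / 3 * N := by
    have hK0 : 0 ≤ K := (abs_nonneg _).trans (hK ω)
    obtain ⟨N₀, hN₀⟩ := exists_nat_ge ((4 * K / (ε / 3)) ^ 2)
    filter_upwards [eventually_ge_atTop (max N₀ 1)] with N hN
    have hN1 : (1 : ℝ) ≤ N := by exact_mod_cast (le_max_right _ _).trans hN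
    have hs1 : 1 ≤ Real.sqrt N := Real.one_le_sqrt.2 hN1
    have hs2 : 4 * K / (ε / 3) ≤ Real.sqrt N :=
      Real.le_sqrt_of_sq_le (hN₀.trans (by exact_mod_cast (le_max_left _ _).trans hN))
    rw [div_le_iff₀ hε3] at hs2
    calc 2 * K * Real.sqrt N + 2 * K ≤ 4 * K * Real.sqrt N := by nlinarith
      _ ≤ Real.sqrt N * (ε / 3) * Real.sqrt N :=
        mul_le_mul_of_nonneg_right hs2 (Real.sqrt_nonneg _)
      _ = ε / 3 * (Real.sqrt N * Real.sqrt N) := by ring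
      _ = ε / 3 * N := by rw [Real.mul_self_sqrt N.cast_nonneg]
  filter_upwards [hRN, hlim] with N hN1 hN2
  set S₁ : Path d → ℝ := fun w => |∑ k ∈ Finset.range N, R (shift d (w k) ω)| with hS₁
  set S₂ : Path d → ℝ := fun w => |∑ k ∈ Finset.range N, (g (shift d (w k) ω) -
    avgOp d ω (fun x => g (shift d x ω)) (w k))| with hS₂
  have i1 : Integrable S₁ μ :=
    (integrable_finsetSum _ fun n _ => integrable_walk hd hμ n fun x => R (shift d x ω)).abs
  have i2 : Integrable S₂ μ :=
    (integrable_finsetSum _ fun n _ => integrable_walk hd hμ n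
      fun x => g (shift d x ω) - avgOp d ω (fun x => g (shift d x ω)) x).abs
  have i12 : Integrable (fun w => S₁ w + S₂ w) μ := i1.add i2
  calc _ ≤ ∫ w, (S₁ w + S₂ w + ε / 3 * N) ∂μ := by
        refine integral_mono (integrable_finsetSum _ fun n _ => integrable_walk hd hμ n
          fun x => F (shift d x ω) - e).abs (i12.add (integrable_const _)) fun w => ?_
        have h1 : ∑ k ∈ Finset.range N, (F (shift d (w k) ω) - e) =
            ∑ k ∈ Finset.range N, R (shift d (w k) ω) +
            ∑ k ∈ Finset.range N, (g (shift d (w k) ω) -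
              avgOp d ω (fun x => g (shift d x ω)) (w k)) + N * (c - e) := by
          have h2 : (N : ℝ) * (c - e) = ∑ k ∈ Finset.range N, (c - e) := by
            rw [Finset.sum_const, Finset.card_range, nsmul_eq_mul]
          rw [h2, ← Finset.sum_add_distrib, ← Finset.sum_add_distrib]
          refine Finset.sum_congr rfl fun k _ => ?_
          simp only [hR_def, avgOp_shift]
          ring
        have h3 : |(N : ℝ) * (c - e)| ≤ ε / 3 * N := by
          rw [abs_mul, Nat.abs_cast, mul_comm, abs_sub_comm]
          exact mul_le_mul_of_nonneg_right (hc.trans (min_le_left _ _)) N.cast_nonneg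
        simp only [h1, hS₁, hS₂]
        exact (abs_add_three _ _ _).trans (add_le_add le_rfl h3)
    _ = ∫ w, S₁ w ∂μ + ∫ w, S₂ w ∂μ + ε / 3 * N := by
        rw [integral_add i12 (integrable_const _), integral_add i1 i2, integral_const,
          probReal_univ, one_smul]
    _ ≤ ε / 3 * N + ε / 3 * N + ε / 3 * N :=
        add_le_add (add_le_add hN1 ((hcob N).trans hN2)) le_rfl
    _ = ε * N := by ring

/-- STATEMENT 11 (Lemma 4.3): averaging along the walk for dominated functions. -/
theorem statement11 (d : ℕ) (hd : 1 ≤ d) (p q : ℝ) (hp : 1 < p) (hq : 1 < q)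
    (hpq : 2 ≤ d → 1 / p + 1 / q < 2 / (d : ℝ))
    (ω : EnvSp d) (hstar : InOmegaStar d ω) (hmom : InOmegaPQ d p q ω)
    (P : Measure (EnvSp d)) (hP : IsEnvLaw d ω P)
    (μ : Measure (Path d)) (hμ : IsWalkLaw d ω 0 μ)
    (f h : EnvSp d → ℝ) (hf : Continuous f) (hh : ∀ ω', 0 ≤ h ω')
    (hdom : ∀ ω', |f ω'| ≤ h ω') (α : ℝ) (hα : 1 < α)
    (hsum : ∃ C : ℝ, ∀ n : ℕ, 1 ≤ n →
        (∑ x ∈ box d (n : ℝ), h (shift d x ω) ^ α * piOf d ω x) / (n : ℝ) ^ d ≤ C) :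
    Integrable f (Qmeas d P) ∧
    Tendsto (fun n : ℕ =>
        ∫ w, |(∑ k ∈ Finset.range n, f (shift d (w k) ω)) / (n : ℝ) -
              ∫ ω', f ω' ∂(Qmeas d P)| ∂μ) atTop (𝓝 0) := by
  have := hμ.1
  obtain ⟨C, hC'⟩ := hsum
  have hC : ∀ n : ℕ, 1 ≤ n →
      ∑ x ∈ box d (n : ℝ), h (shift d x ω) ^ α * piOf d ω x ≤ C * (n : ℝ) ^ d := fun n hn => by
    have hn0 : (0 : ℝ) < n := by exact_mod_cast hn
    exact (div_le_iff₀ (by positivity)).1 (hC' n hn)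
  have hfi := integrable_Qmeas_of_dom hd hP (integrable_piOf hd hp hP hmom.1) hf hdom hα hC
  refine ⟨hfi, Metric.tendsto_atTop'.2 fun ε hε => ?_⟩
  have hε4 : 0 < ε / 4 := by positivity
  obtain ⟨M, hM, hMe⟩ := ((eventually_exists_clamp hd hp hq hpq hmom hμ hdom hα hC hε4).and
    ((tendsto_integral_clamp hf.measurable hfi).eventually
      (Metric.closedBall_mem_nhds _ hε4))).exists
  have hF := eventually_integral_abs_sum_sub_le hd hp hq hpq hmom hμ hP (hstar.2.2 P hP)
    ((continuous_clamp M).comp hf) ⟨M, fun ω' => abs_clamp_le M.cast_nonneg (f ω')⟩ hε4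
  simp only [Function.comp_apply] at hF
  set e := ∫ ω', f ω' ∂(Qmeas d P) with he
  set e' := ∫ ω', clamp M (f ω') ∂(Qmeas d P) with he'
  have hee : |e' - e| ≤ ε / 4 := hMe
  obtain ⟨N₀, hN₀⟩ := eventually_atTop.1 (hM.and hF)
  refine ⟨N₀, fun N hN => ?_⟩
  obtain ⟨h1, h2⟩ := hN₀ N hN.le
  have hNpos : (0 : ℝ) < N := by exact_mod_cast (Nat.zero_le _).trans_lt hN
  set S₁ : Path d → ℝ := fun w =>
    |∑ k ∈ Finset.range N, (f (shift d (w k) ω) - clamp M (f (shift d (w k) ω)))| with hS₁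
  set S₂ : Path d → ℝ := fun w =>
    |∑ k ∈ Finset.range N, (clamp M (f (shift d (w k) ω)) - e')| with hS₂
  have i1 : Integrable S₁ μ := (integrable_finsetSum _ fun n _ => integrable_walk hd hμ n
    fun x => f (shift d x ω) - clamp M (f (shift d x ω))).abs
  have i2 : Integrable S₂ μ := (integrable_finsetSum _ fun n _ => integrable_walk hd hμ n
    fun x => clamp M (f (shift d x ω)) - e').abs
  have i12 : Integrable (fun w => S₁ w + S₂ w) μ := i1.add i2
  rw [Real.dist_0_eq_abs, abs_of_nonneg (integral_nonneg fun _ => abs_nonneg _)]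
  calc _ ≤ ∫ w, ((S₁ w + S₂ w) / N + ε / 4) ∂μ := by
        refine integral_mono (((integrable_finsetSum _ fun n _ => integrable_walk hd hμ n
          fun x => f (shift d x ω)).div_const _).sub (integrable_const _)).abs
          ((i12.div_const _).add (integrable_const _)) fun w => ?_
        have h3 : (∑ k ∈ Finset.range N, f (shift d (w k) ω)) / (N : ℝ) - e =
            (∑ k ∈ Finset.range N, (f (shift d (w k) ω) - clamp M (f (shift d (w k) ω))) +
            ∑ k ∈ Finset.range N, (clamp M (f (shift d (w k) ω)) - e')) / N + (e' - e) := by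
          rw [← Finset.sum_add_distrib, Finset.sum_congr rfl fun k _ => sub_add_sub_cancel _ _ _,
            Finset.sum_sub_distrib, Finset.sum_const, Finset.card_range, nsmul_eq_mul]
          field_simp
          ring
        simp only [h3, hS₁, hS₂]
        refine (abs_add_le _ _).trans (add_le_add ?_ hee)
        rw [abs_div, Nat.abs_cast]
        exact div_le_div_of_nonneg_right (abs_add_le _ _) hNpos.le
    _ = (∫ w, S₁ w ∂μ + ∫ w, S₂ w ∂μ) / N + ε / 4 := by
        rw [integral_add (i12.div_const _) (integrable_const _), integral_div,
          integral_add i1 i2, integral_const, probReal_univ, one_smul]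
    _ ≤ (ε / 4 * N + ε / 4 * N) / N + ε / 4 :=
        add_le_add (div_le_div_of_nonneg_right (add_le_add h1 h2) hNpos.le) le_rfl
    _ = 3 * ε / 4 := by field_simp; ring
    _ < ε := by linarith


end DetCond
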